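/- Let Y = {y ∈ ℝ^m : h_j(y) = 0 (j ∈ E1Y), h_j(y) ≥ 0 (j ∈ E2Y)} with h = (h_1,...,h_{l2}), suppose there is a matrix polynomial H_1(y) with H_1(y)H(y) = I_{l2} for all y, and define μ(x,y) := H_1(y)_{:,1:m} ∇_y F(x,y). Fix x* ∈ ℝ^n and let φ_{x*} be the tuple of polynomials in y consisting of the entries of ∇_y F(x*,y) − Σ_{j} μ_j(x*,y) ∇h_j(y), together with h_j (j ∈ E1Y) and μ_j(x*,y)·h_j (j ∈ E2Y); let ψ_{x*} := (h_j, −μ_j(x*,y))_{j ∈ E2Y}, and set d_2 := ⌈max(deg φ_{x*}, deg ψ_{x*})/2⌉. Assume the problem max_{y ∈ Y} F(x*,y) has a maximizer, one of the following holds: IQ(h_eq, h_in) is archimedean, or φ_{x*}(y) = 0 has finitely many real solutions, or IQ(φ_{x*}, ψ_{x*}) is archimedean; and each maximizer of max_{y ∈ Y} F(x*,y) is an isolated real solution of φ_{x*}(y) = 0. Then for all k big enough, the order-k moment relaxation max { R_z(F(x*,·)) : z_0 = 1, M_k(z) ⪰ 0, L_{φ_{x*}}^{(k)}(z) = 0,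 L_{ψ_{x*}}^{(k)}(z) ⪰ 0 } over truncated multi-sequences z of degree 2k in m variables attains a maximizer, and every maximizer z* satisfies: there exists t with d_2 ≤ t ≤ k such that rank M_t(z*) = rank M_{t−d_2}(z*). -/

import Mathlib

open MvPolynomial

noncomputable section

/-- Index set for rows/columns of moment and localizing matrices:
(exponent vectors of) monomials in the variables `σ` of degree at most `t`. -/
abbrev MomIdx (σ : Type) [Fintype σ] [DecidableEq σ] (t : ℕ) : Type :=
  {v : σ → Fin (t + 1) // ∑ i, (v i : ℕ) ≤ t}

/-- The exponent vector of a moment-matrix index. -/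
def MomIdx.exp {σ : Type} [Fintype σ] [DecidableEq σ] {t : ℕ} (v : MomIdx σ t) : σ →₀ ℕ :=
  Finsupp.equivFunOnFinite.symm fun i => (v.1 i : ℕ)

/-- The Riesz functional of a (truncated) multi-sequence `w`, acting on a polynomial:
`R_w (Σ f_α ξ^α) = Σ f_α w_α`. -/
def riesz {σ : Type} (w : (σ →₀ ℕ) → ℝ) (f : MvPolynomial σ ℝ) : ℝ :=
  ∑ α ∈ f.support, f.coeff α * w α

/-- The order-`k` localizing matrix `L_q^{(k)}(w)` of the polynomial `q`, generated by
`w`: rows and columns are indexed by monomials of degree `≤ k − ⌈deg(q)/2⌉`, and the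
`(α, β)` entry is `R_w(q · ξ^α · ξ^β)`. -/
def locMat {σ : Type} [Fintype σ] [DecidableEq σ] (k : ℕ) (q : MvPolynomial σ ℝ)
    (w : (σ →₀ ℕ) → ℝ) :
    Matrix (MomIdx σ (k - (q.totalDegree + 1) / 2)) (MomIdx σ (k - (q.totalDegree + 1) / 2)) ℝ :=
  Matrix.of fun a b => riesz w (q * monomial (a.exp + b.exp) 1)

/-- The order-`t` moment matrix `M_t(w)` generated by `w`. -/
def momMat {σ : Type} [Fintype σ] [DecidableEq σ] (t : ℕ) (w : (σ →₀ ℕ) → ℝ) :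
    Matrix (MomIdx σ t) (MomIdx σ t) ℝ :=
  Matrix.of fun a b => w (a.exp + b.exp)

/-- Feasibility for the order-`k` Lasserre moment relaxation with equality
constraints `φ` and inequality constraints `ψ`:
`w₀ = 1`, `M_k(w) ⪰ 0`, `L_φ^{(k)}(w) = 0` and `L_ψ^{(k)}(w) ⪰ 0`. -/
def RelaxFeasible {σ : Type} [Fintype σ] [DecidableEq σ] {ι κ : Type*} (k : ℕ)
    (φ : ι → MvPolynomial σ ℝ) (ψ : κ → MvPolynomial σ ℝ) (w : (σ →₀ ℕ) → ℝ) : Prop :=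
  w 0 = 1 ∧ (momMat k w).PosSemidef ∧ (∀ i, locMat k (φ i) w = 0) ∧
    ∀ j, (locMat k (ψ j) w).PosSemidef

/-- A sum of squares of polynomials. -/
def IsSOS {σ : Type} (p : MvPolynomial σ ℝ) : Prop :=
  ∃ (t : ℕ) (s : Fin t → MvPolynomial σ ℝ), p = ∑ i, s i ^ 2


/-- Membership in `IQ(φ,ψ) = Ideal(φ) + Qmod(ψ)`. -/
def InIQ {σ : Type} {ι κ : Type*} [Fintype ι] [Fintype κ]
    (φ : ι → MvPolynomial σ ℝ) (ψ : κ → MvPolynomial σ ℝ) (f : MvPolynomial σ ℝ) : Prop :=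
  ∃ (p : ι → MvPolynomial σ ℝ) (σ0 : MvPolynomial σ ℝ) (σs : κ → MvPolynomial σ ℝ),
    IsSOS σ0 ∧ (∀ j, IsSOS (σs j)) ∧ f = ∑ i, φ i * p i + σ0 + ∑ j, ψ j * σs j

/-- `IQ(φ,ψ)` is archimedean: it contains some `σ` whose nonnegativity set is compact. -/
def IsArchimedean {σ : Type} [Fintype σ] {ι κ : Type*} [Fintype ι] [Fintype κ]
    (φ : ι → MvPolynomial σ ℝ) (ψ : κ → MvPolynomial σ ℝ) : Prop :=
  ∃ σ0 : MvPolynomial σ ℝ, InIQ φ ψ σ0 ∧ IsCompact {z : σ → ℝ | 0 ≤ eval z σ0}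

/-- The matrix `H(y)` associated with a tuple `h` of constraining polynomials:
its `j`-th column is `(∇h_j(y); h_j(y)·e_j)`. -/
def Hmat {m l : ℕ} (h : Fin l → MvPolynomial (Fin m) ℝ) (y : Fin m → ℝ) :
    Matrix (Fin m ⊕ Fin l) (Fin l) ℝ :=
  Matrix.of fun r c =>
    match r with
    | Sum.inl j => eval y (pderiv j (h c))
    | Sum.inr j => if j = c then eval y (h c) else 0

/-- The semialgebraic set `Y = {y : hⱼ(y) = 0 (j ∈ E1Y), hⱼ(y) ≥ 0 (j ∈ E2Y)}`. -/
def SemiSet {m l : ℕ} (E1 E2 : Finset (Fin l)) (h : Fin l → MvPolynomial (Fin m) ℝ) :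
    Set (Fin m → ℝ) :=
  {y | (∀ j ∈ E1, eval y (h j) = 0) ∧ ∀ j ∈ E2, 0 ≤ eval y (h j)}

/-- The polynomial `F(x*, y)`, as a polynomial in `y` only. -/
def Fsub {n m : ℕ} (F : MvPolynomial (Fin n ⊕ Fin m) ℝ) (xstar : Fin n → ℝ) :
    MvPolynomial (Fin m) ℝ :=
  aeval (Sum.elim (fun i => (C (xstar i) : MvPolynomial (Fin m) ℝ)) fun j => X j) F

/-- The Lagrange polynomials `μⱼ(x*, y) = H₁(y)_{j,1:m} ∇_y F(x*, y)`, as polynomials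
in `y`, for a polynomial `fx = F(x*, ·)`. -/
def muSub {m l2 : ℕ} (H1 : Matrix (Fin l2) (Fin m ⊕ Fin l2) (MvPolynomial (Fin m) ℝ))
    (fx : MvPolynomial (Fin m) ℝ) (j : Fin l2) : MvPolynomial (Fin m) ℝ :=
  ∑ j' : Fin m, H1 j (Sum.inl j') * pderiv j' fx

/-- The tuple `φ_{x*}` of equality constraining polynomials (4.16):
the entries of `∇_yF(x*,y) − Σⱼ μⱼ(x*,y) ∇hⱼ(y)`, together with `hⱼ (j ∈ E1Y)` and
`μⱼ(x*,y)·hⱼ (j ∈ E2Y)`. -/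
def phiUp {m l2 : ℕ} (E1Y E2Y : Finset (Fin l2)) (h : Fin l2 → MvPolynomial (Fin m) ℝ)
    (H1 : Matrix (Fin l2) (Fin m ⊕ Fin l2) (MvPolynomial (Fin m) ℝ))
    (fx : MvPolynomial (Fin m) ℝ) : Fin m ⊕ (↥E1Y ⊕ ↥E2Y) → MvPolynomial (Fin m) ℝ
  | Sum.inl j' => pderiv j' fx - ∑ j, muSub H1 fx j * pderiv j' (h j)
  | Sum.inr (Sum.inl j) => h j.1
  | Sum.inr (Sum.inr j) => muSub H1 fx j.1 * h j.1

/-- The tuple `ψ_{x*}` of inequality constraining polynomials (4.17):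
`(hⱼ, −μⱼ(x*,y))` for `j ∈ E2Y`. -/
def psiUp {m l2 : ℕ} (E2Y : Finset (Fin l2)) (h : Fin l2 → MvPolynomial (Fin m) ℝ)
    (H1 : Matrix (Fin l2) (Fin m ⊕ Fin l2) (MvPolynomial (Fin m) ℝ))
    (fx : MvPolynomial (Fin m) ℝ) : ↥E2Y ⊕ ↥E2Y → MvPolynomial (Fin m) ℝ
  | Sum.inl j => h j.1
  | Sum.inr j => -muSub H1 fx j.1

/-- `d₂ = ⌈max(deg φ_{x*}, deg ψ_{x*})/2⌉`. -/
def dUp {m l2 : ℕ} (E1Y E2Y : Finset (Fin l2)) (h : Fin l2 → MvPolynomial (Fin m) ℝ)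
    (H1 : Matrix (Fin l2) (Fin m ⊕ Fin l2) (MvPolynomial (Fin m) ℝ))
    (fx : MvPolynomial (Fin m) ℝ) : ℕ :=
  (((Finset.univ.sup fun idx => (phiUp E1Y E2Y h H1 fx idx).totalDegree) ⊔
    (Finset.univ.sup fun idx => (psiUp E2Y h H1 fx idx).totalDegree)) + 1) / 2

/-- A subset of a commutative ring closed under addition and multiplication that contains all
squares. -/
structure IsPreord {B : Type*} [CommRing B] (T : Set B) : Prop where
  add : ∀ {a b}, a ∈ T → b ∈ T → a + b ∈ T
  mul : ∀ {a b}, a ∈ T → b ∈ T → a * b ∈ T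
  sq : ∀ a, a * a ∈ T

/-- A total preordering with proper prime support. -/
structure IsPrimeCone {B : Type*} [CommRing B] (P : Set B) : Prop extends IsPreord P where
  total : ∀ a, a ∈ P ∨ -a ∈ P
  neg_one : -1 ∉ P
  prime : ∀ {a b}, a * b ∈ P → -(a * b) ∈ P → (a ∈ P ∧ -a ∈ P) ∨ (b ∈ P ∧ -b ∈ P)

namespace IsPreord

variable {B : Type*} [CommRing B] {T : Set B}

theorem zero (hT : IsPreord T) : (0 : B) ∈ T := by simpa using hT.sq 0

theorem one (hT : IsPreord T) : (1 : B) ∈ T := by simpa using hT.sq 1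

theorem even_pow (hT : IsPreord T) (q : B) (N : ℕ) : q ^ (2 * N) ∈ T := by
  have := hT.sq (q ^ N)
  rwa [← pow_add, ← two_mul] at this

/-- Adjoining an element to a preordering. -/
theorem adjoin (hT : IsPreord T) (a : B) : IsPreord {x | ∃ s ∈ T, ∃ t ∈ T, x = s + a * t} where
  add := by
    rintro _ _ ⟨s, hs, t, ht, rfl⟩ ⟨s', hs', t', ht', rfl⟩
    exact ⟨_, hT.add hs hs', _, hT.add ht ht', by ring⟩
  mul := by
    rintro _ _ ⟨s, hs, t, ht, rfl⟩ ⟨s', hs', t', ht', rfl⟩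
    exact ⟨_, hT.add (hT.mul hs hs') (hT.mul (hT.sq a) (hT.mul ht ht')), _,
      hT.add (hT.mul hs ht') (hT.mul ht hs'), by ring⟩
  sq x := ⟨_, hT.sq x, 0, hT.zero, by ring⟩

theorem subset_adjoin (hT : IsPreord T) (a : B) :
    T ⊆ {x | ∃ s ∈ T, ∃ t ∈ T, x = s + a * t} :=
  fun s hs => ⟨s, hs, 0, hT.zero, by ring⟩

theorem mem_adjoin (hT : IsPreord T) (a : B) : a ∈ {x | ∃ s ∈ T, ∃ t ∈ T, x = s + a * t} :=
  ⟨0, hT.zero, 1, hT.one, by ring⟩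

/-- A preordering containing no `-q ^ (2 * N)` extends to a prime cone whose support avoids `q`. -/
theorem exists_isPrimeCone (hT : IsPreord T) (q : B) (hq : ∀ N : ℕ, -(q ^ (2 * N)) ∉ T) :
    ∃ P, T ⊆ P ∧ IsPrimeCone P ∧ ¬ (q ∈ P ∧ -q ∈ P) := by
  obtain ⟨P, hTP, hmax⟩ := zorn_subset_nonempty
    {P : Set B | IsPreord P ∧ ∀ N : ℕ, -(q ^ (2 * N)) ∉ P} (by
      intro c hc hchain hne
      refine ⟨⋃₀ c, ⟨⟨?_, ?_, ?_⟩, ?_⟩, fun s hs => Set.subset_sUnion_of_mem hs⟩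
      · rintro a b ⟨s, hs, ha⟩ ⟨t, ht, hb⟩
        rcases hchain.total hs ht with h | h
        · exact ⟨t, ht, (hc ht).1.add (h ha) hb⟩
        · exact ⟨s, hs, (hc hs).1.add ha (h hb)⟩
      · rintro a b ⟨s, hs, ha⟩ ⟨t, ht, hb⟩
        rcases hchain.total hs ht with h | h
        · exact ⟨t, ht, (hc ht).1.mul (h ha) hb⟩
        · exact ⟨s, hs, (hc hs).1.mul ha (h hb)⟩
      · intro a
        obtain ⟨s, hs⟩ := hne
        exact ⟨s, hs, (hc hs).1.sq a⟩
      · rintro N ⟨s, hs, h⟩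
        exact (hc hs).2 N h) T ⟨hT, hq⟩
  obtain ⟨hP, hqP⟩ := hmax.prop
  have key : ∀ a, a ∉ P → ∃ N : ℕ, ∃ s ∈ P, ∃ t ∈ P, -(q ^ (2 * N)) = s + a * t := by
    intro a ha
    by_contra! hcon
    exact ha (hmax.le_of_ge (y := {x | ∃ s ∈ P, ∃ t ∈ P, x = s + a * t})
      ⟨hP.adjoin a, fun N ⟨s, hs, t, ht, h⟩ => hcon N s hs t ht h⟩ (hP.subset_adjoin a)
      (hP.mem_adjoin a))
  have total : ∀ a, a ∈ P ∨ -a ∈ P := by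
    intro a
    by_contra! hcon
    obtain ⟨N, s, hs, t, ht, h1⟩ := key a hcon.1
    obtain ⟨N', s', hs', t', ht', h2⟩ := key (-a) hcon.2
    refine hqP (N + N') ?_
    have : -(q ^ (2 * (N + N'))) = a * a * (t * t') + q ^ (2 * N) * s' + s * q ^ (2 * N')
        + s * s' := by
      rw [mul_add, pow_add]
      linear_combination (q ^ (2 * N') + s') * h1 - (a * t) * h2
    rw [this]
    exact hP.add (hP.add (hP.add (hP.mul (hP.sq a) (hP.mul ht ht'))
      (hP.mul (hP.even_pow q N) hs')) (hP.mul hs (hP.even_pow q N'))) (hP.mul hs hs')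
  have prime : ∀ {a b}, a * b ∈ P → -(a * b) ∈ P → -a ∉ P → -b ∉ P → False := by
    intro a b hab hab' ha hb
    obtain ⟨N, s, hs, t, ht, h1⟩ := key (-a) ha
    obtain ⟨N', s', hs', t', ht', h2⟩ := key (-b) hb
    refine hqP (N + N') ?_
    have : -(q ^ (2 * (N + N'))) = -(a * b) * (t * t') + q ^ (2 * N) * s' + s * q ^ (2 * N')
        + s * s' := by
      rw [mul_add, pow_add]
      linear_combination (q ^ (2 * N') + s') * h1 + (a * t) * h2
    rw [this]
    exact hP.add (hP.add (hP.add (hP.mul hab' (hP.mul ht ht'))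
      (hP.mul (hP.even_pow q N) hs')) (hP.mul hs (hP.even_pow q N'))) (hP.mul hs hs')
  refine ⟨P, hTP, ⟨hP, total, fun h => ?_, fun {a b} h h' => ?_⟩, fun h => ?_⟩
  · have := hP.mul (hP.sq q) h
    exact hqP 1 (by simpa [pow_two] using this)
  · by_contra! hcon
    rcases total a with ha | ha <;> rcases total b with hb | hb
    · exact prime h h' (hcon.1 ha) (hcon.2 hb)
    · exact prime (a := a) (b := -b) (by simpa using h') (by simpa using h) (hcon.1 ha)
        (by simpa using fun hb' => hcon.2 hb' hb)
    · exact prime (a := -a) (b := b) (by simpa using h') (by simpa using h)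
        (by simpa using fun ha' => hcon.1 ha' ha) (hcon.2 hb)
    · exact prime (a := -a) (b := -b) (by simpa using h) (by simpa using h')
        (by simpa using fun ha' => hcon.1 ha' ha) (by simpa using fun hb' => hcon.2 hb' hb)
  · refine hqP 1 ?_
    have := hP.mul h.1 h.2
    simpa [pow_two] using this

end IsPreord

/-- The intermediate value property for polynomials over an ordered field. -/
def HasPolyIVT (R : Type*) [Field R] [LinearOrder R] : Prop :=
  ∀ (p : Polynomial R) (a b : R), a ≤ b → p.eval a ≤ 0 → 0 ≤ p.eval b →
    ∃ c, a ≤ c ∧ c ≤ b ∧ p.eval c = 0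

section SignChange

variable {K : Type*} [Field K] [LinearOrder K]

/-- Sums of squares of polynomials with nonnegative constant weights. -/
def weightedSOS (K : Type*) [Field K] [LinearOrder K] : AddSubmonoid (Polynomial K) :=
  AddSubmonoid.closure {x | ∃ c : K, 0 ≤ c ∧ ∃ g : Polynomial K, x = Polynomial.C c * (g * g)}

theorem mem_weightedSOS {c : K} (hc : 0 ≤ c) (g : Polynomial K) :
    Polynomial.C c * (g * g) ∈ weightedSOS K :=
  AddSubmonoid.subset_closure ⟨c, hc, g, rfl⟩

theorem weightedSOS_reduce {f : Polynomial K} (hf : f.natDegree ≠ 0) {x : Polynomial K}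
    (hx : x ∈ weightedSOS K) :
    ∃ y ∈ weightedSOS K, f ∣ x - y ∧ y.natDegree ≤ 2 * (f.natDegree - 1) := by
  induction hx using AddSubmonoid.closure_induction with
  | zero => exact ⟨0, zero_mem _, by simp, by simp⟩
  | add a b _ _ ha hb =>
    obtain ⟨y, hy, hd, hn⟩ := ha
    obtain ⟨z, hz, hd', hn'⟩ := hb
    exact ⟨y + z, add_mem hy hz, by simpa [add_sub_add_comm] using dvd_add hd hd',
      (Polynomial.natDegree_add_le _ _).trans (max_le hn hn')⟩
  | mem a ha =>
    obtain ⟨c, hc, g, rfl⟩ := ha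
    refine ⟨_, mem_weightedSOS hc (g % f), ?_, ?_⟩
    · have : f ∣ g - g % f :=
        ⟨g / f, by rw [sub_eq_iff_eq_add]; exact (EuclideanDomain.div_add_mod g f).symm⟩
      have h2 : Polynomial.C c * (g * g) - Polynomial.C c * (g % f * (g % f)) =
        (g - g % f) * (Polynomial.C c * (g + g % f)) := by ring
      rw [h2]
      exact dvd_mul_of_dvd_left this _
    · have h1 := Polynomial.natDegree_mod_lt g hf
      refine (Polynomial.natDegree_C_mul_le _ _).trans (Polynomial.natDegree_mul_le.trans ?_)
      omega

variable [IsStrictOrderedRing K]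

theorem weightedSOS_mul {x y : Polynomial K} (hx : x ∈ weightedSOS K) (hy : y ∈ weightedSOS K) :
    x * y ∈ weightedSOS K := by
  induction hx using AddSubmonoid.closure_induction with
  | zero => simp
  | add a b _ _ ha hb => simpa [add_mul] using add_mem ha hb
  | mem a ha =>
    obtain ⟨c, hc, g, rfl⟩ := ha
    induction hy using AddSubmonoid.closure_induction with
    | zero => simp
    | add a b _ _ ha hb => simpa [mul_add] using add_mem ha hb
    | mem b hb =>
      obtain ⟨d, hd, k, rfl⟩ := hb
      have := mem_weightedSOS (mul_nonneg hc hd) (g * k)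
      rw [Polynomial.C_mul] at this
      convert this using 1
      ring

theorem weightedSOS_eval_nonneg {x : Polynomial K} (hx : x ∈ weightedSOS K) (a : K) :
    0 ≤ x.eval a := by
  induction hx using AddSubmonoid.closure_induction with
  | zero => simp
  | add a b _ _ ha hb => simpa using add_nonneg ha hb
  | mem a ha =>
    obtain ⟨c, hc, g, rfl⟩ := ha
    simpa using mul_nonneg hc (mul_self_nonneg _)

/-- A polynomial that changes sign does not divide `1 + s` for a weighted sum of squares `s`. -/
theorem mul_ne_one_add_weightedSOS {f : Polynomial K} {a b : K} (hab : f.eval a * f.eval b < 0)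
    {s : Polynomial K} (hs : s ∈ weightedSOS K) (h : Polynomial K) : f * h ≠ 1 + s := by
  induction hn : f.natDegree using Nat.strong_induction_on generalizing f s h with
  | _ n ih =>
    intro heq
    have hf : f.natDegree ≠ 0 := by
      intro h0
      rw [Polynomial.eq_C_of_natDegree_eq_zero h0] at hab
      simp only [Polynomial.eval_C] at hab
      exact absurd hab (not_lt.2 (mul_self_nonneg _))
    obtain ⟨y, hy, ⟨w, hw⟩, hdeg⟩ := weightedSOS_reduce hf hs
    have heq' : f * (h - w) = 1 + y := by rw [mul_sub, heq, ← hw]; ring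
    have hpos : ∀ c, 0 < f.eval c * (h - w).eval c := fun c => by
      rw [← Polynomial.eval_mul, heq']
      have := weightedSOS_eval_nonneg hy c
      simp only [Polynomial.eval_add, Polynomial.eval_one]
      positivity
    have hne : h - w ≠ 0 := fun h0 => by
      have := hpos a
      simp [h0] at this
    have hfne : f ≠ 0 := fun h0 => hf (by simp [h0])
    have hd : f.natDegree + (h - w).natDegree ≤ 2 * (f.natDegree - 1) := by
      rw [← Polynomial.natDegree_mul hfne hne, heq']
      refine (Polynomial.natDegree_add_le _ _).trans (max_le (by simp) hdeg)
    refine ih (h - w).natDegree (by omega) (f := h - w) ?_ hy f rfl (by rw [mul_comm]; exact heq')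
    have := mul_pos (hpos a) (hpos b)
    by_contra! hcon
    nlinarith

theorem isPreord_weightedSOS_add_span (f : Polynomial K) :
    IsPreord {x | ∃ s ∈ weightedSOS K, ∃ h, x = s + f * h} where
  add := by
    rintro _ _ ⟨s, hs, h, rfl⟩ ⟨s', hs', h', rfl⟩
    exact ⟨_, add_mem hs hs', h + h', by ring⟩
  mul := by
    rintro _ _ ⟨s, hs, h, rfl⟩ ⟨s', hs', h', rfl⟩
    exact ⟨_, weightedSOS_mul hs hs', s * h' + h * s' + f * h * h', by ring⟩
  sq g := ⟨_, mem_weightedSOS zero_le_one g, 0, by simp⟩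

end SignChange

/-- A subsemiring `P` of a field with `P ∩ -P = 0` that totally orders `P - P`. -/
structure IsTotalCone {Ω : Type*} [Field Ω] (P : Set Ω) : Prop where
  add : ∀ {a b}, a ∈ P → b ∈ P → a + b ∈ P
  mul : ∀ {a b}, a ∈ P → b ∈ P → a * b ∈ P
  one : 1 ∈ P
  pointed : ∀ {a}, a ∈ P → -a ∈ P → a = 0
  total : ∀ {a b}, a ∈ P → b ∈ P → a - b ∈ P ∨ b - a ∈ P

namespace IsTotalCone

variable {Ω : Type*} [Field Ω] {P : Set Ω}

theorem zero (hP : IsTotalCone P) : (0 : Ω) ∈ P := by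
  simpa using hP.total hP.one hP.one

theorem _root_.IsPrimeCone.isTotalCone_image {B : Type*} [CommRing B] {Q : Set B}
    (hQ : IsPrimeCone Q) (f : B →+* Ω) (hf : ∀ x, f x = 0 → x ∈ Q ∧ -x ∈ Q)
    (hf' : ∀ x, x ∈ Q → -x ∈ Q → f x = 0) :
    IsTotalCone (f '' Q) where
  add := by
    rintro _ _ ⟨a, ha, rfl⟩ ⟨b, hb, rfl⟩
    exact ⟨_, hQ.add ha hb, by simp⟩
  mul := by
    rintro _ _ ⟨a, ha, rfl⟩ ⟨b, hb, rfl⟩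
    exact ⟨_, hQ.mul ha hb, by simp⟩
  one := ⟨1, hQ.one, by simp⟩
  pointed := by
    rintro _ ⟨a, ha, rfl⟩ ⟨b, hb, hab⟩
    have h := (hf (a + b) (by simp [hab])).2
    refine hf' a ha ?_
    have := hQ.add h hb
    simpa using this
  total := by
    rintro _ _ ⟨a, ha, rfl⟩ ⟨b, hb, rfl⟩
    rcases hQ.total (a - b) with h | h
    · exact Or.inl ⟨_, h, by simp⟩
    · exact Or.inr ⟨_, h, by simp⟩

theorem exists_maximal (hP : IsTotalCone P) :
    ∃ M, P ⊆ M ∧ Maximal (fun M : Set Ω => IsTotalCone M) M := by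
  refine zorn_subset_nonempty {M : Set Ω | IsTotalCone M} ?_ P hP
  intro c hc hchain hne
  have key : ∀ {a b}, a ∈ ⋃₀ c → b ∈ ⋃₀ c → ∃ s ∈ c, a ∈ s ∧ b ∈ s := by
    rintro a b ⟨s, hs, ha⟩ ⟨t, ht, hb⟩
    rcases hchain.total hs ht with h | h
    · exact ⟨t, ht, h ha, hb⟩
    · exact ⟨s, hs, ha, h hb⟩
  refine ⟨⋃₀ c, ⟨?_, ?_, ?_, ?_, ?_⟩, fun s hs => Set.subset_sUnion_of_mem hs⟩
  · intro a b ha hb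
    obtain ⟨s, hs, ha, hb⟩ := key ha hb
    exact ⟨s, hs, (hc hs).add ha hb⟩
  · intro a b ha hb
    obtain ⟨s, hs, ha, hb⟩ := key ha hb
    exact ⟨s, hs, (hc hs).mul ha hb⟩
  · obtain ⟨s, hs⟩ := hne
    exact ⟨s, hs, (hc hs).one⟩
  · intro a ha hb
    obtain ⟨s, hs, ha, hb⟩ := key ha hb
    exact (hc hs).pointed ha hb
  · intro a b ha hb
    obtain ⟨s, hs, ha, hb⟩ := key ha hb
    exact ((hc hs).total ha hb).imp (fun h => ⟨s, hs, h⟩) (fun h => ⟨s, hs, h⟩)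

/-- A maximal total cone is closed under inverses. -/
theorem inv_mem_of_maximal (hmax : Maximal (fun M : Set Ω => IsTotalCone M) P) {x : Ω}
    (hx : x ∈ P) : x⁻¹ ∈ P := by
  have hP := hmax.prop
  rcases eq_or_ne x 0 with rfl | hx0
  · simpa using hx
  refine hmax.le_of_ge (y := {x | ∃ y ∈ P, y ≠ 0 ∧ x * y ∈ P}) ⟨?_, ?_, ?_, ?_, ?_⟩
    (fun x hx => ⟨1, hP.one, one_ne_zero, by simpa using hx⟩)
    ⟨x, hx, hx0, by simpa [hx0] using hP.one⟩
  · rintro a b ⟨y, hy, hy0, hay⟩ ⟨z, hz, hz0, hbz⟩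
    refine ⟨_, hP.mul hy hz, mul_ne_zero hy0 hz0, ?_⟩
    convert hP.add (hP.mul hay hz) (hP.mul hbz hy) using 1
    ring
  · rintro a b ⟨y, hy, hy0, hay⟩ ⟨z, hz, hz0, hbz⟩
    refine ⟨_, hP.mul hy hz, mul_ne_zero hy0 hz0, ?_⟩
    convert hP.mul hay hbz using 1
    ring
  · exact ⟨1, hP.one, one_ne_zero, by simpa using hP.one⟩
  · rintro a ⟨y, hy, hy0, hay⟩ ⟨z, hz, hz0, hbz⟩
    have := hP.pointed (a := a * y * z) (hP.mul hay hz) (by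
      convert hP.mul hbz hy using 1
      ring)
    simpa [hy0, hz0] using this
  · rintro a b ⟨y, hy, hy0, hay⟩ ⟨z, hz, hz0, hbz⟩
    refine (hP.total (hP.mul hay hz) (hP.mul hbz hy)).imp (fun h => ?_) (fun h => ?_)
    · refine ⟨_, hP.mul hy hz, mul_ne_zero hy0 hz0, ?_⟩
      convert h using 1
      ring
    · refine ⟨_, hP.mul hy hz, mul_ne_zero hy0 hz0, ?_⟩
      convert h using 1
      ring

/-- The subfield totally ordered by a maximal total cone. -/
def subfield (hmax : Maximal (fun M : Set Ω => IsTotalCone M) P) : Subfield Ω where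
  carrier := {x | x ∈ P ∨ -x ∈ P}
  zero_mem' := Or.inl hmax.prop.zero
  one_mem' := Or.inl hmax.prop.one
  neg_mem' := by
    rintro x (h | h)
    · exact Or.inr (by simpa using h)
    · exact Or.inl h
  add_mem' := by
    have hP := hmax.prop
    rintro a b (ha | ha) (hb | hb)
    · exact Or.inl (hP.add ha hb)
    · simpa [add_comm, sub_eq_add_neg] using hP.total ha hb
    · simpa [add_comm, sub_eq_add_neg] using hP.total hb ha
    · exact Or.inr (by simpa [add_comm] using hP.add ha hb)
  mul_mem' := by
    have hP := hmax.prop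
    rintro a b (ha | ha) (hb | hb)
    · exact Or.inl (hP.mul ha hb)
    · exact Or.inr (by simpa using hP.mul ha hb)
    · exact Or.inr (by simpa using hP.mul ha hb)
    · exact Or.inl (by simpa using hP.mul ha hb)
  inv_mem' := by
    rintro a (ha | ha)
    · exact Or.inl (inv_mem_of_maximal hmax ha)
    · exact Or.inr (by simpa [inv_neg] using inv_mem_of_maximal hmax ha)

open Classical in
/-- The order on the subfield defined by a maximal total cone. -/
abbrev linearOrder (hmax : Maximal (fun M : Set Ω => IsTotalCone M) P) :
    LinearOrder (subfield hmax) where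
  le x y := (y : Ω) - x ∈ P
  le_refl x := by simpa using hmax.prop.zero
  le_trans x y z h h' := by simpa using hmax.prop.add h h'
  le_antisymm x y h h' := by
    have := hmax.prop.pointed h (by simpa using h')
    exact Subtype.ext (sub_eq_zero.1 this).symm
  le_total x y := by
    rcases (y - x).2 with h | h
    · exact Or.inl h
    · exact Or.inr (by simpa using h)
  toDecidableLE := inferInstance

theorem isStrictOrderedRing (hmax : Maximal (fun M : Set Ω => IsTotalCone M) P) :
    letI := linearOrder hmax
    IsStrictOrderedRing (subfield hmax) := by
  let _ := linearOrder hmax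
  have key : ∀ x y : subfield hmax, x ≤ y ↔ (y : Ω) - x ∈ P := fun x y => Iff.rfl
  have : IsOrderedAddMonoid (subfield hmax) :=
    { add_le_add_left := fun a b h c => by
        rw [key] at h ⊢
        simpa using h }
  have : ZeroLEOneClass (subfield hmax) :=
    ⟨by rw [key]; simpa using hmax.prop.one⟩
  have : IsOrderedRing (subfield hmax) := .of_mul_nonneg fun x y hx hy => by
    rw [key] at hx hy ⊢
    simpa using hmax.prop.mul (by simpa using hx) (by simpa using hy)
  exact IsOrderedRing.toIsStrictOrderedRing _

end IsTotalCone

theorem IsPrimeCone.supp_mul {B : Type*} [CommRing B] {Q : Set B} (hQ : IsPrimeCone Q) {x : B}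
    (hx : x ∈ Q) (hx' : -x ∈ Q) (v : B) : v * x ∈ Q := by
  rcases hQ.total v with h | h
  · exact hQ.mul h hx
  · simpa using hQ.mul h hx'

/-- The support of a prime cone. -/
def IsPrimeCone.supp {B : Type*} [CommRing B] {Q : Set B} (hQ : IsPrimeCone Q) : Ideal B where
  carrier := {x | x ∈ Q ∧ -x ∈ Q}
  zero_mem' := by simpa using hQ.zero
  add_mem' := fun ⟨ha, ha'⟩ ⟨hb, hb'⟩ => ⟨hQ.add ha hb, by simpa [add_comm] using hQ.add ha' hb'⟩
  smul_mem' := fun c x ⟨hx, hx'⟩ =>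
    ⟨hQ.supp_mul hx hx' c, by simpa using hQ.supp_mul hx hx' (-c)⟩

theorem IsPrimeCone.supp_isPrime {B : Type*} [CommRing B] {Q : Set B} (hQ : IsPrimeCone Q) :
    hQ.supp.IsPrime where
  ne_top' h := hQ.neg_one (((Ideal.eq_top_iff_one _).1 h).2)
  mem_or_mem' := fun ⟨h, h'⟩ => hQ.prime h h'

namespace IsTotalCone

variable {Ω : Type*} [Field Ω] {P : Set Ω}

theorem exists_root_of_irreducible [IsAlgClosed Ω]
    (hmax : Maximal (fun M : Set Ω => IsTotalCone M) P)
    {f : Polynomial (subfield hmax)} (hf : Irreducible f) {a b : subfield hmax}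
    (hab : letI := linearOrder hmax; f.eval a * f.eval b < 0) : ∃ c, f.eval c = 0 := by
  let _ := linearOrder hmax
  have := isStrictOrderedRing hmax
  obtain ⟨θ, hθ⟩ := IsAlgClosed.exists_aeval_eq_zero Ω f
    (Polynomial.degree_pos_of_irreducible hf).ne'
  have hT := isPreord_weightedSOS_add_span f
  obtain ⟨Q, hTQ, hQ, -⟩ := hT.exists_isPrimeCone 1 (by
    rintro N ⟨s, hs, h, hsh⟩
    refine mul_ne_one_add_weightedSOS hab hs (-h) ?_
    simp only [one_pow] at hsh
    linear_combination hsh)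
  have hfQ : f ∈ hQ.supp :=
    ⟨hTQ ⟨0, zero_mem _, 1, by simp⟩, hTQ ⟨0, zero_mem _, -1, by simp⟩⟩
  have hker : ∀ x : Polynomial (subfield hmax), Polynomial.aeval θ x = 0 → x ∈ hQ.supp := by
    intro x hx
    have : f ∣ x := by
      by_contra hcon
      obtain ⟨u, v, huv⟩ := (hf.coprime_iff_not_dvd).2 hcon
      have := congrArg (Polynomial.aeval θ) huv
      simp [hx, hθ] at this
    obtain ⟨g, rfl⟩ := this
    exact Ideal.mul_mem_right _ _ hfQ
  have hker' : ∀ x : Polynomial (subfield hmax), x ∈ hQ.supp → Polynomial.aeval θ x = 0 := by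
    intro x hx
    have : f ∣ x := by
      by_contra hcon
      obtain ⟨u, v, huv⟩ := (hf.coprime_iff_not_dvd).2 hcon
      have h1 : (1 : Polynomial (subfield hmax)) ∈ hQ.supp := by
        rw [← huv]
        exact add_mem (Ideal.mul_mem_left _ _ hfQ) (Ideal.mul_mem_left _ _ hx)
      exact hQ.neg_one h1.2
    obtain ⟨g, rfl⟩ := this
    simp [hθ]
  have hcone : IsTotalCone ((Polynomial.aeval θ : Polynomial (subfield hmax) →ₐ[_] Ω) '' Q) :=
    hQ.isTotalCone_image (Polynomial.aeval θ : Polynomial (subfield hmax) →ₐ[_] Ω).toRingHom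
      hker fun x hx hx' => hker' x ⟨hx, hx'⟩
  have hle : P ⊆ (Polynomial.aeval θ : Polynomial (subfield hmax) →ₐ[_] Ω) '' Q := by
    intro c hc
    have hc0 : (0 : subfield hmax) ≤ ⟨c, Or.inl hc⟩ := by
      change c - 0 ∈ P
      simpa using hc
    refine ⟨Polynomial.C ⟨c, Or.inl hc⟩, hTQ ⟨_, mem_weightedSOS hc0 1, 0, by simp⟩, ?_⟩
    simp only [Polynomial.aeval_C]
    rfl
  have hge := hmax.le_of_ge hcone hle
  have hθL : θ ∈ subfield hmax := by
    rcases hQ.total Polynomial.X with h | h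
    · exact Or.inl (hge ⟨_, h, by simp⟩)
    · exact Or.inr (hge ⟨_, h, by simp⟩)
  refine ⟨⟨θ, hθL⟩, Subtype.ext ?_⟩
  have := Polynomial.aeval_algebraMap_apply Ω (⟨θ, hθL⟩ : subfield hmax) f
  have h2 : (algebraMap (subfield hmax) Ω) ⟨θ, hθL⟩ = θ := rfl
  rw [h2, hθ] at this
  exact this.symm

end IsTotalCone

/-- The intermediate value property follows from the existence of roots of irreducible polynomials
that change sign. -/
theorem hasPolyIVT_of_irreducible {R : Type*} [Field R] [LinearOrder R] [IsStrictOrderedRing R]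
    (H : ∀ (f : Polynomial R) (a b : R), Irreducible f → f.eval a * f.eval b < 0 →
      ∃ c, f.eval c = 0) : HasPolyIVT R := by
  have key : ∀ (n : ℕ) (p : Polynomial R) (a b : R), p.natDegree = n → a ≤ b →
      p.eval a * p.eval b < 0 → ∃ c, a ≤ c ∧ c ≤ b ∧ p.eval c = 0 := by
    intro n
    induction n using Nat.strong_induction_on with
    | _ n ih =>
      intro p a b hn hab hp
      have hp0 : p ≠ 0 := by rintro rfl; simp at hp
      have hpu : ¬ IsUnit p := by
        intro hu
        obtain ⟨c, hc, rfl⟩ := Polynomial.isUnit_iff.1 hu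
        simp only [Polynomial.eval_C] at hp
        exact absurd hp (not_lt.2 (mul_self_nonneg _))
      obtain ⟨f, hf, g, rfl⟩ := WfDvdMonoid.exists_irreducible_factor hpu hp0
      have hf0 := hf.ne_zero
      have hg0 : g ≠ 0 := by rintro rfl; simp at hp0
      have hfd := (Polynomial.natDegree_pos_iff_degree_pos.2
        (Polynomial.degree_pos_of_irreducible hf))
      rw [Polynomial.natDegree_mul hf0 hg0] at hn
      simp only [Polynomial.eval_mul] at hp
      by_cases hfs : f.eval a * f.eval b < 0
      · obtain ⟨c, hc⟩ := H f a b hf hfs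
        have hdeg : f.degree = 1 := Polynomial.degree_eq_one_of_irreducible_of_root hf hc
        obtain ⟨d, hd⟩ := Polynomial.dvd_iff_isRoot.2 hc
        have hfd1 : f.natDegree = 1 := Polynomial.natDegree_eq_of_degree_eq_some hdeg
        have hd0 : d ≠ 0 := by rintro rfl; simp at hd; exact hf0 hd
        have hdc : d.natDegree = 0 := by
          have := congrArg Polynomial.natDegree hd
          rw [Polynomial.natDegree_mul (Polynomial.X_sub_C_ne_zero c) hd0,
            Polynomial.natDegree_X_sub_C, hfd1] at this
          omega
        rw [Polynomial.eq_C_of_natDegree_eq_zero hdc] at hd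
        rw [hd] at hfs
        simp only [Polynomial.eval_mul, Polynomial.eval_sub, Polynomial.eval_X,
          Polynomial.eval_C] at hfs
        have h3 : (a - c) * (b - c) < 0 := by
          by_contra! hcon
          nlinarith [mul_nonneg hcon (mul_self_nonneg (d.coeff 0))]
        refine ⟨c, ?_, ?_, by simp [hc]⟩
        · by_contra! hcon
          nlinarith
        · by_contra! hcon
          nlinarith
      · have hga : g.eval a * g.eval b < 0 := by
          by_contra! hcon
          nlinarith [mul_nonneg hcon (not_lt.1 hfs)]
        obtain ⟨c, h1, h2, h3⟩ := ih g.natDegree (by omega) g a b rfl hab hga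
        exact ⟨c, h1, h2, by simp [h3]⟩
  intro p a b hab ha hb
  rcases ha.eq_or_lt with ha | ha
  · exact ⟨a, le_rfl, hab, ha⟩
  rcases hb.eq_or_lt with hb | hb
  · exact ⟨b, hab, le_rfl, hb.symm⟩
  exact key _ p a b rfl hab (mul_neg_of_neg_of_pos ha hb)

/-- Every prime cone is the preimage of the nonnegative elements of an ordered field with the
intermediate value property. -/
theorem IsPrimeCone.exists_field {A : Type} [CommRing A] {P : Set A} (hP : IsPrimeCone P) :
    ∃ (R : Type) (_ : Field R) (_ : LinearOrder R) (_ : IsStrictOrderedRing R) (φ : A →+* R),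
      HasPolyIVT R ∧ ∀ a, 0 ≤ φ a ↔ a ∈ P := by
  have := hP.supp_isPrime
  let K := FractionRing (A ⧸ hP.supp)
  let Ω := AlgebraicClosure K
  let e : A →+* Ω := (algebraMap K Ω).comp
    ((algebraMap (A ⧸ hP.supp) K).comp (Ideal.Quotient.mk hP.supp))
  have he : ∀ x, e x = 0 ↔ x ∈ hP.supp := by
    intro x
    simp only [e, RingHom.comp_apply]
    rw [map_eq_zero_iff _ (algebraMap K Ω).injective,
      map_eq_zero_iff _ (IsFractionRing.injective (A ⧸ hP.supp) K), Ideal.Quotient.eq_zero_iff_mem]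
  have hc : IsTotalCone (e '' P) :=
    hP.isTotalCone_image e (fun x hx => (he x).1 hx) fun x hx hx' => (he x).2 ⟨hx, hx'⟩
  obtain ⟨M, hM, hmax⟩ := hc.exists_maximal
  let _ := IsTotalCone.linearOrder hmax
  have hord := IsTotalCone.isStrictOrderedRing hmax
  have hmem : ∀ x, e x ∈ IsTotalCone.subfield hmax := by
    intro x
    rcases hP.total x with h | h
    · exact Or.inl (hM ⟨x, h, rfl⟩)
    · exact Or.inr (hM ⟨-x, h, by simp⟩)
  refine ⟨IsTotalCone.subfield hmax, inferInstance, IsTotalCone.linearOrder hmax, hord,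
    e.codRestrict (IsTotalCone.subfield hmax) hmem,
    hasPolyIVT_of_irreducible fun f a b hf hab =>
      IsTotalCone.exists_root_of_irreducible hmax hf hab, ?_⟩
  intro a
  have hiff : 0 ≤ e.codRestrict (IsTotalCone.subfield hmax) hmem a ↔ e a ∈ M := by
    change e a - 0 ∈ M ↔ _
    simp
  rw [hiff]
  refine ⟨fun h => ?_, fun h => hM ⟨a, h, rfl⟩⟩
  rcases hP.total a with h' | h'
  · exact h'
  · have := hmax.prop.pointed h (hM ⟨_, h', by simp⟩)
    exact ((he a).1 this).1

section PolyOrder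

variable {R : Type*} [Field R] [LinearOrder R] [IsStrictOrderedRing R]

open Polynomial in
theorem HasPolyIVT.exists_root_of_mul_nonpos (hR : HasPolyIVT R) {p : R[X]} {a b : R} (hab : a ≤ b)
    (h : p.eval a * p.eval b ≤ 0) : ∃ c, a ≤ c ∧ c ≤ b ∧ p.eval c = 0 := by
  rcases mul_nonpos_iff.1 h with ⟨h1, h2⟩ | ⟨h1, h2⟩
  · simpa using hR (-p) a b hab (by simpa using h1) (by simpa using h2)
  · exact hR p a b hab h1 h2

open Polynomial in
theorem HasPolyIVT.sign_eq (hR : HasPolyIVT R) {p : R[X]} {a b : R} (hab : a ≤ b)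
    (h : ∀ c, a ≤ c → c ≤ b → p.eval c ≠ 0) :
    SignType.sign (p.eval a) = SignType.sign (p.eval b) := by
  by_contra hne
  have ha := h a le_rfl hab
  have hb := h b hab le_rfl
  have : p.eval a * p.eval b ≤ 0 := by
    by_contra! hpos
    apply hne
    rcases pos_and_pos_or_neg_and_neg_of_mul_pos hpos with ⟨h1, h2⟩ | ⟨h1, h2⟩
    · rw [sign_pos h1, sign_pos h2]
    · rw [sign_neg h1, sign_neg h2]
  obtain ⟨c, h1, h2, h3⟩ := hR.exists_root_of_mul_nonpos hab this
  exact h c h1 h2 h3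

open Polynomial in
theorem HasPolyIVT.rolle (hR : HasPolyIVT R) {p : R[X]} {a b : R} (hab : a < b)
    (ha : p.eval a = 0) (hb : p.eval b = 0) : ∃ c, a < c ∧ c < b ∧ p.derivative.eval c = 0 := by
  rcases eq_or_ne p 0 with rfl | hp
  · obtain ⟨c, h1, h2⟩ := exists_between hab
    exact ⟨c, h1, h2, by simp⟩
  -- pass to the first root after `a`
  obtain ⟨b', hab', hb'b, hb', hmin⟩ : ∃ b', a < b' ∧ b' ≤ b ∧ p.eval b' = 0 ∧
      ∀ c, a < c → c < b' → p.eval c ≠ 0 := by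
    let s := p.roots.toFinset.filter (fun c => a < c)
    have hs : s.Nonempty := ⟨b, by simp [s, hp, hb, hab]⟩
    have h1 := s.min'_mem hs
    simp only [s, Finset.mem_filter, Multiset.mem_toFinset, mem_roots hp] at h1
    refine ⟨s.min' hs, h1.2, s.min'_le _ (by simp [s, hp, hb, hab]), h1.1, fun c hc hc' h0 => ?_⟩
    exact absurd (s.min'_le c (by simp [s, hp, h0, hc])) (not_le.2 hc')
  obtain ⟨q, hq, hqa⟩ := exists_eq_pow_rootMultiplicity_mul_and_not_dvd p hp a
  have hq0 : q ≠ 0 := by rintro rfl; simp at hqa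
  obtain ⟨r, hr, hrb⟩ := exists_eq_pow_rootMultiplicity_mul_and_not_dvd q hq0 b'
  set k := p.rootMultiplicity a
  set l := q.rootMultiplicity b'
  have hk : 0 < k := (rootMultiplicity_pos hp).2 ha
  have hqb : q.eval b' = 0 := by
    have : (b' - a) ^ k * q.eval b' = 0 := by
      rw [← hb']
      conv_rhs => rw [hq]
      simp
    rcases mul_eq_zero.1 this with h | h
    · exact absurd (pow_eq_zero_iff hk.ne' |>.1 h) (sub_pos.2 hab').ne'
    · exact h
  have hl : 0 < l := (rootMultiplicity_pos hq0).2 hqb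
  have hra : r.eval a ≠ 0 := by
    intro h
    refine hqa (dvd_iff_isRoot.2 ?_)
    rw [IsRoot, hr]
    simp [h]
  have hrb : r.eval b' ≠ 0 := fun h => hrb (dvd_iff_isRoot.2 h)
  have hrs : SignType.sign (r.eval a) = SignType.sign (r.eval b') := by
    refine hR.sign_eq hab'.le fun c hc hc' h0 => ?_
    rcases hc.eq_or_lt with rfl | hc
    · exact hra h0
    rcases hc'.eq_or_lt with rfl | hc'
    · exact hrb h0
    refine hmin c hc hc' ?_
    rw [hq, hr]
    simp [h0]
  obtain ⟨k', hk'⟩ := Nat.exists_eq_succ_of_ne_zero hk.ne'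
  obtain ⟨l', hl'⟩ := Nat.exists_eq_succ_of_ne_zero hl.ne'
  let g : R[X] := Polynomial.C (k : R) * (Polynomial.X - Polynomial.C b') * r +
    Polynomial.C (l : R) * (Polynomial.X - Polynomial.C a) * r +
    (Polynomial.X - Polynomial.C a) * (Polynomial.X - Polynomial.C b') * derivative r
  have hder : derivative p =
      (Polynomial.X - Polynomial.C a) ^ k' * (Polynomial.X - Polynomial.C b') ^ l' * g := by
    have h1 : ∀ (e : R) (n : ℕ), derivative ((Polynomial.X - Polynomial.C e) ^ (n + 1)) =
        Polynomial.C ((n + 1 : ℕ) : R) * (Polynomial.X - Polynomial.C e) ^ n := fun e n => by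
      rw [derivative_X_sub_C_pow, Nat.add_sub_cancel]
    rw [hq, hr, derivative_mul, derivative_mul, hk', hl', Nat.succ_eq_add_one, Nat.succ_eq_add_one,
      h1, h1]
    simp only [g, hk', hl', Nat.succ_eq_add_one, pow_succ]
    ring
  have hga : g.eval a = k * (a - b') * r.eval a := by simp [g]
  have hgb : g.eval b' = l * (b' - a) * r.eval b' := by simp [g]
  have hrr : 0 < r.eval a * r.eval b' := by
    rcases lt_trichotomy (r.eval a) 0 with h | h | h
    · rw [sign_neg h, eq_comm, sign_eq_neg_one_iff] at hrs
      exact mul_pos_of_neg_of_neg h hrs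
    · exact absurd h hra
    · rw [sign_pos h, eq_comm, sign_eq_one_iff] at hrs
      exact mul_pos h hrs
  have hkl : (0 : R) < k * l := by positivity
  have hbb : 0 < (b' - a) * (b' - a) := mul_pos (sub_pos.2 hab') (sub_pos.2 hab')
  have hgg : g.eval a * g.eval b' < 0 := by
    rw [hga, hgb]
    have := mul_pos (mul_pos hkl hbb) hrr
    nlinarith
  obtain ⟨c, hc, hc', h0⟩ := hR.exists_root_of_mul_nonpos hab'.le hgg.le
  refine ⟨c, hc.lt_of_ne ?_, (hc'.lt_of_ne ?_).trans_le hb'b, by simp [hder, h0]⟩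
  · rintro rfl; simp [h0] at hgg
  · rintro rfl; simp [h0] at hgg

open Polynomial in
theorem HasPolyIVT.mean_value (hR : HasPolyIVT R) (p : R[X]) {a b : R} (hab : a < b) :
    ∃ c, a < c ∧ c < b ∧ p.eval b - p.eval a = p.derivative.eval c * (b - a) := by
  obtain ⟨c, h1, h2, h3⟩ := hR.rolle
    (p := Polynomial.C (b - a) * (p - Polynomial.C (p.eval a)) -
      Polynomial.C (p.eval b - p.eval a) * (Polynomial.X - Polynomial.C a)) hab
    (by simp) (by simp; ring)
  refine ⟨c, h1, h2, ?_⟩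
  simp only [derivative_sub, derivative_mul, derivative_C, derivative_X, Polynomial.eval_sub, Polynomial.eval_add,
    Polynomial.eval_mul, Polynomial.eval_C, Polynomial.eval_zero, Polynomial.eval_one] at h3
  linear_combination -h3

open Polynomial in
theorem HasPolyIVT.monotone (hR : HasPolyIVT R) {p : R[X]} {a b : R} (hab : a ≤ b)
    (h : ∀ c, a < c → c < b → 0 ≤ p.derivative.eval c) : p.eval a ≤ p.eval b := by
  rcases hab.eq_or_lt with rfl | hab
  · rfl
  obtain ⟨c, h1, h2, h3⟩ := hR.mean_value p hab
  nlinarith [h c h1 h2, mul_nonneg (h c h1 h2) (sub_pos.2 hab).le]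

open Polynomial in
theorem HasPolyIVT.strictMono (hR : HasPolyIVT R) {p : R[X]} {a b : R} (hab : a < b)
    (h : ∀ c, a < c → c < b → 0 < p.derivative.eval c) : p.eval a < p.eval b := by
  obtain ⟨c, h1, h2, h3⟩ := hR.mean_value p hab
  nlinarith [mul_pos (h c h1 h2) (sub_pos.2 hab)]

open Polynomial in
theorem exists_forall_le_eval (p : R[X]) (hp : 0 < p.natDegree) (hlc : 0 < p.leadingCoeff) (M : R) :
    ∃ B, ∀ x, B ≤ x → M ≤ p.eval x := by
  induction hn : p.natDegree using Nat.strong_induction_on generalizing p M with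
  | _ n ih =>
    have hpe : ∀ x, p.eval x = p.divX.eval x * x + p.coeff 0 := fun x => by
      conv_lhs => rw [← divX_mul_X_add p]
      simp
    have hd : p.divX.natDegree = p.natDegree - 1 := natDegree_divX_eq_natDegree_tsub_one
    have hlc' : p.divX.leadingCoeff = p.leadingCoeff := by
      rw [leadingCoeff, leadingCoeff, hd, coeff_divX, Nat.sub_add_cancel hp]
    rcases Nat.eq_or_lt_of_le (Nat.succ_le_of_lt hp) with h1 | h1
    · have h0 : p.divX.natDegree = 0 := by omega
      have h2 : ∀ x, p.divX.eval x = p.leadingCoeff := fun x => by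
        rw [← hlc', eq_C_of_natDegree_eq_zero h0]; simp
      refine ⟨(M - p.coeff 0) / p.leadingCoeff, fun x hx => ?_⟩
      rw [div_le_iff₀ hlc] at hx
      rw [hpe, h2]
      linarith
    · obtain ⟨B, hB⟩ := ih p.divX.natDegree (by omega) p.divX (by omega) (by rwa [hlc']) 1 rfl
      refine ⟨max B (max 0 (M - p.coeff 0)), fun x hx => ?_⟩
      have h2 := hB x ((le_max_left _ _).trans hx)
      have h3 : 0 ≤ x := (le_max_left _ _).trans ((le_max_right _ _).trans hx)
      have h4 : M - p.coeff 0 ≤ x := (le_max_right _ _).trans ((le_max_right _ _).trans hx)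
      rw [hpe]
      nlinarith [mul_le_mul_of_nonneg_right h2 h3]

open Polynomial in
/-- A nonconstant polynomial with nonnegative derivative on a half-line takes positive values
there. -/
theorem HasPolyIVT.exists_pos_of_derivative_nonneg (hR : HasPolyIVT R) {p : R[X]}
    {a : R} (h : ∀ c, a < c → 0 < p.derivative.eval c) : ∃ b, a < b ∧ 0 < p.eval b := by
  have hp : 0 < p.natDegree := by
    by_contra! h0
    have := h (a + 1) (by linarith)
    rw [eq_C_of_natDegree_eq_zero (Nat.le_zero.1 h0)] at this
    simp at this
  rcases lt_trichotomy p.leadingCoeff 0 with hlc | hlc | hlc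
  · exfalso
    obtain ⟨B, hB⟩ := exists_forall_le_eval (-p) (by simpa using hp) (by simpa using hlc)
      (-p.eval a + 1)
    have h1 := hB (max B a) (le_max_left _ _)
    have h2 := hR.monotone (p := p) (le_max_right B a) fun c hc _ => (h c hc).le
    simp only [Polynomial.eval_neg] at h1
    linarith
  · simp only [leadingCoeff_eq_zero] at hlc
    simp [hlc] at hp
  · obtain ⟨B, hB⟩ := exists_forall_le_eval p hp hlc 1
    exact ⟨max B (a + 1), (lt_add_one a).trans_le (le_max_right _ _),
      zero_lt_one.trans_le (hB _ (le_max_left _ _))⟩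

open Polynomial in
/-- A polynomial positive at `b` is positive near `b`, to the left. -/
theorem HasPolyIVT.exists_pos_left (hR : HasPolyIVT R) {p : R[X]} {a b : R} (hab : a < b)
    (hb : 0 < p.eval b) : ∃ c, a < c ∧ c < b ∧ 0 < p.eval c := by
  have hp : p ≠ 0 := by rintro rfl; simp at hb
  let s := insert a (p.roots.toFinset.filter (fun c => c < b))
  have hs : s.Nonempty := ⟨a, by simp [s]⟩
  have hsb : s.max' hs < b := by
    rw [Finset.max'_lt_iff]
    intro y hy
    simp only [s, Finset.mem_insert, Finset.mem_filter] at hy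
    rcases hy with rfl | hy
    · exact hab
    · exact hy.2
  obtain ⟨c, h1, h2⟩ := exists_between hsb
  refine ⟨c, (s.le_max' a (by simp [s])).trans_lt h1, h2, ?_⟩
  have := hR.sign_eq (p := p) h2.le fun d hd hdb h0 => ?_
  · rwa [sign_pos hb, sign_eq_one_iff] at this
  · rcases hdb.eq_or_lt with rfl | hdb
    · simp [h0] at hb
    · have := s.le_max' d (by simp [s, hp, h0, hdb])
      linarith

theorem hasPolyIVT_real : HasPolyIVT ℝ := fun p a b hab ha hb => by
  obtain ⟨c, hc, h⟩ := intermediate_value_Icc hab p.continuous.continuousOn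
    (show (0 : ℝ) ∈ Set.Icc (p.eval a) (p.eval b) from ⟨ha, hb⟩)
  exact ⟨c, hc.1, hc.2, h⟩

end PolyOrder

section Thom

variable {R : Type*} [Field R] [LinearOrder R] [IsStrictOrderedRing R]
variable {R' : Type*} [Field R'] [LinearOrder R'] [IsStrictOrderedRing R']

open Polynomial (derivative)

theorem HasPolyIVT.le_of_sign_derivative (hR : HasPolyIVT R) {p : Polynomial R} {a b : R}
    (hab : a ≤ b) {s : SignType}
    (h : ∀ c, a ≤ c → c ≤ b → SignType.sign ((derivative p).eval c) = s) :
    (0 ≤ s → p.eval a ≤ p.eval b) ∧ (s ≤ 0 → p.eval b ≤ p.eval a) := by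
  refine ⟨fun hs => hR.monotone hab fun c hc hc' => ?_, fun hs => ?_⟩
  · rw [← sign_nonneg_iff, h c hc.le hc'.le]
    exact hs
  · have := hR.monotone (p := -p) hab fun c hc hc' => ?_
    · simpa using this
    · have h1 : (derivative p).eval c ≤ 0 := by
        rw [← sign_nonpos_iff, h c hc.le hc'.le]
        exact hs
      simpa using h1

/-- Thom's lemma: the signs of a polynomial and its derivatives determine convex sets. -/
theorem HasPolyIVT.sign_eq_of_iterate_derivative (hR : HasPolyIVT R) (p : Polynomial R) {a b : R}
    (h : ∀ i, SignType.sign ((derivative^[i] p).eval a) = SignType.sign ((derivative^[i] p).eval b))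
    {c : R} (hac : a ≤ c) (hcb : c ≤ b) :
    SignType.sign (p.eval c) = SignType.sign (p.eval a) := by
  induction hn : p.natDegree using Nat.strong_induction_on generalizing p c with
  | _ n ih =>
    rcases Nat.eq_zero_or_pos p.natDegree with h0 | h0
    · rw [Polynomial.eq_C_of_natDegree_eq_zero h0]
      simp
    have hder : ∀ c, a ≤ c → c ≤ b → SignType.sign ((derivative p).eval c) =
        SignType.sign ((derivative p).eval a) := fun c hac hcb =>
      ih _ (hn ▸ Polynomial.natDegree_derivative_lt h0.ne') (derivative p)
        (fun i => h (i + 1)) hac hcb rfl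
    have h1 := hR.le_of_sign_derivative hac fun d h1 h2 => hder d h1 (h2.trans hcb)
    have h2 := hR.le_of_sign_derivative hcb fun d h1 h2 => hder d (hac.trans h1) h2
    have h3 := h 0
    simp only [Function.iterate_zero, id_eq] at h3
    have hmono : Monotone (SignType.sign : R → SignType) := SignType.sign.monotone
    rcases le_total 0 (SignType.sign ((derivative p).eval a)) with hs | hs
    · exact le_antisymm ((hmono (h2.1 hs)).trans h3.ge) (hmono (h1.1 hs))
    · exact le_antisymm (hmono (h1.2 hs)) (h3.le.trans (hmono (h2.2 hs)))

variable {A : Type*} [CommRing A]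

/-- The sign at `y` of the polynomial `g` with coefficients transported along `α`. -/
def sgn (α : A →+* R) (y : R) (g : Polynomial A) : SignType :=
  SignType.sign ((g.map α).eval y)

theorem iterate_derivative_mem {H : Set (Polynomial A)} (hd : ∀ g ∈ H, derivative g ∈ H)
    {g : Polynomial A} (hg : g ∈ H) (i : ℕ) : derivative^[i] g ∈ H := by
  induction i generalizing g with
  | zero => exact hg
  | succ i ih => exact ih (hd g hg)

theorem sgn_eq_of_forall (hR : HasPolyIVT R) {α : A →+* R} {H : Set (Polynomial A)}
    (hd : ∀ g ∈ H, derivative g ∈ H) {a b : R} (h : ∀ g ∈ H, sgn α a g = sgn α b g)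
    {g : Polynomial A} (hg : g ∈ H) {c : R} (hac : a ≤ c) (hcb : c ≤ b) :
    sgn α c g = sgn α a g :=
  hR.sign_eq_of_iterate_derivative _ (fun i => by
    have := h _ (iterate_derivative_mem hd hg i)
    rwa [sgn, sgn, ← Polynomial.iterate_derivative_map] at this) hac hcb

/-- Sign vectors on a derivative-closed family determine the order of the points realizing them. -/
theorem lt_of_sgn_ne (hR : HasPolyIVT R) (hR' : HasPolyIVT R') {α : A →+* R} {β : A →+* R'}
    {H : Set (Polynomial A)} (hd : ∀ g ∈ H, derivative g ∈ H) {y₁ y₂ : R} {y₁' y₂' : R'}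
    (h₁ : ∀ g ∈ H, sgn α y₁ g = sgn β y₁' g) (h₂ : ∀ g ∈ H, sgn α y₂ g = sgn β y₂' g)
    (hne : ∃ g ∈ H, sgn α y₁ g ≠ sgn α y₂ g) (hlt : y₁ < y₂) : y₁' < y₂' := by
  classical
  obtain ⟨g, ⟨hg, hgne⟩, hmin⟩ := (measure (Polynomial.natDegree (R := A))).wf.has_min
    {g | g ∈ H ∧ sgn α y₁ g ≠ sgn α y₂ g} (by simpa [Set.Nonempty] using hne)
  have hg0 : g.natDegree ≠ 0 := by
    intro h0
    refine hgne ?_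
    rw [Polynomial.eq_C_of_natDegree_eq_zero h0]
    simp [sgn]
  have hlow : ∀ i, sgn α y₁ (derivative^[i] (derivative g)) =
      sgn α y₂ (derivative^[i] (derivative g)) := by
    intro i
    by_contra hcon
    refine hmin _ ⟨iterate_derivative_mem hd (hd g hg) i, hcon⟩ ?_
    change (derivative^[i] (derivative g)).natDegree < g.natDegree
    have h1 := Polynomial.natDegree_derivative_lt hg0
    have h2 := Polynomial.natDegree_iterate_derivative (derivative g) i
    omega
  have hlow' : ∀ i, sgn β y₂' (derivative^[i] (derivative g)) =
      sgn β y₁' (derivative^[i] (derivative g)) := fun i => by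
    rw [← h₁ _ (iterate_derivative_mem hd (hd g hg) i), hlow i,
      ← h₂ _ (iterate_derivative_mem hd (hd g hg) i)]
  have hc : ∀ c, y₁ ≤ c → c ≤ y₂ → SignType.sign ((derivative (g.map α)).eval c) =
      sgn α y₁ (derivative g) := fun c h1 h2 => by
    rw [sgn, ← Polynomial.derivative_map]
    refine hR.sign_eq_of_iterate_derivative _ (fun i => ?_) h1 h2
    have := hlow i
    simp only [sgn] at this
    rwa [← Polynomial.iterate_derivative_map, ← Polynomial.derivative_map] at this
  by_contra! hcon
  have hc' : ∀ c, y₂' ≤ c → c ≤ y₁' → SignType.sign ((derivative (g.map β)).eval c) =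
      sgn α y₁ (derivative g) := fun c h1 h2 => by
    have h0 := hlow 0
    simp only [Function.iterate_zero, id_eq] at h0
    rw [h0, h₂ _ (hd g hg), sgn, ← Polynomial.derivative_map]
    refine hR'.sign_eq_of_iterate_derivative _ (fun i => ?_) h1 h2
    have := hlow' i
    simp only [sgn] at this
    rwa [← Polynomial.iterate_derivative_map, ← Polynomial.derivative_map] at this
  have h3 := hR.le_of_sign_derivative hlt.le hc
  have h4 := hR'.le_of_sign_derivative hcon hc'
  have e1 := h₁ g hg
  have e2 := h₂ g hg
  have hmono : Monotone (SignType.sign : R → SignType) := SignType.sign.monotone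
  have hmono' : Monotone (SignType.sign : R' → SignType) := SignType.sign.monotone
  refine hgne ?_
  rcases le_total 0 (sgn α y₁ (derivative g)) with hs | hs
  · exact le_antisymm (hmono (h3.1 hs)) (e2.le.trans ((hmono' (h4.1 hs)).trans e1.ge))
  · exact le_antisymm (e1.le.trans ((hmono' (h4.2 hs)).trans e2.ge)) (hmono (h3.2 hs))

/-- A total correspondence between points of two ordered fields that respects finite sets of
distinguished points and the order relative to them. -/
structure IsOrderMatch (m : R → R' → Prop) (Z : Set R) (Z' : Set R') : Prop where
  finite : Z.Finite
  left : ∀ y, ∃ y', m y y'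
  right : ∀ y', ∃ y, m y y'
  mem_iff : ∀ {y y'}, m y y' → (y ∈ Z ↔ y' ∈ Z')
  lt_iff : ∀ {y y' z z'}, m y y' → m z z' → z ∈ Z → (y < z ↔ y' < z')
  gt_iff : ∀ {y y' z z'}, m y y' → m z z' → z ∈ Z → (z < y ↔ z' < y')

theorem IsOrderMatch.reflect {m : R → R' → Prop} {Z : Set R} {Z' : Set R'}
    (h : IsOrderMatch m Z Z') :
    IsOrderMatch (fun y y' => m (-y) (-y')) {y | -y ∈ Z} {y' | -y' ∈ Z'} where
  finite := h.finite.preimage neg_injective.injOn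
  left y := by
    obtain ⟨y', hy'⟩ := h.left (-y)
    exact ⟨-y', by simpa using hy'⟩
  right y' := by
    obtain ⟨y, hy⟩ := h.right (-y')
    exact ⟨-y, by simpa using hy⟩
  mem_iff hy := h.mem_iff hy
  lt_iff hy hz hZ := by simpa using h.gt_iff hy hz hZ
  gt_iff hy hz hZ := by simpa using h.lt_iff hy hz hZ

/-- Polynomials with matching derivative signs, and matching signs at the distinguished points. -/
structure IsPolyMatch (m : R → R' → Prop) (Z : Set R) (Z' : Set R') (G : Polynomial R)
    (G' : Polynomial R') : Prop where
  deriv : ∀ {y y'}, m y y' →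
    SignType.sign ((derivative G).eval y) = SignType.sign ((derivative G').eval y')
  ne : ∀ {y}, y ∉ Z → (derivative G).eval y ≠ 0
  ne' : ∀ {y'}, y' ∉ Z' → (derivative G').eval y' ≠ 0
  sign : ∀ {z z'}, m z z' → z ∈ Z → SignType.sign (G.eval z) = SignType.sign (G'.eval z')

theorem IsPolyMatch.neg {m : R → R' → Prop} {Z : Set R} {Z' : Set R'} {G : Polynomial R}
    {G' : Polynomial R'} (h : IsPolyMatch m Z Z' G G') : IsPolyMatch m Z Z' (-G) (-G') where
  deriv hy := by simpa [Left.sign_neg] using h.deriv hy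
  ne hy := by simpa using h.ne hy
  ne' hy := by simpa using h.ne' hy
  sign hz hZ := by simpa [Left.sign_neg] using h.sign hz hZ

theorem IsPolyMatch.reflect {m : R → R' → Prop} {Z : Set R} {Z' : Set R'} {G : Polynomial R}
    {G' : Polynomial R'} (h : IsPolyMatch m Z Z' G G') :
    IsPolyMatch (fun y y' => m (-y) (-y')) {y | -y ∈ Z} {y' | -y' ∈ Z'}
      (G.comp (-Polynomial.X)) (G'.comp (-Polynomial.X)) where
  deriv hy := by simpa [Polynomial.derivative_comp, Left.sign_neg] using h.deriv hy
  ne hy := by simpa [Polynomial.derivative_comp] using h.ne hy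
  ne' hy := by simpa [Polynomial.derivative_comp] using h.ne' hy
  sign hz hZ := by simpa using h.sign hz hZ

theorem IsPolyMatch.exists_pos (hR : HasPolyIVT R) (hR' : HasPolyIVT R') {m : R → R' → Prop}
    {Z : Set R} {Z' : Set R'} (hm : IsOrderMatch m Z Z') {G : Polynomial R} {G' : Polynomial R'}
    (h : IsPolyMatch m Z Z' G G') {y : R} {y' : R'} (hy : m y y') (hyZ : y ∉ Z)
    (hG : 0 ≤ G.eval y) (hder : 0 < (derivative G).eval y) :
    ∃ c', y' ≤ c' ∧ (∀ z' ∈ Z', y' ≤ z' → ¬ z' ≤ c') ∧ 0 < G'.eval c' := by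
  have hyZ' : y' ∉ Z' := fun h' => hyZ ((hm.mem_iff hy).2 h')
  have hder' : 0 < (derivative G').eval y' := by
    have := h.deriv hy
    rwa [sign_pos hder, eq_comm, sign_eq_one_iff] at this
  by_cases hex : ∃ z ∈ Z, y < z
  · let s := hm.finite.toFinset.filter (fun z => y < z)
    have hs : s.Nonempty := by
      obtain ⟨z, hz, hyz⟩ := hex
      exact ⟨z, by simp [s, hz, hyz]⟩
    have hz₀ := s.min'_mem hs
    simp only [s, Finset.mem_filter, Set.Finite.mem_toFinset] at hz₀
    set z₀ := s.min' hs with hz₀def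
    have hmin : ∀ z ∈ Z, y < z → z₀ ≤ z := fun z hz hyz => s.min'_le z (by simp [s, hz, hyz])
    obtain ⟨z₀', hz₀'⟩ := hm.left z₀
    have hlt' : y' < z₀' := (hm.lt_iff hy hz₀' hz₀.1).1 hz₀.2
    have hGz : 0 < G.eval z₀ := by
      refine hG.trans_lt (hR.strictMono hz₀.2 fun c hc hc' => ?_)
      have := hR.sign_eq (p := derivative G) hc.le fun d hd hd' => h.ne fun hdZ => ?_
      · rwa [sign_pos hder, eq_comm, sign_eq_one_iff] at this
      · rcases hd.eq_or_lt with rfl | hd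
        · exact hyZ hdZ
        · exact absurd (hmin d hdZ hd) (not_le.2 (hd'.trans_lt hc'))
    have hGz' : 0 < G'.eval z₀' := by
      have := h.sign hz₀' hz₀.1
      rwa [sign_pos hGz, eq_comm, sign_eq_one_iff] at this
    obtain ⟨c, hc, hc', hpos⟩ := hR'.exists_pos_left hlt' hGz'
    refine ⟨c, hc.le, fun w' hw' h1 h2 => ?_, hpos⟩
    obtain ⟨w, hw⟩ := hm.right w'
    have hwZ := (hm.mem_iff hw).2 hw'
    have h1' : y' < w' := h1.lt_of_ne (by rintro rfl; exact hyZ' hw')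
    have h3 := hmin w hwZ ((hm.lt_iff hy hw hwZ).2 h1')
    exact absurd ((hm.lt_iff hw hz₀' hz₀.1).2 (h2.trans_lt hc')) (not_lt.2 h3)
  · push Not at hex
    have hno : ∀ z' ∈ Z', ¬ y' ≤ z' := by
      intro z' hz' hle
      obtain ⟨z, hz⟩ := hm.right z'
      have hzZ := (hm.mem_iff hz).2 hz'
      have hlt : y' < z' := hle.lt_of_ne (by rintro rfl; exact hyZ' hz')
      exact absurd ((hm.lt_iff hy hz hzZ).2 hlt) (not_lt.2 (hex z hzZ))
    obtain ⟨b, hb, hpos⟩ := hR'.exists_pos_of_derivative_nonneg (p := G') (a := y') fun c hc => by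
      have := hR'.sign_eq (p := derivative G') hc.le fun d hd hd' => h.ne' fun hdZ => hno d hdZ hd
      rwa [sign_pos hder', eq_comm, sign_eq_one_iff] at this
    exact ⟨b, hb.le, fun z' hz' h1 => absurd h1 (hno z' hz'), hpos⟩

theorem IsPolyMatch.exists_sign_eq_of_pos (hR : HasPolyIVT R) (hR' : HasPolyIVT R')
    {m : R → R' → Prop}
    {Z : Set R} {Z' : Set R'} (hm : IsOrderMatch m Z Z') {G : Polynomial R} {G' : Polynomial R'}
    (h : IsPolyMatch m Z Z' G G') {y : R} {y' : R'} (hy : m y y') (hyZ : y ∉ Z)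
    (hder : 0 < (derivative G).eval y) :
    ∃ c', (∀ z' ∈ Z', z' ∉ Set.uIcc y' c') ∧
      SignType.sign (G'.eval c') = SignType.sign (G.eval y) := by
  have right : 0 ≤ G.eval y →
      ∃ c', y' ≤ c' ∧ (∀ z' ∈ Z', y' ≤ z' → ¬ z' ≤ c') ∧ 0 < G'.eval c' :=
    fun hG => h.exists_pos hR hR' hm hy hyZ hG hder
  have left : G.eval y ≤ 0 →
      ∃ c', c' ≤ y' ∧ (∀ z' ∈ Z', c' ≤ z' → ¬ z' ≤ y') ∧ G'.eval c' < 0 := by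
    intro hG
    obtain ⟨c, hc, hZ, hpos⟩ := h.reflect.neg.exists_pos hR hR' hm.reflect (y := -y) (y' := -y')
      (by simpa using hy) (by simpa using hyZ) (by simpa using hG)
      (by simpa [Polynomial.derivative_comp] using hder)
    refine ⟨-c, by linarith, fun z' hz' h1 h2 => ?_, by simpa using hpos⟩
    exact hZ (-z') (by simpa using hz') (by linarith) (by linarith)
  rcases lt_trichotomy (G.eval y) 0 with hG | hG | hG
  · obtain ⟨c, hc, hZ, hneg⟩ := left hG.le
    refine ⟨c, fun z' hz' hmem => ?_, by rw [sign_neg hG, sign_neg hneg]⟩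
    rw [Set.uIcc_of_ge hc] at hmem
    exact hZ z' hz' hmem.1 hmem.2
  · obtain ⟨c, hc, hZ, hneg⟩ := left hG.le
    obtain ⟨d, hd, hZ', hpos⟩ := right hG.ge
    obtain ⟨e, he, he', h0⟩ := hR' G' c d (hc.trans hd) hneg.le hpos.le
    refine ⟨e, fun z' hz' hmem => ?_, by rw [h0, hG, sign_zero, sign_zero]⟩
    rcases Set.mem_uIcc.1 hmem with ⟨h1, h2⟩ | ⟨h1, h2⟩
    · exact hZ' z' hz' h1 (h2.trans he')
    · exact hZ z' hz' (he.trans h1) h2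
  · obtain ⟨c, hc, hZ, hpos⟩ := right hG.le
    refine ⟨c, fun z' hz' hmem => ?_, by rw [sign_pos hG, sign_pos hpos]⟩
    rw [Set.uIcc_of_le hc] at hmem
    exact hZ z' hz' hmem.1 hmem.2

theorem IsPolyMatch.exists_sign_eq (hR : HasPolyIVT R) (hR' : HasPolyIVT R')
    {m : R → R' → Prop}
    {Z : Set R} {Z' : Set R'} (hm : IsOrderMatch m Z Z') {G : Polynomial R} {G' : Polynomial R'}
    (h : IsPolyMatch m Z Z' G G') {y : R} {y' : R'} (hy : m y y') (hyZ : y ∉ Z) :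
    ∃ c', (∀ z' ∈ Z', z' ∉ Set.uIcc y' c') ∧
      SignType.sign (G'.eval c') = SignType.sign (G.eval y) := by
  rcases lt_or_gt_of_ne (h.ne hyZ) with hder | hder
  · obtain ⟨c, h1, h2⟩ := h.neg.exists_sign_eq_of_pos hR hR' hm hy hyZ (by simpa using hder)
    exact ⟨c, h1, by simpa [Left.sign_neg] using h2⟩
  · exact h.exists_sign_eq_of_pos hR hR' hm hy hyZ hder

end Thom

section Transfer

open Polynomial (derivative)

variable {R : Type*} [Field R] [LinearOrder R] {R' : Type*} [Field R'] [LinearOrder R']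
variable {A : Type*} [CommRing A]

theorem sgn_eq_zero_iff {α : A →+* R} {y : R} {g : Polynomial A} :
    sgn α y g = 0 ↔ (g.map α).eval y = 0 := sign_eq_zero_iff

/-- The sign vectors realized on `H` along `α` and `β` coincide. -/
def SgnMatch (α : A →+* R) (β : A →+* R') (H : Set (Polynomial A)) : Prop :=
  (∀ y, ∃ y', ∀ g ∈ H, sgn α y g = sgn β y' g) ∧ ∀ y', ∃ y, ∀ g ∈ H, sgn α y g = sgn β y' g

theorem SgnMatch.mono {α : A →+* R} {β : A →+* R'} {H H' : Set (Polynomial A)}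
    (h : SgnMatch α β H') (hH : H ⊆ H') : SgnMatch α β H :=
  ⟨fun y => (h.1 y).imp fun _ hy g hg => hy g (hH hg),
    fun y => (h.2 y).imp fun _ hy g hg => hy g (hH hg)⟩

variable [IsStrictOrderedRing R] [IsStrictOrderedRing R']

theorem exists_sgn_ne (hR : HasPolyIVT R) {α : A →+* R} {H : Set (Polynomial A)}
    (hd : ∀ g ∈ H, derivative g ∈ H) {q : Polynomial A} (hq : q ∈ H) (hq0 : q.map α ≠ 0) {a b : R}
    (hab : a < b) (h : (q.map α).eval a = 0 ∨ (q.map α).eval b = 0) :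
    ∃ g ∈ H, sgn α a g ≠ sgn α b g := by
  by_contra! hcon
  have ha : (q.map α).eval a = 0 := by
    rcases h with h | h
    · exact h
    · rwa [← sgn_eq_zero_iff, ← hcon q hq, sgn_eq_zero_iff] at h
  refine hq0 (Polynomial.eq_zero_of_infinite_isRoot _ ((Set.Icc_infinite hab).mono ?_))
  intro c hc
  have := sgn_eq_of_forall hR hd hcon hq hc.1 hc.2
  rw [sgn_eq_zero_iff.2 ha, sgn_eq_zero_iff] at this
  exact this

theorem exists_sgn_eq_insert (hR : HasPolyIVT R) (hR' : HasPolyIVT R') {α : A →+* R} {β : A →+* R'}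
    {H H₂ : Set (Polynomial A)} (hfin : H.Finite) (hsub : H ⊆ H₂)
    (hd : ∀ g ∈ H, derivative g ∈ H)
    (hleft : ∀ y, ∃ y', ∀ g ∈ H₂, sgn α y g = sgn β y' g)
    (hright : ∀ y', ∃ y, ∀ g ∈ H₂, sgn α y g = sgn β y' g)
    (hzero : ∀ q ∈ H, q.map α = 0 ↔ q.map β = 0) {g : Polynomial A} (hg : derivative g ∈ H)
    (hg0 : (derivative g).map α ≠ 0)
    (hrem : ∀ q ∈ H, q.map α ≠ 0 → ∃ r ∈ H₂,
      (∀ y, (q.map α).eval y = 0 → sgn α y g = sgn α y r) ∧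
      ∀ y, (q.map β).eval y = 0 → sgn β y g = sgn β y r) (y : R) :
    ∃ y', ∀ f ∈ insert g H, sgn α y f = sgn β y' f := by
  let m : R → R' → Prop := fun y y' => ∀ g ∈ H₂, sgn α y g = sgn β y' g
  let Z : Set R := {y | ∃ q ∈ H, q.map α ≠ 0 ∧ (q.map α).eval y = 0}
  let Z' : Set R' := {y | ∃ q ∈ H, q.map β ≠ 0 ∧ (q.map β).eval y = 0}
  have hroot : ∀ {y y'}, m y y' → ∀ {q}, q ∈ H →
      ((q.map α).eval y = 0 ↔ (q.map β).eval y' = 0) := fun {y y'} h q hq => by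
    rw [← sgn_eq_zero_iff, h q (hsub hq), sgn_eq_zero_iff]
  have hmem : ∀ {y y'}, m y y' → (y ∈ Z ↔ y' ∈ Z') := by
    intro y y' h
    refine exists_congr fun q => and_congr_right fun hq => and_congr (hzero q hq).not (hroot h hq)
  have hlt : ∀ {y y' z z'}, m y y' → m z z' → z ∈ Z → y < z → y' < z' := by
    rintro y y' z z' hy hz ⟨q, hq, hq0, hqz⟩ hlt
    exact lt_of_sgn_ne hR hR' hd (fun g hg => hy g (hsub hg)) (fun g hg => hz g (hsub hg))
      (exists_sgn_ne hR hd hq hq0 hlt (Or.inr hqz)) hlt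
  have hgt : ∀ {y y' z z'}, m y y' → m z z' → z ∈ Z → z < y → z' < y' := by
    rintro y y' z z' hy hz ⟨q, hq, hq0, hqz⟩ hlt
    exact lt_of_sgn_ne hR hR' hd (fun g hg => hz g (hsub hg)) (fun g hg => hy g (hsub hg))
      (exists_sgn_ne hR hd hq hq0 hlt (Or.inl hqz)) hlt
  have hlt' : ∀ {y y' z z'}, m y y' → m z z' → z ∈ Z → y' < z' → y < z := by
    rintro y y' z z' hy hz hZ hlt
    obtain ⟨q, hq, hq0, hqz⟩ := (hmem hz).1 hZ
    exact lt_of_sgn_ne hR' hR hd (fun g hg => (hy g (hsub hg)).symm)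
      (fun g hg => (hz g (hsub hg)).symm) (exists_sgn_ne hR' hd hq hq0 hlt (Or.inr hqz)) hlt
  have hgt' : ∀ {y y' z z'}, m y y' → m z z' → z ∈ Z → z' < y' → z < y := by
    rintro y y' z z' hy hz hZ hlt
    obtain ⟨q, hq, hq0, hqz⟩ := (hmem hz).1 hZ
    exact lt_of_sgn_ne hR' hR hd (fun g hg => (hz g (hsub hg)).symm)
      (fun g hg => (hy g (hsub hg)).symm) (exists_sgn_ne hR' hd hq hq0 hlt (Or.inl hqz)) hlt
  have hm : IsOrderMatch m Z Z' :=
    { finite := by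
        refine (hfin.biUnion fun q _ => (q.map α).roots.toFinset.finite_toSet).subset ?_
        rintro y ⟨q, hq, hq0, hy⟩
        exact Set.mem_biUnion hq (by simp [hq0, hy])
      left := hleft
      right := hright
      mem_iff := hmem
      lt_iff := fun hy hz hZ => ⟨hlt hy hz hZ, hlt' hy hz hZ⟩
      gt_iff := fun hy hz hZ => ⟨hgt hy hz hZ, hgt' hy hz hZ⟩ }
  have hpoly : IsPolyMatch m Z Z' (g.map α) (g.map β) :=
    { deriv := fun hy => by
        have := hy _ (hsub hg)
        rwa [sgn, sgn, ← Polynomial.derivative_map, ← Polynomial.derivative_map] at this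
      ne := fun hy h0 => hy ⟨_, hg, hg0, by rwa [← Polynomial.derivative_map]⟩
      ne' := fun hy h0 => hy ⟨_, hg, fun h => hg0 ((hzero _ hg).2 h),
        by rwa [← Polynomial.derivative_map]⟩
      sign := by
        rintro z z' hz ⟨q, hq, hq0, hqz⟩
        obtain ⟨r, hr, h1, h2⟩ := hrem q hq hq0
        have e := hz r hr
        rw [← h1 z hqz, ← h2 z' ((hroot hz hq).1 hqz)] at e
        exact e }
  obtain ⟨y', hy⟩ := hleft y
  by_cases hyZ : y ∈ Z
  · refine ⟨y', fun f hf => ?_⟩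
    rcases hf with rfl | hf
    · exact hpoly.sign hy hyZ
    · exact hy f (hsub hf)
  · obtain ⟨c, hc, hcg⟩ := hpoly.exists_sign_eq hR hR' hm hy hyZ
    refine ⟨c, fun f hf => ?_⟩
    rcases hf with rfl | hf
    · exact hcg.symm
    rw [hy f (hsub hf)]
    by_cases hf0 : f.map β = 0
    · simp [sgn, hf0]
    have hne : ∀ d ∈ Set.uIcc y' c, (f.map β).eval d ≠ 0 := fun d hd h0 =>
      hc d ⟨f, hf, hf0, h0⟩ hd
    rcases le_total y' c with h | h
    · exact hR'.sign_eq h fun d h1 h2 => hne d (Set.mem_uIcc.2 (Or.inl ⟨h1, h2⟩))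
    · exact (hR'.sign_eq h fun d h1 h2 => hne d (Set.mem_uIcc.2 (Or.inr ⟨h1, h2⟩))).symm

/-- Pseudo-division with an even power of the leading coefficient. -/
theorem exists_pseudo_rem (q : Polynomial A) (c : A) (e : ℕ) (hq : q.natDegree ≤ e)
    (hc : q.coeff e = c) (g : Polynomial A) :
    ∃ (N : ℕ) (s r : Polynomial A), Polynomial.C (c ^ (2 * N)) * g = s * q + r ∧
      r.degree < e := by
  induction hn : g.natDegree using Nat.strong_induction_on generalizing g with
  | _ n ih =>
    by_cases hlt : g.degree < e
    · exact ⟨0, 0, g, by simp, hlt⟩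
    have hle : e ≤ g.natDegree := by
      by_contra! hcon
      exact hlt (Polynomial.degree_le_natDegree.trans_lt (by exact_mod_cast hcon))
    let t := Polynomial.C (g.leadingCoeff) * Polynomial.X ^ (g.natDegree - e)
    let g' := Polynomial.C c * g - t * q
    have htd : t.natDegree ≤ g.natDegree - e :=
      (Polynomial.natDegree_C_mul_X_pow_le _ _)
    have hg'deg : g'.natDegree ≤ g.natDegree := by
      refine (Polynomial.natDegree_sub_le _ _).trans (max_le (Polynomial.natDegree_C_mul_le _ _)
        (Polynomial.natDegree_mul_le.trans ?_))
      omega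
    have hco : g'.coeff g.natDegree = 0 := by
      have h1 : (t * q).coeff g.natDegree = g.leadingCoeff * c := by
        have h2 : g.natDegree = e + (g.natDegree - e) := by omega
        simp only [t, mul_assoc, Polynomial.coeff_C_mul]
        rw [mul_comm (Polynomial.X ^ _), h2, Nat.add_sub_cancel_left, Polynomial.coeff_mul_X_pow, hc]
      simp only [g', Polynomial.coeff_sub, h1, Polynomial.coeff_C_mul]
      rw [← Polynomial.leadingCoeff]
      ring
    have hfin : ∃ (N : ℕ) (s r : Polynomial A), Polynomial.C (c ^ (2 * N)) * g' = s * q + r ∧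
        r.degree < e := by
      by_cases hlt' : g'.degree < e
      · exact ⟨0, 0, g', by simp, hlt'⟩
      have : g'.natDegree < g.natDegree := by
        refine lt_of_le_of_ne hg'deg fun h => hlt' ?_
        have h0 : g' = 0 := by
          rw [← Polynomial.leadingCoeff_eq_zero, Polynomial.leadingCoeff, h, hco]
        simp [h0]
      exact ih _ (hn ▸ this) g' rfl
    obtain ⟨N, s, r, h1, h2⟩ := hfin
    refine ⟨N + 1, Polynomial.C c * s + Polynomial.C (c ^ (2 * N + 1)) * t, Polynomial.C c * r,
      ?_, ?_⟩
    · have h3 : Polynomial.C (c ^ (2 * (N + 1))) * g = Polynomial.C c *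
          (Polynomial.C (c ^ (2 * N)) * g') + Polynomial.C (c ^ (2 * N + 1)) * t * q := by
        simp only [g', map_pow]
        ring
      rw [h3, h1]
      ring
    · rw [Polynomial.degree_lt_iff_coeff_zero] at h2 ⊢
      intro m hm
      simp [h2 m hm]

theorem finite_iterate_derivative (g : Polynomial A) : {p | ∃ i, p = derivative^[i] g}.Finite := by
  refine (((Finset.range (g.natDegree + 1)).finite_toSet.image
    (fun i => derivative^[i] g)).insert 0).subset ?_
  rintro _ ⟨i, rfl⟩
  rcases lt_or_ge i (g.natDegree + 1) with h | h
  · exact Or.inr ⟨i, by simpa using h, rfl⟩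
  · exact Or.inl (Polynomial.iterate_derivative_eq_zero (by omega))

/-- If the signs of all coefficients eventually agree with those along `α`, so do the sets of
realized sign vectors of any finite family of univariate polynomials. -/
theorem eventually_sgnMatch (hR : HasPolyIVT R) (hR' : HasPolyIVT R') {α : A →+* R} {X : Type*}
    {F : Filter X} {β : X → A →+* R'}
    (hF : ∀ a, ∀ᶠ x in F, SignType.sign (β x a) = SignType.sign (α a))
    {H : Set (Polynomial A)} (hH : H.Finite) : ∀ᶠ x in F, SgnMatch α (β x) H := by
  have hcoeff : ∀ {H : Set (Polynomial A)}, H.Finite → ∀ᶠ x in F, ∀ g ∈ H, ∀ i,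
      SignType.sign (β x (g.coeff i)) = SignType.sign (α (g.coeff i)) := by
    intro H hH
    rw [Filter.eventually_all_finite hH]
    intro g _
    have h1 : ∀ᶠ x in F, ∀ i ∈ Finset.range (g.natDegree + 1),
        SignType.sign (β x (g.coeff i)) = SignType.sign (α (g.coeff i)) := by
      rw [Filter.eventually_all_finset]
      exact fun i _ => hF _
    filter_upwards [h1] with x hx i
    rcases lt_or_ge i (g.natDegree + 1) with h | h
    · exact hx i (by simpa using h)
    · rw [Polynomial.coeff_eq_zero_of_natDegree_lt (by omega)]
      simp
  have main : ∀ (d : ℕ) (H : Set (Polynomial A)), H.Finite → (∀ g ∈ H, (g.map α).natDegree ≤ d) →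
      ∀ᶠ x in F, SgnMatch α (β x) H := by
    intro d
    induction d with
    | zero =>
      intro H hH hdeg
      filter_upwards [hcoeff hH] with x hx
      have key : ∀ (y : R) (y' : R'), ∀ g ∈ H, sgn α y g = sgn (β x) y' g := by
        intro y y' g hg
        have h1 := hdeg g hg
        have h2 : ((g.map (β x)).natDegree) = 0 := by
          rw [Polynomial.natDegree_eq_zero_iff_degree_le_zero, Polynomial.degree_le_iff_coeff_zero]
          intro i hi
          have h3 := hx g hg i
          rw [← Polynomial.coeff_map α, Polynomial.coeff_eq_zero_of_natDegree_lt (p := g.map α),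
            sign_zero, sign_eq_zero_iff] at h3
          · rwa [Polynomial.coeff_map]
          · have : 0 < i := by exact_mod_cast hi
            omega
        rw [sgn, sgn, Polynomial.eq_C_of_natDegree_eq_zero h2,
          Polynomial.eq_C_of_natDegree_eq_zero (Nat.le_zero.1 h1)]
        simpa using (hx g hg 0).symm
      exact ⟨fun y => ⟨0, key y 0⟩, fun y' => ⟨0, key 0 y'⟩⟩
    | succ d ih =>
      have inner : ∀ (G : Set (Polynomial A)), G.Finite → (∀ g ∈ G, (g.map α).natDegree ≤ d + 1) →
          ∀ (L : Set (Polynomial A)), L.Finite → (∀ g ∈ L, (g.map α).natDegree ≤ d) →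
          ∀ᶠ x in F, SgnMatch α (β x) (L ∪ G) := by
        intro G hG
        induction G, hG using Set.Finite.induction_on with
        | empty => exact fun _ L hL hLd => by simpa using ih L hL hLd
        | @insert g G hgG hG ihG =>
          intro hGd L hL hLd
          have hGd' : ∀ f ∈ G, (f.map α).natDegree ≤ d + 1 := fun f hf => hGd f (Or.inr hf)
          by_cases hg0 : (derivative g).map α = 0
          · have hg : (g.map α).natDegree = 0 := by
              rw [← Polynomial.derivative_map] at hg0
              exact Polynomial.derivative_eq_zero.1 hg0
            refine (ihG hGd' (insert g L) (hL.insert g) ?_).mono fun x hx => hx.mono ?_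
            · rintro f (rfl | hf)
              · omega
              · exact hLd f hf
            · rintro f (hf | rfl | hf)
              · exact Or.inl (Or.inr hf)
              · exact Or.inl (Or.inl rfl)
              · exact Or.inr hf
          let L₁ : Set (Polynomial A) :=
            L ∪ ⋃ f ∈ L ∪ insert g G, {p | ∃ i, p = derivative^[i] (derivative f)}
          let H : Set (Polynomial A) := L₁ ∪ G
          have hL₁ : L₁.Finite :=
            hL.union ((hL.union (hG.insert g)).biUnion fun f _ => finite_iterate_derivative _)
          have hHfin : H.Finite := hL₁.union hG
          have hmem : ∀ f ∈ L ∪ insert g G, ∀ i, derivative^[i] (derivative f) ∈ L₁ :=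
            fun f hf i => Or.inr (Set.mem_biUnion hf ⟨i, rfl⟩)
          have hd : ∀ f ∈ H, derivative f ∈ H := by
            rintro f ((hf | hf) | hf)
            · exact Or.inl (hmem f (Or.inl hf) 0)
            · simp only [Set.mem_iUnion] at hf
              obtain ⟨f', hf', i, rfl⟩ := hf
              have := hmem f' hf' (i + 1)
              rw [Function.iterate_succ_apply'] at this
              exact Or.inl this
            · exact Or.inl (hmem f (Or.inr (Or.inr hf)) 0)
          have hL₁d : ∀ f ∈ L₁, (f.map α).natDegree ≤ d := by
            rintro f (hf | hf)
            · exact hLd f hf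
            · simp only [Set.mem_iUnion] at hf
              obtain ⟨f', hf', i, rfl⟩ := hf
              rw [← Polynomial.iterate_derivative_map, ← Polynomial.derivative_map]
              have h1 := Polynomial.natDegree_iterate_derivative (derivative (f'.map α)) i
              have h2 := Polynomial.natDegree_derivative_le (f'.map α)
              have h3 : (f'.map α).natDegree ≤ d + 1 := by
                rcases hf' with hf' | hf'
                · exact (hLd f' hf').trans (Nat.le_succ d)
                · exact hGd f' hf'
              omega
          have hHd : ∀ q ∈ H, (q.map α).natDegree ≤ d + 1 := by
            rintro f (hf | hf)
            · exact (hL₁d f hf).trans (Nat.le_succ d)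
            · exact hGd' f hf
          let tr : Polynomial A → Polynomial A := fun q =>
            ∑ i ∈ Finset.range ((q.map α).natDegree + 1), Polynomial.monomial i (q.coeff i)
          have htr : ∀ q i, (tr q).coeff i = if i ≤ (q.map α).natDegree then q.coeff i else 0 := by
            intro q i
            simp [tr, Polynomial.finsetSum_coeff, Polynomial.coeff_monomial]
          have hex : ∀ q : Polynomial A, ∃ (N : ℕ) (s r : Polynomial A),
              Polynomial.C (q.coeff (q.map α).natDegree ^ (2 * N)) * g = s * tr q + r ∧
              r.degree < ((q.map α).natDegree : ℕ) := fun q =>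
            exists_pseudo_rem (tr q) _ _ (by
              refine Polynomial.natDegree_le_iff_coeff_eq_zero.2 fun i hi => ?_
              rw [htr, if_neg (by omega)]) (by rw [htr, if_pos le_rfl]) g
          choose N s r hdiv hrdeg using hex
          have hrd : ∀ q ∈ H, ((r q).map α).natDegree ≤ d := by
            intro q hq
            have h1 : ((r q).map α).degree < ((q.map α).natDegree : ℕ) :=
              Polynomial.degree_map_le.trans_lt (hrdeg q)
            have h2 := hHd q hq
            rcases eq_or_ne ((r q).map α) 0 with h0 | h0
            · simp [h0]
            · have := (Polynomial.natDegree_lt_iff_degree_lt h0).2 h1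
              omega
          have hind := ihG hGd' (L₁ ∪ r '' H) (hL₁.union (hHfin.image r)) (by
            rintro f (hf | ⟨q, hq, rfl⟩)
            · exact hL₁d f hf
            · exact hrd q hq)
          filter_upwards [hind, hcoeff hHfin] with x hx hxc
          have hxz : ∀ q ∈ H, ∀ i, α (q.coeff i) = 0 ↔ β x (q.coeff i) = 0 := fun q hq i => by
            rw [← sign_eq_zero_iff, ← hxc q hq i, sign_eq_zero_iff]
          have hzero : ∀ q ∈ H, q.map α = 0 ↔ q.map (β x) = 0 := by
            intro q hq
            simp only [Polynomial.ext_iff, Polynomial.coeff_map, Polynomial.coeff_zero]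
            exact forall_congr' fun i => hxz q hq i
          have htrα : ∀ q, (tr q).map α = q.map α := by
            intro q
            ext i
            rw [Polynomial.coeff_map, htr]
            split_ifs with h
            · rw [Polynomial.coeff_map]
            · rw [map_zero, Polynomial.coeff_eq_zero_of_natDegree_lt (by omega)]
          have htrβ : ∀ q ∈ H, (tr q).map (β x) = q.map (β x) := by
            intro q hq
            ext i
            rw [Polynomial.coeff_map, htr]
            split_ifs with h
            · rw [Polynomial.coeff_map]
            · rw [map_zero, Polynomial.coeff_map, eq_comm, ← hxz q hq, ← Polynomial.coeff_map,
                Polynomial.coeff_eq_zero_of_natDegree_lt (by omega)]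
          have hsub : H ⊆ L₁ ∪ r '' H ∪ G := by
            rintro f (hf | hf)
            · exact Or.inl (Or.inl hf)
            · exact Or.inr hf
          have hrem : ∀ q ∈ H, q.map α ≠ 0 → ∃ t ∈ L₁ ∪ r '' H ∪ G,
              (∀ y, (q.map α).eval y = 0 → sgn α y g = sgn α y t) ∧
              ∀ y, (q.map (β x)).eval y = 0 → sgn (β x) y g = sgn (β x) y t := by
            intro q hq hq0
            have hlc : α (q.coeff (q.map α).natDegree) ≠ 0 := by
              rw [← Polynomial.coeff_map]
              exact Polynomial.leadingCoeff_ne_zero.2 hq0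
            have hlc' : β x (q.coeff (q.map α).natDegree) ≠ 0 := (hxz q hq _).not.1 hlc
            refine ⟨r q, Or.inl (Or.inr ⟨q, hq, rfl⟩), fun y hy => ?_, fun y hy => ?_⟩
            · have h1 := congrArg (fun p => (p.map α).eval y) (hdiv q)
              simp only [Polynomial.map_mul, Polynomial.map_add, Polynomial.eval_mul,
                Polynomial.eval_add, htrα q, hy, mul_zero, zero_add, Polynomial.map_C,
                Polynomial.eval_C] at h1
              rw [sgn, sgn, ← h1, sign_mul, map_pow, sign_pos ((even_two_mul _).pow_pos hlc), one_mul]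
            · have h1 := congrArg (fun p => (p.map (β x)).eval y) (hdiv q)
              simp only [Polynomial.map_mul, Polynomial.map_add, Polynomial.eval_mul,
                Polynomial.eval_add, htrβ q hq, hy, mul_zero, zero_add, Polynomial.map_C,
                Polynomial.eval_C] at h1
              rw [sgn, sgn, ← h1, sign_mul, map_pow, sign_pos ((even_two_mul _).pow_pos hlc'), one_mul]
          have hgH : derivative g ∈ H := Or.inl (hmem g (Or.inr (Or.inl rfl)) 0)
          have hins : L ∪ insert g G ⊆ insert g H := by
            rintro f (hf | rfl | hf)
            · exact Or.inr (Or.inl (Or.inl hf))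
            · exact Or.inl rfl
            · exact Or.inr (Or.inr hf)
          refine SgnMatch.mono ⟨?_, ?_⟩ hins
          · exact exists_sgn_eq_insert hR hR' hHfin hsub hd hx.1 hx.2 hzero hgH hg0 hrem
          · intro y'
            obtain ⟨y, hy⟩ := exists_sgn_eq_insert hR' hR hHfin hsub hd
              (fun y => (hx.2 y).imp fun _ h g hg => (h g hg).symm)
              (fun y => (hx.1 y).imp fun _ h g hg => (h g hg).symm)
              (fun q hq => (hzero q hq).symm) hgH ((hzero _ hgH).not.1 hg0)
              (fun q hq hq0 => (hrem q hq ((hzero q hq).not.2 hq0)).imp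
                fun _ h => ⟨h.1, h.2.2, h.2.1⟩) y'
            exact ⟨y, fun f hf => (hy f hf).symm⟩
      intro H hH hdeg
      simpa using inner H hH hdeg ∅ Set.finite_empty (by simp)
  exact main (hH.toFinset.sup fun g => (g.map α).natDegree) H hH fun g hg =>
    Finset.le_sup (f := fun g => (g.map α).natDegree) (hH.mem_toFinset.2 hg)

end Transfer

section Stengle

theorem sign_map_real {R : Type*} [Field R] [LinearOrder R] [IsStrictOrderedRing R] (ρ : ℝ →+* R)
    (c : ℝ) : SignType.sign (ρ c) = SignType.sign c := by
  have key : ∀ c : ℝ, 0 < c → 0 < ρ c := fun c hc => by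
    have h1 : 0 ≤ ρ c := by
      rw [← Real.sq_sqrt hc.le, map_pow]
      exact sq_nonneg _
    exact h1.lt_of_ne' ((map_ne_zero ρ).2 hc.ne')
  rcases lt_trichotomy c 0 with h | rfl | h
  · rw [sign_neg h, sign_neg]
    simpa using key (-c) (by linarith)
  · simp
  · rw [sign_pos h, sign_pos (key c h)]

/-- A ring homomorphism from a real polynomial ring to a field with the intermediate value
property for polynomials can be replaced, for any finite set of polynomials and up to signs, by
evaluation at a real point. -/
theorem exists_sign_eval_eq {R : Type*} [Field R] [LinearOrder R] [IsStrictOrderedRing R]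
    (hR : HasPolyIVT R) {m : ℕ} (φ : MvPolynomial (Fin m) ℝ →+* R)
    {G : Set (MvPolynomial (Fin m) ℝ)} (hG : G.Finite) :
    ∃ a : Fin m → ℝ, ∀ g ∈ G, SignType.sign (eval a g) = SignType.sign (φ g) := by
  induction m with
  | zero =>
    refine ⟨0, fun g _ => ?_⟩
    rw [eq_C_of_isEmpty g, eval_C]
    exact (sign_map_real (φ.comp C) _).symm
  | succ m ih =>
    let e := finSuccEquiv ℝ m
    let α : MvPolynomial (Fin m) ℝ →+* R :=
      (φ.comp (e.symm : Polynomial (MvPolynomial (Fin m) ℝ) →+* MvPolynomial (Fin (m + 1)) ℝ)).comp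
        Polynomial.C
    let y : R := φ (e.symm Polynomial.X)
    have hφ : ∀ g, φ g = ((e g).map α).eval y := by
      intro g
      have : φ.comp (e.symm : Polynomial (MvPolynomial (Fin m) ℝ) →+* MvPolynomial (Fin (m + 1)) ℝ)
          = Polynomial.eval₂RingHom α y := by
        refine Polynomial.ringHom_ext (fun a => ?_) ?_
        · simp [α]
        · simp [y]
      have h := congrArg (fun f => f (e g)) this
      simpa [Polynomial.eval_map] using h
    let F : Filter (Fin m → ℝ) := ⨅ s : Finset (MvPolynomial (Fin m) ℝ),
      Filter.principal {a | ∀ g ∈ s, SignType.sign (eval a g) = SignType.sign (α g)}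
    have hF : F.NeBot := by
      refine Filter.iInf_neBot_of_directed (fun s t => ?_) fun s => ?_
      · classical
        exact ⟨s ∪ t, Filter.principal_mono.2 fun a ha g hg => ha g (Finset.mem_union_left _ hg),
          Filter.principal_mono.2 fun a ha g hg => ha g (Finset.mem_union_right _ hg)⟩
      · exact Filter.principal_neBot_iff.2 (ih α s.finite_toSet)
    have hF' : ∀ g, ∀ᶠ a in F, SignType.sign (eval a g) = SignType.sign (α g) := fun g =>
      Filter.mem_iInf_of_mem {g} (by simp)
    obtain ⟨a, ha⟩ := (eventually_sgnMatch hR hasPolyIVT_real (β := fun a => eval a) hF'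
      (hG.image e)).exists
    obtain ⟨y', hy'⟩ := ha.1 y
    refine ⟨Fin.cons y' a, fun g hg => ?_⟩
    rw [eval_eq_eval_mv_eval', hφ]
    exact (hy' _ ⟨g, hg, rfl⟩).symm

/-- **Krivine-Stengle Positivstellensatz** for real polynomial rings. -/
theorem IsPreord.exists_neg_even_pow_mem {m : ℕ} {T G : Set (MvPolynomial (Fin m) ℝ)}
    (hT : IsPreord T) (hG : G.Finite) (hGT : G ⊆ T) (q : MvPolynomial (Fin m) ℝ)
    (h : ∀ a : Fin m → ℝ, (∀ g ∈ G, 0 ≤ eval a g) → eval a q = 0) :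
    ∃ N : ℕ, -(q ^ (2 * N)) ∈ T := by
  by_contra! hq
  obtain ⟨P, hTP, hP, hqP⟩ := hT.exists_isPrimeCone q hq
  obtain ⟨R, _, _, _, φ, hR, hφ⟩ := hP.exists_field
  obtain ⟨a, ha⟩ := exists_sign_eval_eq hR φ (hG.insert q)
  have h1 : eval a q = 0 := h a fun g hg => by
    rw [← sign_nonneg_iff, ha g (Or.inr hg), sign_nonneg_iff, hφ]
    exact hTP (hGT hg)
  have h2 := ha q (Or.inl rfl)
  rw [h1, sign_zero, eq_comm, sign_eq_zero_iff] at h2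
  exact hqP ⟨(hφ q).1 h2.ge, (hφ (-q)).1 (by simp [h2])⟩

end Stengle

section QuadModule

variable {σ : Type}

/-- A quadratic module of a real polynomial ring. -/
structure IsQuadModule (M : Set (MvPolynomial σ ℝ)) : Prop where
  one : 1 ∈ M
  add : ∀ {a b}, a ∈ M → b ∈ M → a + b ∈ M
  mul_sq : ∀ {a} b, a ∈ M → a * (b * b) ∈ M

/-- A set of polynomials that bounds every polynomial from above by a constant. -/
def BoundsAll (M : Set (MvPolynomial σ ℝ)) : Prop :=
  ∀ a, ∃ r : ℝ, C r - a ∈ M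

theorem BoundsAll.mono {M M' : Set (MvPolynomial σ ℝ)} (h : BoundsAll M) (hM : M ⊆ M') :
    BoundsAll M' := fun a => (h a).imp fun _ hr => hM hr

namespace IsQuadModule

variable {M : Set (MvPolynomial σ ℝ)}

theorem sq (hM : IsQuadModule M) (a : MvPolynomial σ ℝ) : a * a ∈ M := by
  simpa using hM.mul_sq a hM.one

theorem zero (hM : IsQuadModule M) : 0 ∈ M := by simpa using hM.sq 0

theorem mul_C (hM : IsQuadModule M) {a : MvPolynomial σ ℝ} (ha : a ∈ M) {c : ℝ} (hc : 0 ≤ c) :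
    a * C c ∈ M := by
  have := hM.mul_sq (C (√c)) ha
  rwa [← C_mul, Real.mul_self_sqrt hc] at this

theorem C_mem (hM : IsQuadModule M) {c : ℝ} (hc : 0 ≤ c) : C c ∈ M := by
  simpa using hM.mul_C hM.one hc

theorem of_mul_C (hM : IsQuadModule M) {a : MvPolynomial σ ℝ} {c : ℝ} (hc : 0 < c)
    (ha : a * C c ∈ M) : a ∈ M := by
  have := hM.mul_C ha (inv_pos.2 hc).le
  rwa [mul_assoc, ← C_mul, mul_inv_cancel₀ hc.ne', C_1, mul_one] at this

theorem mul_isSumSq (hM : IsQuadModule M) {a s : MvPolynomial σ ℝ} (ha : a ∈ M)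
    (hs : IsSumSq s) : a * s ∈ M := by
  induction hs with
  | zero => simpa using hM.zero
  | sq_add b _ ih => simpa [mul_add] using hM.add (hM.mul_sq b ha) ih

theorem isSumSq_mem (hM : IsQuadModule M) {s : MvPolynomial σ ℝ} (hs : IsSumSq s) : s ∈ M := by
  simpa using hM.mul_isSumSq hM.one hs

theorem sum_mem (hM : IsQuadModule M) {ι : Type*} (s : Finset ι) {a : ι → MvPolynomial σ ℝ}
    (ha : ∀ i ∈ s, a i ∈ M) : ∑ i ∈ s, a i ∈ M :=
  Finset.sum_induction _ (· ∈ M) (fun _ _ => hM.add) hM.zero ha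

theorem C_sub_mono (hM : IsQuadModule M) {a : MvPolynomial σ ℝ} {r r' : ℝ} (h : C r - a ∈ M)
    (hr : r ≤ r') : C r' - a ∈ M := by
  have := hM.add h (hM.C_mem (sub_nonneg.2 hr))
  rw [C_sub] at this
  convert this using 1
  ring

theorem C_sq_sub_sq_mem (hM : IsQuadModule M) {a : MvPolynomial σ ℝ} {r : ℝ} (hr : 0 < r)
    (h1 : C r - a ∈ M) (h2 : C r + a ∈ M) : C (r * r) - a * a ∈ M := by
  refine hM.of_mul_C (c := 2 * r) (by positivity) ?_
  convert hM.add (hM.mul_sq (C r + a) h1) (hM.mul_sq (C r - a) h2) using 1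
  simp only [C_mul, map_ofNat]
  ring

/-- Adjoining an element to a quadratic module. -/
theorem adjoin (hM : IsQuadModule M) (a : MvPolynomial σ ℝ) :
    IsQuadModule {x | ∃ g ∈ M, ∃ s, IsSumSq s ∧ x = g + a * s} where
  one := ⟨1, hM.one, 0, .zero, by simp⟩
  add := by
    rintro _ _ ⟨g, hg, s, hs, rfl⟩ ⟨g', hg', s', hs', rfl⟩
    exact ⟨_, hM.add hg hg', _, hs.add hs', by ring⟩
  mul_sq := by
    rintro _ b ⟨g, hg, s, hs, rfl⟩
    exact ⟨_, hM.mul_sq b hg, _, hs.mul (.mul_self b), by ring⟩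

theorem subset_adjoin (a : MvPolynomial σ ℝ) :
    M ⊆ {x | ∃ g ∈ M, ∃ s, IsSumSq s ∧ x = g + a * s} :=
  fun g hg => ⟨g, hg, 0, .zero, by simp⟩

theorem mem_adjoin (hM : IsQuadModule M) (a : MvPolynomial σ ℝ) :
    a ∈ {x | ∃ g ∈ M, ∃ s, IsSumSq s ∧ x = g + a * s} :=
  ⟨0, hM.zero, 1, .one, by simp⟩

theorem _root_.IsSumSq.isQuadModule : IsQuadModule {s : MvPolynomial σ ℝ | IsSumSq s} where
  one := .one
  add := fun ha hb => .add ha hb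
  mul_sq := fun b ha => ha.mul (.mul_self b)

/-- A quadratic module containing `r - |X|²` bounds all polynomials. -/
theorem boundsAll [Fintype σ] (hM : IsQuadModule M) {r : ℝ} (hr : C r - ∑ i, X i * X i ∈ M) :
    BoundsAll M := by
  let B : MvPolynomial σ ℝ → Prop := fun a => ∃ r : ℝ, 0 < r ∧ C r - a ∈ M ∧ C r + a ∈ M
  have hadd : ∀ {a b}, B a → B b → B (a + b) := by
    rintro a b ⟨r, hr, h1, h2⟩ ⟨r', hr', h1', h2'⟩
    refine ⟨r + r', by positivity, ?_, ?_⟩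
    · convert hM.add h1 h1' using 1
      rw [C_add]; ring
    · convert hM.add h2 h2' using 1
      rw [C_add]; ring
  have hneg : ∀ {a}, B a → B (-a) := by
    rintro a ⟨r, hr, h1, h2⟩
    exact ⟨r, hr, by simpa using h2, by simpa [← sub_eq_add_neg] using h1⟩
  have hsq : ∀ {a}, B a → B (a * a) := by
    rintro a ⟨r, hr, h1, h2⟩
    exact ⟨r * r, by positivity, hM.C_sq_sub_sq_mem hr h1 h2,
      hM.add (hM.C_mem (by positivity)) (hM.sq a)⟩
  have hscale : ∀ {a} {c : ℝ}, 0 < c → B a → B (a * C c) := by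
    rintro a c hc ⟨r, hr, h1, h2⟩
    refine ⟨r * c, by positivity, ?_, ?_⟩
    · simpa [sub_mul] using hM.mul_C h1 hc.le
    · simpa [add_mul] using hM.mul_C h2 hc.le
  have hmul : ∀ {a b}, B a → B b → B (a * b) := by
    intro a b ha hb
    have h := hscale (c := 1 / 4) (by norm_num)
      (hadd (hsq (hadd ha hb)) (hneg (hsq (hadd ha (hneg hb)))))
    convert h using 1
    have h4 : (4 : MvPolynomial σ ℝ) * C (1 / 4) = 1 := by
      rw [← map_ofNat C 4, ← C_mul]; norm_num
    linear_combination (-a * b) * h4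
  have hC : ∀ c, B (C c) := fun c => by
    refine ⟨|c| + 1, by positivity, ?_, ?_⟩
    · rw [← C_sub]
      exact hM.C_mem (by linarith [le_abs_self c])
    · rw [← C_add]
      exact hM.C_mem (by linarith [neg_abs_le c])
  have hX : ∀ i, B (X i) := by
    classical
    intro i
    have h1 : C r - X i * X i ∈ M := by
      convert hM.add hr (hM.sum_mem (Finset.univ.erase i) fun j _ => hM.sq (X j)) using 1
      rw [← Finset.add_sum_erase _ _ (Finset.mem_univ i)]
      ring
    have h2 : (2 : MvPolynomial σ ℝ) * C (1 / 2) = 1 := by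
      rw [← map_ofNat C 2, ← C_mul]; norm_num
    have h3 := hM.add h1 (hM.sq (X i - C (1 / 2)))
    have h4 := hM.add h1 (hM.sq (X i + C (1 / 2)))
    have h5 : C r - X i * X i + (X i - C (1 / 2)) * (X i - C (1 / 2)) =
        C (r + 1 / 2 * (1 / 2)) - X i := by
      rw [C_add, C_mul]
      linear_combination -X i * h2
    have h6 : C r - X i * X i + (X i + C (1 / 2)) * (X i + C (1 / 2)) =
        C (r + 1 / 2 * (1 / 2)) + X i := by
      rw [C_add, C_mul]
      linear_combination X i * h2
    rw [h5] at h3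
    rw [h6] at h4
    refine ⟨|r + 1 / 2 * (1 / 2)| + 1, by positivity,
      hM.C_sub_mono h3 (by linarith [le_abs_self (r + 1 / 2 * (1 / 2))]), ?_⟩
    rw [← sub_neg_eq_add] at h4 ⊢
    exact hM.C_sub_mono h4 (by linarith [le_abs_self (r + 1 / 2 * (1 / 2))])
  have hall : ∀ a, B a := fun a => by
    induction a using MvPolynomial.induction_on with
    | C c => exact hC c
    | add p q hp hq => exact hadd hp hq
    | mul_X p i hp => exact hmul hp (hX i)
  exact fun a => (hall a).imp fun _ h => h.2.1

end IsQuadModule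

end QuadModule

section Putinar

variable {σ : Type}

namespace IsQuadModule

variable {M : Set (MvPolynomial σ ℝ)}

/-- A quadratic module not containing `-1` is contained in a total one. -/
theorem exists_total (hM : IsQuadModule M) (h : -1 ∉ M) :
    ∃ P, M ⊆ P ∧ IsQuadModule P ∧ -1 ∉ P ∧ ∀ a, a ∈ P ∨ -a ∈ P := by
  obtain ⟨P, hMP, hmax⟩ := zorn_subset_nonempty
    {P : Set (MvPolynomial σ ℝ) | IsQuadModule P ∧ -1 ∉ P} (by
      intro c hc hchain hne
      refine ⟨⋃₀ c, ⟨⟨?_, ?_, ?_⟩, ?_⟩, fun s hs => Set.subset_sUnion_of_mem hs⟩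
      · obtain ⟨s, hs⟩ := hne
        exact ⟨s, hs, (hc hs).1.one⟩
      · rintro a b ⟨s, hs, ha⟩ ⟨t, ht, hb⟩
        rcases hchain.total hs ht with h | h
        · exact ⟨t, ht, (hc ht).1.add (h ha) hb⟩
        · exact ⟨s, hs, (hc hs).1.add ha (h hb)⟩
      · rintro a b ⟨s, hs, ha⟩
        exact ⟨s, hs, (hc hs).1.mul_sq b ha⟩
      · rintro ⟨s, hs, h⟩
        exact (hc hs).2 h) M ⟨hM, h⟩
  obtain ⟨hP, hP1⟩ := hmax.prop
  have key : ∀ a, a ∉ P → ∃ g ∈ P, ∃ s, IsSumSq s ∧ -1 = g + a * s := by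
    intro a ha
    by_contra! hcon
    exact ha (hmax.le_of_ge (y := {x | ∃ g ∈ P, ∃ s, IsSumSq s ∧ x = g + a * s})
      ⟨hP.adjoin a, fun ⟨g, hg, s, hs, h⟩ => hcon g hg s hs h⟩ (subset_adjoin a)
      (hP.mem_adjoin a))
  refine ⟨P, hMP, hP, hP1, fun a => ?_⟩
  by_contra! hcon
  obtain ⟨p, hp, s, hs, h1⟩ := key a hcon.1
  obtain ⟨q, hq, t, ht, h2⟩ := key (-a) hcon.2
  have hns : -s ∈ P := by
    have := hP.add (hP.isSumSq_mem ht) (hP.add (hP.mul_isSumSq hq hs) (hP.mul_isSumSq hp ht))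
    convert this using 1
    linear_combination s * h2 + t * h1
  have has : a * s ∈ P := by
    refine hP.of_mul_C (c := 4) (by norm_num) ?_
    convert hP.add (hP.mul_sq (a + 1) (hP.isSumSq_mem hs)) (hP.mul_sq (a - 1) hns) using 1
    simp only [map_ofNat]
    ring
  exact hP1 (h1 ▸ hP.add hp has)

/-- A quadratic module that bounds all polynomials and does not contain `-1` is nonnegative at
some point. -/
theorem exists_point (hM : IsQuadModule M) (hb : BoundsAll M) (h : -1 ∉ M) :
    ∃ x : σ → ℝ, ∀ g ∈ M, 0 ≤ eval x g := by
  obtain ⟨P, hMP, hP, hP1, htot⟩ := hM.exists_total h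
  replace hb := hb.mono hMP
  have hC : ∀ {c : ℝ}, C c ∈ P → 0 ≤ c := by
    intro c hc
    by_contra! hlt
    refine hP1 (hP.of_mul_C (c := -c) (by linarith) ?_)
    simpa using hc
  let V : MvPolynomial σ ℝ → ℝ → Prop := fun a s => ∀ ε > 0, C (s + ε) - a ∈ P ∧ a - C (s - ε) ∈ P
  have hex : ∀ a, ∃ s, V a s := by
    intro a
    let S : Set ℝ := {r | a - C r ∈ P}
    have hne : S.Nonempty := by
      obtain ⟨r, hr⟩ := hb (-a)
      exact ⟨-r, by simpa [S, add_comm] using hr⟩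
    have hbdd : BddAbove S := by
      obtain ⟨r, hr⟩ := hb a
      refine ⟨r, fun t ht => ?_⟩
      have h1 := hP.add hr ht
      have h2 : C r - a + (a - C t) = C (r - t) := by rw [C_sub]; ring
      rw [h2] at h1
      linarith [hC h1]
    refine ⟨sSup S, fun ε hε => ⟨?_, ?_⟩⟩
    · rcases htot (C (sSup S + ε) - a) with h1 | h1
      · exact h1
      · rw [neg_sub] at h1
        linarith [le_csSup hbdd h1]
    · obtain ⟨t, ht, hlt⟩ := exists_lt_of_lt_csSup hne (show sSup S - ε < sSup S by linarith)
      have h1 := hP.add ht (hP.C_mem (sub_nonneg.2 hlt.le))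
      convert h1 using 1
      simp only [C_sub]
      ring
  have hVadd : ∀ {a b s t}, V a s → V b t → V (a + b) (s + t) := by
    intro a b s t ha hb ε hε
    obtain ⟨h1, h2⟩ := ha (ε / 2) (by positivity)
    obtain ⟨h3, h4⟩ := hb (ε / 2) (by positivity)
    constructor
    · convert hP.add h1 h3 using 1
      rw [show s + t + ε = (s + ε / 2) + (t + ε / 2) by ring, C_add]
      ring
    · convert hP.add h2 h4 using 1
      rw [show s + t - ε = (s - ε / 2) + (t - ε / 2) by ring, C_add]
      ring
  have hVneg : ∀ {a s}, V a s → V (-a) (-s) := by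
    intro a s ha ε hε
    obtain ⟨h1, h2⟩ := ha ε hε
    constructor
    · convert h2 using 1
      simp only [C_add, C_sub, C_neg]
      ring
    · convert h1 using 1
      simp only [C_add, C_sub, C_neg]
      ring
  have hVC : ∀ c, V (C c) c := by
    intro c ε hε
    rw [← C_sub, ← C_sub]
    exact ⟨hP.C_mem (by linarith), hP.C_mem (by linarith)⟩
  have hVpos : ∀ {a s} {c : ℝ}, 0 < c → V a s → V (a * C c) (s * c) := by
    intro a s c hc ha ε hε
    obtain ⟨h1, h2⟩ := ha (ε / c) (by positivity)
    constructor
    · convert hP.mul_C h1 hc.le using 1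
      rw [sub_mul, ← C_mul, add_mul, div_mul_cancel₀ _ hc.ne']
    · convert hP.mul_C h2 hc.le using 1
      rw [sub_mul, ← C_mul, sub_mul, div_mul_cancel₀ _ hc.ne']
  have hVscale : ∀ {a s} (c : ℝ), V a s → V (a * C c) (s * c) := by
    intro a s c ha
    rcases lt_trichotomy c 0 with h | rfl | h
    · simpa using hVneg (hVpos (neg_pos.2 h) ha)
    · simpa using hVC 0
    · exact hVpos h ha
  have hVzero : ∀ {a}, V a 0 → V (a * a) 0 := by
    intro a ha ε hε
    obtain ⟨h1, h2⟩ := ha (√ε) (Real.sqrt_pos.2 hε)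
    rw [zero_add] at h1
    rw [zero_sub, C_neg, sub_neg_eq_add, add_comm] at h2
    constructor
    · have := hP.C_sq_sub_sq_mem (Real.sqrt_pos.2 hε) h1 h2
      rwa [Real.mul_self_sqrt hε.le, ← zero_add ε] at this
    · convert hP.add (hP.sq a) (hP.C_mem hε.le) using 1
      simp
  have hVsq : ∀ {a s}, V a s → V (a * a) (s * s) := by
    intro a s ha
    have h1 := hVzero (by simpa using hVadd ha (hVneg (hVC s)))
    have h2 := hVadd (hVadd h1 (hVscale (2 * s) ha)) (hVneg (hVC (s * s)))
    convert h2 using 1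
    · simp only [C_mul, map_ofNat]
      ring
    · ring
  have hVmul : ∀ {a b s t}, V a s → V b t → V (a * b) (s * t) := by
    intro a b s t ha hb
    have h := hVscale (1 / 4)
      (hVadd (hVsq (hVadd ha hb)) (hVneg (hVsq (hVadd ha (hVneg hb)))))
    have h4 : (4 : MvPolynomial σ ℝ) * C (1 / 4) = 1 := by
      rw [← map_ofNat C 4, ← C_mul]; norm_num
    convert h using 1
    · linear_combination (-a * b) * h4
    · ring
  choose x hx using fun i : σ => hex (X i)
  have hV : ∀ a, V a (eval x a) := by
    intro a
    induction a using MvPolynomial.induction_on with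
    | C c => simpa using hVC c
    | add p q hp hq => simpa using hVadd hp hq
    | mul_X p i hp => simpa using hVmul hp (hx i)
  refine ⟨x, fun g hg => le_of_forall_pos_le_add fun ε hε => ?_⟩
  have h1 := hP.add (hV g ε hε).1 (hMP hg)
  rw [sub_add_cancel] at h1
  exact hC h1

/-- **Putinar's Positivstellensatz**. -/
theorem mem_of_forall_pos (hM : IsQuadModule M) (hb : BoundsAll M) {f : MvPolynomial σ ℝ}
    (hf : ∀ x : σ → ℝ, (∀ g ∈ M, 0 ≤ eval x g) → 0 < eval x f) : f ∈ M := by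
  have h1 : (-1 : MvPolynomial σ ℝ) ∈ {x | ∃ g ∈ M, ∃ s, IsSumSq s ∧ x = g + (-f) * s} := by
    by_contra hcon
    obtain ⟨x, hx⟩ := (hM.adjoin (-f)).exists_point (hb.mono (subset_adjoin _)) hcon
    have h1 := hf x fun g hg => hx g (subset_adjoin _ hg)
    have h2 := hx _ (hM.mem_adjoin (-f))
    rw [eval_neg] at h2
    linarith
  obtain ⟨g, hg, s, hs, h1⟩ := h1
  obtain ⟨k₁, hk₁⟩ := hb s
  obtain ⟨k₂, hk₂⟩ := hb (s * s * f)
  obtain ⟨r₀, hr₀⟩ := hb (-f)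
  obtain ⟨k, hk0, hk1, hk2⟩ : ∃ k : ℝ, 0 < k ∧ k₁ ≤ 2 * k ∧ k₂ ≤ k :=
    ⟨|k₁| + |k₂| + 1, by positivity, by
      linarith [le_abs_self k₁, abs_nonneg k₁, abs_nonneg k₂], by
      linarith [le_abs_self k₂, abs_nonneg k₁, abs_nonneg k₂]⟩
  replace hk₁ := hM.C_sub_mono hk₁ hk1
  replace hk₂ := hM.C_sub_mono hk₂ hk2
  have hss : s * (C (2 * k) - s) ∈ M := by
    refine hM.of_mul_C (c := 2 * k) (by positivity) ?_
    convert hM.add (hM.mul_sq (C (2 * k) - s) (hM.isSumSq_mem hs)) (hM.mul_sq s hk₁) using 1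
    ring
  have step : ∀ r : ℝ, 0 ≤ r → f + C r ∈ M → f + C (r - 1 / k) ∈ M := by
    intro r hr hfr
    refine hM.of_mul_C (c := k * k) (by positivity) ?_
    convert hM.add (hM.add (hM.mul_sq (C k - s) hfr) (hM.mul_C hg (c := 2 * k) (by positivity)))
      (hM.add (hM.mul_C hss hr) hk₂) using 1
    have h3 : (C (1 / k) : MvPolynomial σ ℝ) * C k = 1 := by
      rw [← C_mul, one_div_mul_cancel hk0.ne', C_1]
    simp only [C_sub, C_mul, map_ofNat]
    linear_combination -(C k) * h3 + 2 * C k * h1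
  have main : ∀ n : ℕ, f ∈ M ∨ f + C (r₀ - n / k) ∈ M := by
    intro n
    induction n with
    | zero => exact Or.inr (by simpa [add_comm] using hr₀)
    | succ n ih =>
      rcases ih with ih | ih
      · exact Or.inl ih
      · rcases le_or_gt 0 (r₀ - n / k) with h | h
        · refine Or.inr ?_
          convert step _ h ih using 3
          push_cast
          ring
        · refine Or.inl ?_
          convert hM.add ih (hM.C_mem (neg_pos.2 h).le) using 1
          rw [C_neg]; ring
  obtain ⟨n, hn⟩ := exists_nat_gt (r₀ * k)
  rcases main n with h | h
  · exact h
  · have : r₀ - n / k < 0 := by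
      rw [sub_neg, lt_div_iff₀ hk0]; exact hn
    convert hM.add h (hM.C_mem (neg_pos.2 this).le) using 1
    rw [C_neg]; ring

end IsQuadModule

theorem IsSumSq.isPreord : IsPreord {s : MvPolynomial σ ℝ | IsSumSq s} where
  add := fun ha hb => .add ha hb
  mul := fun ha hb => .mul ha hb
  sq := fun a => .mul_self a

/-- A quadratic module containing a polynomial with compact nonnegativity set bounds all
polynomials. -/
theorem IsQuadModule.boundsAll_of_isCompact {m : ℕ} {M : Set (MvPolynomial (Fin m) ℝ)}
    (hM : IsQuadModule M) {f : MvPolynomial (Fin m) ℝ} (hf : f ∈ M)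
    (hc : IsCompact {x : Fin m → ℝ | 0 ≤ eval x f}) : BoundsAll M := by
  let n : MvPolynomial (Fin m) ℝ := ∑ i, X i * X i
  obtain ⟨N, hN0, hN⟩ : ∃ N : ℝ, 0 < N ∧ ∀ x : Fin m → ℝ, 0 ≤ eval x f → eval x n < N := by
    obtain ⟨N, hN⟩ := hc.bddAbove_image (f := fun x => eval x n)
      (MvPolynomial.continuous_eval n).continuousOn
    exact ⟨|N| + 1, by positivity, fun x hx =>
      (hN ⟨x, hx, rfl⟩).trans_lt (by linarith [le_abs_self N])⟩
  have hn : IsSumSq n := .sum_mul_self _ _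
  let g := C N - n
  have hT := (IsSumSq.isPreord (σ := Fin m)).adjoin f
  have hTM : ∀ {a}, a ∈ {x | ∃ s ∈ {s : MvPolynomial (Fin m) ℝ | IsSumSq s},
      ∃ t ∈ {s | IsSumSq s}, x = s + f * t} → a ∈ M := by
    rintro _ ⟨s, hs, t, ht, rfl⟩
    exact hM.add (hM.isSumSq_mem hs) (hM.mul_isSumSq hf ht)
  set T := {x | ∃ s ∈ {s : MvPolynomial (Fin m) ℝ | IsSumSq s},
      ∃ t ∈ {s | IsSumSq s}, x = s + f * t} with hTdef
  have hST : ∀ {s : MvPolynomial (Fin m) ℝ}, IsSumSq s → s ∈ T :=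
    fun hs => IsSumSq.isPreord.subset_adjoin f hs
  have hT' := hT.adjoin (-g)
  obtain ⟨k, q, hq, p, hp, h1⟩ := hT'.exists_neg_even_pow_mem (G := {f, -g})
    (Set.toFinite _) (by
      rintro _ (rfl | rfl)
      · exact hT.subset_adjoin _ (IsSumSq.isPreord.mem_adjoin _)
      · exact hT.mem_adjoin _) 1 (by
      intro a ha
      have h1 := hN a (ha f (Or.inl rfl))
      have h2 := ha (-g) (Or.inr rfl)
      simp only [g, eval_neg, eval_sub, eval_C] at h2
      linarith)
  rw [one_pow] at h1
  have hgp : (1 + q) * g ∈ T := by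
    convert hT.mul hp (hT.sq g) using 1
    linear_combination (-g) * h1
  obtain ⟨r, s₀, hs₀, s₁, hs₁, h2⟩ := (IsSumSq.isQuadModule.adjoin g).boundsAll
    (IsSumSq.isQuadModule.mem_adjoin g) q
  have h3 : (C r - q) * (1 + q) ∈ T := by
    rw [h2]
    convert hT.add (hT.mul (hST hs₀) (hT.add hT.one hq)) (hT.mul (hST hs₁) hgp) using 1
    ring
  have h4 : C (r + r / 2 * (r / 2)) - q ∈ T := by
    convert hT.add h3 (hT.sq (q - C (r / 2))) using 1
    have : (C r : MvPolynomial (Fin m) ℝ) = 2 * C (r / 2) := by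
      rw [← map_ofNat C 2, ← C_mul]; congr 1; ring
    rw [C_add, C_mul, this]
    ring
  refine hM.boundsAll (r := N * (r + r / 2 * (r / 2)) + N) (hTM ?_)
  convert hT.add (hT.add (hT.mul h4 (hST (IsSumSq.isQuadModule.C_mem hN0.le))) hgp)
    (hT.mul hq (hST hn)) using 1
  simp only [g, n, C_add, C_mul]
  ring

end Putinar

section Algebraicity

/-- A transcendental element of an essentially finitely generated field extension in
characteristic zero is mapped to `1` by some derivation. -/
theorem Transcendental.exists_derivation_eq_one {k K : Type*} [Field k] [CharZero k] [Field K]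
    [Algebra k K] [Algebra.EssFiniteType k K] {x : K} (hx : Transcendental k x) :
    ∃ D : Derivation k K K, D x = 1 := by
  let : Algebra (Polynomial k) K := (Polynomial.aeval (R := k) x).toRingHom.toAlgebra
  have hmap : ∀ p : Polynomial k, algebraMap (Polynomial k) K p = Polynomial.aeval x p :=
    fun p => rfl
  have : IsScalarTower k (Polynomial k) K := .of_algebraMap_eq fun c => by
    rw [hmap, Polynomial.algebraMap_eq, Polynomial.aeval_C]
  have : FaithfulSMul (Polynomial k) K := by
    rw [faithfulSMul_iff_algebraMap_injective]
    exact transcendental_iff_injective.1 hx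
  let := FractionRing.liftAlgebra (Polynomial k) K
  have : IsScalarTower k (FractionRing (Polynomial k)) K := .to₁₃₄ k (Polynomial k) _ K
  have : Algebra.EssFiniteType (FractionRing (Polynomial k)) K := .of_comp k _ _
  have : CharZero (FractionRing (Polynomial k)) := algebraRat.charZero _
  have : Algebra.FormallySmooth (Polynomial k) (FractionRing (Polynomial k)) :=
    .of_isLocalization (nonZeroDivisors _)
  have : Algebra.FormallySmooth (Polynomial k) K :=
    .comp _ (FractionRing (Polynomial k)) _
  have hinj : Function.Injective (KaehlerDifferential.mapBaseChange k (Polynomial k) K) := by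
    rw [← LinearMap.ker_eq_bot, eq_bot_iff]
    intro z hz
    obtain ⟨y, rfl⟩ := (Algebra.H1Cotangent.exact_δ_mapBaseChange k (Polynomial k) K z).1 hz
    rw [Subsingleton.elim y 0, map_zero]
    exact Submodule.zero_mem _
  have hne : KaehlerDifferential.D k K x ≠ 0 := by
    have h1 : KaehlerDifferential.D k K x = KaehlerDifferential.mapBaseChange k (Polynomial k) K
        (1 ⊗ₜ KaehlerDifferential.D k (Polynomial k) Polynomial.X) := by
      rw [KaehlerDifferential.mapBaseChange_tmul, KaehlerDifferential.map_D, hmap,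
        Polynomial.aeval_X, one_smul]
    rw [h1, Ne, map_eq_zero_iff _ hinj]
    intro h2
    have h3 := congrArg (fun z => TensorProduct.rid (Polynomial k) K
      ((KaehlerDifferential.polynomialEquiv k).toLinearMap.lTensor K z)) h2
    simp at h3
  obtain ⟨l, hl⟩ := Module.Projective.exists_dual_eq_one K hne
  exact ⟨l.compDer (KaehlerDifferential.D k K), hl⟩

variable {σ : Type} [Fintype σ]

theorem MvPolynomial.derivation_eq_sum {k M : Type*} [CommRing k] [AddCommGroup M] [Module k M]
    [Module (MvPolynomial σ k) M] [IsScalarTower k (MvPolynomial σ k) M]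
    (d : Derivation k (MvPolynomial σ k) M) (f : MvPolynomial σ k) :
    d f = ∑ i, pderiv i f • d (X i) := by
  classical
  induction f using MvPolynomial.induction_on with
  | C c => simp [← algebraMap_eq]
  | add p q hp hq => simp [hp, hq, add_smul, Finset.sum_add_distrib]
  | mul_X p i hp =>
    simp only [Derivation.leibniz, hp, pderiv_X, smul_eq_mul, add_smul, Finset.sum_add_distrib,
      mul_smul, Finset.smul_sum, Pi.single_apply]
    simp

variable {ι : Type*} [Fintype ι]

/-- A Lagrange system forces the objective to be algebraic over the constants modulo any prime
containing it. -/
theorem exists_aeval_mem_of_isPrime {P : Ideal (MvPolynomial σ ℝ)} [P.IsPrime]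
    {f : MvPolynomial σ ℝ} {h μ : ι → MvPolynomial σ ℝ}
    (hgrad : ∀ i, pderiv i f - ∑ j, μ j * pderiv i (h j) ∈ P) (hh : ∀ j, h j ∈ P ∨ μ j * h j ∈ P) :
    ∃ p : Polynomial ℝ, p ≠ 0 ∧ Polynomial.aeval f p ∈ P := by
  let A := MvPolynomial σ ℝ
  let K := FractionRing (A ⧸ P)
  have : Algebra.EssFiniteType (A ⧸ P) K := .of_isLocalization _ (nonZeroDivisors (A ⧸ P))
  have : Algebra.EssFiniteType ℝ K := .comp ℝ (A ⧸ P) K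
  have hker : ∀ a : A, algebraMap A K a = 0 ↔ a ∈ P := fun a => by
    rw [IsScalarTower.algebraMap_apply A (A ⧸ P) K, IsFractionRing.to_map_eq_zero_iff,
      Ideal.Quotient.algebraMap_eq, Ideal.Quotient.eq_zero_iff_mem]
  by_contra! hcon
  have hx : Transcendental ℝ (algebraMap A K f) := by
    rintro ⟨p, hp, hp0⟩
    refine hcon p hp ((hker _).1 ?_)
    rw [← hp0, Polynomial.aeval_algebraMap_apply]
  obtain ⟨D, hD⟩ := hx.exists_derivation_eq_one
  let d := D.compAlgebraMap A
  have hd : ∀ a : A, d a = D (algebraMap A K a) := fun a => rfl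
  have hzero : ∀ j, algebraMap A K (μ j) * d (h j) = 0 := by
    intro j
    have h0 : algebraMap A K (h j) = 0 → algebraMap A K (μ j) * d (h j) = 0 := fun h0 => by
      rw [hd, h0, map_zero, mul_zero]
    rcases hh j with hj | hj
    · exact h0 ((hker _).2 hj)
    · rw [← hker, map_mul, mul_eq_zero] at hj
      rcases hj with hj | hj
      · rw [hj, zero_mul]
      · exact h0 hj
  have h1 : d f = 0 := by
    have h2 : ∀ i, algebraMap A K (pderiv i f) =
        ∑ j, algebraMap A K (μ j) * algebraMap A K (pderiv i (h j)) := fun i => by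
      have := (hker _).2 (hgrad i)
      rw [map_sub, map_sum, sub_eq_zero] at this
      simpa using this
    calc d f = ∑ i, ∑ j, algebraMap A K (μ j) * algebraMap A K (pderiv i (h j)) * d (X i) := by
          rw [derivation_eq_sum d f]
          refine Finset.sum_congr rfl fun i _ => ?_
          rw [Algebra.smul_def, ← Finset.sum_mul]
          exact congrArg (· * d (X i)) (h2 i)
      _ = ∑ j, algebraMap A K (μ j) * d (h j) := by
          rw [Finset.sum_comm]
          refine Finset.sum_congr rfl fun j _ => ?_
          rw [derivation_eq_sum d (h j), Finset.mul_sum]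
          refine Finset.sum_congr rfl fun i _ => ?_
          rw [Algebra.smul_def, mul_assoc]
      _ = 0 := Finset.sum_eq_zero fun j _ => hzero j
  exact one_ne_zero (hD.symm.trans ((hd f).symm.trans h1))

/-- A Lagrange system forces the objective to be algebraic over the constants. -/
theorem exists_aeval_mem {I : Ideal (MvPolynomial σ ℝ)}
    {f : MvPolynomial σ ℝ} {h μ : ι → MvPolynomial σ ℝ}
    (hgrad : ∀ i, pderiv i f - ∑ j, μ j * pderiv i (h j) ∈ I) (hh : ∀ j, h j ∈ I ∨ μ j * h j ∈ I) :
    ∃ p : Polynomial ℝ, p ≠ 0 ∧ Polynomial.aeval f p ∈ I := by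
  have hfin := I.finite_minimalPrimes_of_isNoetherianRing
  have hP : ∀ P ∈ I.minimalPrimes, ∃ p : Polynomial ℝ, p ≠ 0 ∧ Polynomial.aeval f p ∈ P := by
    intro P hP
    have := hP.1.1
    exact exists_aeval_mem_of_isPrime (fun i => hP.1.2 (hgrad i))
      fun j => (hh j).imp (fun h => hP.1.2 h) fun h => hP.1.2 h
  choose! p hp0 hp using hP
  let q := ∏ P ∈ hfin.toFinset, p P
  have hq : Polynomial.aeval f q ∈ I.radical := by
    rw [← I.sInf_minimalPrimes, Submodule.mem_sInf]
    intro P hP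
    rw [map_prod]
    exact Ideal.mem_of_dvd _ (Finset.dvd_prod_of_mem _ (hfin.mem_toFinset.2 hP)) (hp P hP)
  obtain ⟨n, hn⟩ := hq
  exact ⟨q ^ n, pow_ne_zero _ (Finset.prod_ne_zero_iff.2 fun P hP =>
    hp0 P (hfin.mem_toFinset.1 hP)), by rwa [map_pow]⟩

end Algebraicity

section Multipliers

theorem MvPolynomial.hasStrictFDerivAt_eval {σ : Type} [Fintype σ] (p : MvPolynomial σ ℝ)
    (y : σ → ℝ) : HasStrictFDerivAt (fun y => eval y p)
      (∑ i, eval y (pderiv i p) • ContinuousLinearMap.proj (R := ℝ) (φ := fun _ : σ => ℝ) i) y := by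
  classical
  induction p using MvPolynomial.induction_on with
  | C c => simpa using hasStrictFDerivAt_const c y
  | add p q hp hq =>
    have h := hp.fun_add hq
    rw [← Finset.sum_add_distrib] at h
    simpa [add_smul] using h
  | mul_X p i hp =>
    have h := hp.fun_mul (hasStrictFDerivAt_apply (𝕜 := ℝ) (F' := fun _ : σ => ℝ) i y)
    have h' : (fun y => eval y (p * X i)) = fun y => eval y p * y i := by
      funext y
      simp
    rw [h']
    refine h.congr_fderiv (Eq.symm ?_)
    simp only [Derivation.leibniz, pderiv_X, smul_eq_mul, map_add, map_mul, eval_X, add_smul,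
      Finset.sum_add_distrib, Finset.smul_sum, smul_smul]
    congr 1
    rw [Finset.sum_eq_single i] <;> simp +contextual [eq_comm]

/-- First order necessary conditions: a Lagrange multiplier expressed through a left inverse of
the constraint matrix is nonpositive at a maximizer. -/
theorem multiplier_nonpos {m l : ℕ} {E1 E2 : Finset (Fin l)}
    (hd : Disjoint E1 E2) {h : Fin l → MvPolynomial (Fin m) ℝ} {y₀ : Fin m → ℝ}
    {B : Matrix (Fin l) (Fin m ⊕ Fin l) ℝ} (hB : B * Hmat h y₀ = 1) {f : MvPolynomial (Fin m) ℝ}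
    (hy₀ : y₀ ∈ SemiSet E1 E2 h) (hmax : ∀ y ∈ SemiSet E1 E2 h, eval y f ≤ eval y₀ f)
    {j : Fin l} (hj : j ∈ E2) : ∑ i, B j (Sum.inl i) * eval y₀ (pderiv i f) ≤ 0 := by
  let W : (Fin l → ℝ) →L[ℝ] (Fin m ⊕ Fin l → ℝ) := LinearMap.toContinuousLinearMap B.vecMulLinear
  have hW : ∀ c r, W c r = ∑ k, c k * B k r := fun c r => rfl
  let Wy : (Fin l → ℝ) →L[ℝ] (Fin m → ℝ) :=
    ContinuousLinearMap.pi fun i => (ContinuousLinearMap.proj (Sum.inl i)).comp W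
  have hWy : ∀ c i, Wy c i = W c (Sum.inl i) := fun c r => rfl
  let Y : (Fin l → ℝ) → Fin m → ℝ := fun c => y₀ + Wy c
  have hY : ∀ c, HasStrictFDerivAt Y Wy c := fun c => Wy.hasStrictFDerivAt.const_add y₀
  have hY0 : Y 0 = y₀ := by simp [Y]
  let Ψ : (Fin l → ℝ) → Fin l → ℝ := fun c i => eval (Y c) (h i) * (1 + W c (Sum.inr i))
  have hΨ0 : ∀ i, Ψ 0 i = eval y₀ (h i) := fun i => by simp [Ψ, hY0]
  have hΨ : HasStrictFDerivAt Ψ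
      ((ContinuousLinearEquiv.refl ℝ (Fin l → ℝ) : (Fin l → ℝ) →L[ℝ] (Fin l → ℝ))) 0 := by
    rw [hasStrictFDerivAt_pi']
    intro i
    have h1 : HasStrictFDerivAt (fun c => eval (Y c) (h i)) _ 0 :=
      (hY0 ▸ hasStrictFDerivAt_eval (h i) y₀ :
        HasStrictFDerivAt (fun y => eval y (h i)) _ (Y 0)).comp 0 (hY 0)
    have h2 : HasStrictFDerivAt (fun c => 1 + W c (Sum.inr i))
        ((ContinuousLinearMap.proj (Sum.inr i)).comp W) 0 :=
      ((ContinuousLinearMap.proj (R := ℝ) (φ := fun _ : Fin m ⊕ Fin l => ℝ)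
        (Sum.inr i)).comp W).hasStrictFDerivAt.const_add 1
    refine (h1.fun_mul h2).congr_fderiv (Eq.symm ?_)
    refine ContinuousLinearMap.ext fun c => ?_
    have h3 : Matrix.vecMul c (B * Hmat h y₀) i =
        Matrix.vecMul c (1 : Matrix (Fin l) (Fin l) ℝ) i := by rw [hB]
    simp only [← Matrix.vecMul_vecMul, Matrix.vecMul_one] at h3
    simp [hY0, hWy, ← h3, Matrix.vecMul, dotProduct, Hmat, hW, Fintype.sum_sum_type]
    rw [add_comm, mul_comm]
    simp_rw [mul_comm]
  let c : ℝ → Fin l → ℝ := fun τ => hΨ.localInverse Ψ _ 0 (Ψ 0 + τ • Pi.single j 1)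
  have hc : HasDerivAt c (Pi.single j 1) 0 := by
    have h1 : HasDerivAt (fun τ : ℝ => Ψ 0 + τ • (Pi.single j 1 : Fin l → ℝ)) (Pi.single j 1) 0 := by
      simpa using ((hasDerivAt_id (0 : ℝ)).smul_const (Pi.single j 1 : Fin l → ℝ)).const_add (Ψ 0)
    have h2 := hΨ.to_localInverse.hasFDerivAt
    have h3 : Ψ 0 = Ψ 0 + (0 : ℝ) • (Pi.single j 1 : Fin l → ℝ) := by simp
    rw [h3] at h2
    exact h2.comp_hasDerivAt 0 h1
  have hc0 : c 0 = 0 := by simp [c]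
  have hcΨ : ∀ᶠ τ in nhds 0, Ψ (c τ) = Ψ 0 + τ • Pi.single j 1 := by
    have : Filter.Tendsto (fun τ : ℝ => Ψ 0 + τ • (Pi.single j 1 : Fin l → ℝ)) (nhds 0)
        (nhds (Ψ 0)) := by
      refine Continuous.tendsto' (by fun_prop) _ _ (by simp)
    exact this.eventually hΨ.eventually_right_inverse
  have hpos : ∀ᶠ τ in nhds 0, ∀ i, 0 < 1 + W (c τ) (Sum.inr i) := by
    rw [Filter.eventually_all]
    intro i
    have h1 : ContinuousAt (fun τ => 1 + W (c τ) (Sum.inr i)) 0 := by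
      have := hc.continuousAt
      fun_prop
    exact h1.eventually (lt_mem_nhds (by simp [hc0]))
  have hfeas : ∀ᶠ τ in nhds 0, 0 ≤ τ → eval (Y (c τ)) f ≤ eval y₀ f := by
    filter_upwards [hcΨ, hpos] with τ h1 h2 hτ
    refine hmax _ ⟨fun i hi => ?_, fun i hi => ?_⟩
    · have h3 := congrFun h1 i
      have hij : i ≠ j := fun h => Finset.disjoint_left.1 hd hi (h ▸ hj)
      simp only [Pi.add_apply, hΨ0, hy₀.1 i hi, Pi.smul_apply, Pi.single_eq_of_ne hij, smul_zero,
        add_zero] at h3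
      exact (mul_eq_zero.1 h3).resolve_right (h2 i).ne'
    · have h3 := congrFun h1 i
      have h4 : 0 ≤ Ψ (c τ) i := by
        rw [h3, Pi.add_apply, hΨ0]
        refine add_nonneg (hy₀.2 i hi) (mul_nonneg hτ ?_)
        rw [Pi.single_apply]
        positivity
      exact nonneg_of_mul_nonneg_left h4 (h2 i)
  have hderiv : HasDerivAt (fun τ => eval (Y (c τ)) f)
      (∑ i, B j (Sum.inl i) * eval y₀ (pderiv i f)) 0 := by
    have h1 : HasDerivAt (fun τ => Y (c τ)) (Wy (Pi.single j 1)) 0 :=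
      (hY _).hasFDerivAt.comp_hasDerivAt 0 hc
    have h2 : HasFDerivAt (fun y => eval y f) _ (Y (c 0)) :=
      (hasStrictFDerivAt_eval f _).hasFDerivAt
    refine (h2.comp_hasDerivAt 0 h1).congr_deriv ?_
    simp [hc0, hY0, hWy, hW, Pi.single_apply, mul_comm]
  refine le_of_tendsto hderiv.tendsto_slope_zero_right ?_
  filter_upwards [self_mem_nhdsWithin, hfeas.filter_mono nhdsWithin_le_nhds] with τ hτ h1
  have hτ' : 0 < τ := hτ
  have h2 := h1 hτ'.le
  have h3 : eval (Y (c 0)) f = eval y₀ f := by rw [hc0, hY0]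
  rw [zero_add, h3, smul_eq_mul]
  exact mul_nonpos_of_nonneg_of_nonpos (by positivity) (by linarith)

end Multipliers

section MixedModule

theorem isSOS_iff_isSumSq {σ : Type} {p : MvPolynomial σ ℝ} : IsSOS p ↔ IsSumSq p := by
  constructor
  · rintro ⟨t, s, rfl⟩
    exact IsSumSq.isQuadModule.sum_mem _ fun i _ => by
      rw [sq]
      exact .mul_self _
  · intro h
    induction h with
    | zero => exact ⟨0, Fin.elim0, by simp⟩
    | sq_add a _ ih =>
      obtain ⟨t, s, rfl⟩ := ih
      exact ⟨t + 1, Fin.cons a s, by simp [Fin.sum_univ_succ, sq]⟩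

variable {σ : Type} {ι κ : Type*} [Fintype ι] [Fintype κ] {φ : ι → MvPolynomial σ ℝ}
  {ψ : κ → MvPolynomial σ ℝ}

theorem mem_span_range_iff_exists_sum {a : MvPolynomial σ ℝ} :
    a ∈ Ideal.span (Set.range φ) ↔ ∃ p : ι → MvPolynomial σ ℝ, a = ∑ i, φ i * p i := by
  rw [Ideal.span, Submodule.mem_span_range_iff_exists_fun]
  simp only [smul_eq_mul, mul_comm, eq_comm]

theorem inIQ_iff {a : MvPolynomial σ ℝ} : InIQ φ ψ a ↔
    ∃ i ∈ Ideal.span (Set.range φ), ∃ (s : MvPolynomial σ ℝ) (t : κ → MvPolynomial σ ℝ),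
      IsSumSq s ∧ (∀ j, IsSumSq (t j)) ∧ a = i + s + ∑ j, ψ j * t j := by
  simp only [InIQ, isSOS_iff_isSumSq, mem_span_range_iff_exists_sum]
  constructor
  · rintro ⟨p, s, t, hs, ht, rfl⟩
    exact ⟨_, ⟨p, rfl⟩, s, t, hs, ht, rfl⟩
  · rintro ⟨_, ⟨p, rfl⟩, s, t, hs, ht, rfl⟩
    exact ⟨p, s, t, hs, ht, rfl⟩

theorem InIQ.of_mem_span {a : MvPolynomial σ ℝ} (ha : a ∈ Ideal.span (Set.range φ)) :
    InIQ φ ψ a :=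
  inIQ_iff.2 ⟨a, ha, 0, 0, .zero, fun _ => .zero, by simp⟩

theorem InIQ.ineq (j : κ) : InIQ φ ψ (ψ j) := by
  classical
  refine inIQ_iff.2 ⟨0, Ideal.zero_mem _, 0, Pi.single j 1, .zero, fun k => ?_, ?_⟩
  · rw [Pi.single_apply]
    split_ifs
    · exact .one
    · exact .zero
  · simp [Pi.single_apply]

variable (φ ψ) in
theorem isQuadModule_inIQ : IsQuadModule {a | InIQ φ ψ a} where
  one := inIQ_iff.2 ⟨0, Ideal.zero_mem _, 1, 0, .one, fun _ => .zero, by simp⟩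
  add := by
    intro a b ha hb
    obtain ⟨i, hi, s, t, hs, ht, rfl⟩ := inIQ_iff.1 ha
    obtain ⟨i', hi', s', t', hs', ht', rfl⟩ := inIQ_iff.1 hb
    refine inIQ_iff.2 ⟨i + i', Ideal.add_mem _ hi hi', s + s', t + t', .add hs hs',
      fun j => .add (ht j) (ht' j), ?_⟩
    simp only [Pi.add_apply, mul_add, Finset.sum_add_distrib]
    ring
  mul_sq := by
    intro a b ha
    obtain ⟨i, hi, s, t, hs, ht, rfl⟩ := inIQ_iff.1 ha
    refine inIQ_iff.2 ⟨i * (b * b), Ideal.mul_mem_right _ _ hi, s * (b * b),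
      fun j => t j * (b * b), hs.mul (.mul_self b), fun j => (ht j).mul (.mul_self b), ?_⟩
    simp only [add_mul, Finset.sum_mul, mul_assoc]

theorem InIQ.mono {ι' κ' : Type*} [Fintype ι'] [Fintype κ'] {φ' : ι' → MvPolynomial σ ℝ}
    {ψ' : κ' → MvPolynomial σ ℝ} (hφ : ∀ i, φ i ∈ Ideal.span (Set.range φ'))
    (hψ : ∀ j, InIQ φ' ψ' (ψ j)) {a : MvPolynomial σ ℝ} (ha : InIQ φ ψ a) : InIQ φ' ψ' a := by
  obtain ⟨i, hi, s, t, hs, ht, rfl⟩ := inIQ_iff.1 ha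
  have hQ := isQuadModule_inIQ φ' ψ'
  refine hQ.add (hQ.add (.of_mem_span ?_) (hQ.isSumSq_mem hs))
    (hQ.sum_mem _ fun j _ => hQ.mul_isSumSq (hψ j) (ht j))
  exact Ideal.span_le.2 (by rintro _ ⟨i, rfl⟩; exact hφ i) hi

theorem eval_eq_zero_of_mem_span {a : MvPolynomial σ ℝ} (ha : a ∈ Ideal.span (Set.range φ))
    {x : σ → ℝ} (hx : ∀ i, eval x (φ i) = 0) : eval x a = 0 := by
  obtain ⟨p, rfl⟩ := mem_span_range_iff_exists_sum.1 ha
  simp [hx]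

theorem eval_nonneg_of_isSumSq {s : MvPolynomial σ ℝ} (hs : IsSumSq s) (x : σ → ℝ) :
    0 ≤ eval x s := by
  induction hs with
  | zero => simp
  | sq_add a _ ih =>
    rw [map_add, map_mul]
    exact add_nonneg (mul_self_nonneg _) ih

theorem forall_inIQ_eval_nonneg_iff {x : σ → ℝ} : (∀ a, InIQ φ ψ a → 0 ≤ eval x a) ↔
    (∀ i, eval x (φ i) = 0) ∧ ∀ j, 0 ≤ eval x (ψ j) := by
  constructor
  · refine fun h => ⟨fun i => ?_, fun j => h _ (.ineq j)⟩
    have hi : φ i ∈ Ideal.span (Set.range φ) := Ideal.subset_span ⟨i, rfl⟩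
    have h1 := h _ (.of_mem_span (neg_mem hi))
    rw [map_neg] at h1
    exact le_antisymm (by linarith) (h _ (.of_mem_span hi))
  · rintro ⟨h1, h2⟩ a ha
    obtain ⟨i, hi, s, t, hs, ht, rfl⟩ := inIQ_iff.1 ha
    rw [map_add, map_add, eval_eq_zero_of_mem_span hi h1, zero_add, map_sum]
    refine add_nonneg (eval_nonneg_of_isSumSq hs x) (Finset.sum_nonneg fun j _ => ?_)
    rw [map_mul]
    exact mul_nonneg (h2 j) (eval_nonneg_of_isSumSq (ht j) x)

theorem isPreord_add_isSumSq (I : Ideal (MvPolynomial σ ℝ)) :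
    IsPreord {a : MvPolynomial σ ℝ | ∃ i ∈ I, ∃ s, IsSumSq s ∧ a = i + s} where
  add := by
    rintro _ _ ⟨i, hi, s, hs, rfl⟩ ⟨i', hi', s', hs', rfl⟩
    exact ⟨i + i', I.add_mem hi hi', s + s', .add hs hs', by ring⟩
  mul := by
    rintro _ _ ⟨i, hi, s, hs, rfl⟩ ⟨i', hi', s', hs', rfl⟩
    exact ⟨i * (i' + s') + s * i', I.add_mem (I.mul_mem_right _ hi) (I.mul_mem_left _ hi'),
      s * s', .mul hs hs', by ring⟩
  sq := fun a => ⟨0, I.zero_mem, a * a, .mul_self a, by simp⟩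

theorem exists_neg_even_pow_eq {m : ℕ} {φ : ι → MvPolynomial (Fin m) ℝ}
    {a q : MvPolynomial (Fin m) ℝ}
    (h : ∀ x, (∀ i, eval x (φ i) = 0) → 0 ≤ eval x a → eval x q = 0) :
    ∃ N : ℕ, ∃ i ∈ Ideal.span (Set.range φ), ∃ s t, IsSumSq s ∧ IsSumSq t ∧
      -(q ^ (2 * N)) = i + s + a * t := by
  have hT := isPreord_add_isSumSq (Ideal.span (Set.range φ))
  have hφ : ∀ i, φ i ∈ Ideal.span (Set.range φ) := fun i => Ideal.subset_span ⟨i, rfl⟩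
  have hG : (insert a (Set.range φ ∪ Set.range fun i => -φ i)).Finite :=
    ((Set.finite_range _).union (Set.finite_range _)).insert _
  obtain ⟨N, _, ⟨i, hi, s, hs, rfl⟩, _, ⟨i', hi', s', hs', rfl⟩, h3⟩ :=
    (hT.adjoin a).exists_neg_even_pow_mem hG (by
      rintro _ (rfl | ⟨i, rfl⟩ | ⟨i, rfl⟩)
      · exact hT.mem_adjoin _
      · exact hT.subset_adjoin _ ⟨_, hφ i, 0, .zero, by simp⟩
      · exact hT.subset_adjoin _ ⟨_, neg_mem (hφ i), 0, .zero, by simp⟩) q (by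
      intro x hx
      refine h x (fun i => le_antisymm ?_ (hx _ (.inr (.inl ⟨i, rfl⟩)))) (hx _ (.inl rfl))
      have := hx _ (.inr (.inr ⟨i, rfl⟩))
      rw [map_neg] at this
      linarith)
  refine ⟨N, i + a * i', Ideal.add_mem _ hi (Ideal.mul_mem_left _ _ hi'), s, s', hs, hs', ?_⟩
  rw [h3]
  ring

/-- The product of the squared distances to the points of a finite set. -/
def sqDistProd [Fintype σ] (S : Finset (σ → ℝ)) : MvPolynomial σ ℝ :=
  ∏ u ∈ S, ∑ i, (X i - C (u i)) ^ 2

theorem eval_sqDistProd [Fintype σ] (S : Finset (σ → ℝ)) (x : σ → ℝ) :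
    eval x (sqDistProd S) = ∏ u ∈ S, ∑ i, (x i - u i) ^ 2 := by
  simp [sqDistProd, map_prod]

theorem eval_sqDistProd_eq_zero_iff [Fintype σ] (S : Finset (σ → ℝ)) (x : σ → ℝ) :
    eval x (sqDistProd S) = 0 ↔ x ∈ S := by
  rw [eval_sqDistProd, Finset.prod_eq_zero_iff]
  constructor
  · rintro ⟨u, hu, h⟩
    rw [Finset.sum_eq_zero_iff_of_nonneg fun i _ => sq_nonneg _] at h
    have : x = u := funext fun i => by
      have := h i (Finset.mem_univ i)
      rwa [sq_eq_zero_iff, sub_eq_zero] at this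
    exact this ▸ hu
  · exact fun h => ⟨x, h, by simp⟩

theorem boundsAll_inIQ_of_finite {m : ℕ} {φ : ι → MvPolynomial (Fin m) ℝ}
    {ψ : κ → MvPolynomial (Fin m) ℝ} (h : {x | ∀ i, eval x (φ i) = 0}.Finite) :
    BoundsAll {a | InIQ φ ψ a} := by
  have hQ := isQuadModule_inIQ φ ψ
  obtain ⟨N, i, hi, s, t, hs, ht, hN⟩ := exists_neg_even_pow_eq (φ := φ) (a := 1)
    (q := sqDistProd h.toFinset) fun x hx _ => by
      rw [eval_sqDistProd_eq_zero_iff]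
      simpa using hx
  have h1 : InIQ φ ψ (-(sqDistProd h.toFinset ^ (2 * N)) * sqDistProd h.toFinset ^ 2) := by
    rw [sq]
    refine hQ.mul_sq _ ?_
    rw [hN, one_mul]
    exact hQ.add (hQ.add (.of_mem_span hi) (hQ.isSumSq_mem hs)) (hQ.isSumSq_mem ht)
  refine hQ.boundsAll_of_isCompact h1 ?_
  convert h.isCompact using 1
  ext x
  have h2 := eval_sqDistProd_eq_zero_iff h.toFinset x
  simp only [Set.Finite.mem_toFinset] at h2
  rw [← h2, Set.mem_ofPred_eq, map_mul, map_neg, map_pow, map_pow, neg_mul, ← pow_add, neg_nonneg]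
  have h3 : 2 * N + 2 = 2 * (N + 1) := by ring
  rw [h3, pow_mul]
  constructor
  · intro h4
    have h5 := le_antisymm h4 (pow_nonneg (sq_nonneg _) _)
    simpa using h5
  · intro h4
    simp [h4]

theorem IsArchimedean.boundsAll {m : ℕ} {φ : ι → MvPolynomial (Fin m) ℝ}
    {ψ : κ → MvPolynomial (Fin m) ℝ} (h : IsArchimedean φ ψ) :
    BoundsAll {a | InIQ φ ψ a} := by
  obtain ⟨f, hf, hc⟩ := h
  exact (isQuadModule_inIQ φ ψ).boundsAll_of_isCompact hf hc

end MixedModule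

section Riesz

variable {σ : Type} (w : (σ →₀ ℕ) → ℝ)

/-- The Riesz functional as a linear map. -/
def rieszLin : MvPolynomial σ ℝ →ₗ[ℝ] ℝ := (basisMonomials σ ℝ).constr ℝ w

theorem rieszLin_monomial (α : σ →₀ ℕ) (c : ℝ) : rieszLin w (monomial α c) = c * w α := by
  have h : monomial α c = c • basisMonomials σ ℝ α := by simp [smul_monomial]
  rw [h, map_smul, rieszLin, Module.Basis.constr_basis, smul_eq_mul]

theorem rieszLin_apply (f : MvPolynomial σ ℝ) : rieszLin w f = riesz w f := by
  conv_lhs => rw [f.as_sum]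
  simp only [map_sum, rieszLin_monomial, riesz]

theorem rieszLin_one (h : w 0 = 1) : rieszLin w 1 = 1 := by
  have := rieszLin_monomial w 0 1
  rwa [h, mul_one] at this

variable [Fintype σ]

theorem monomial_totalDegree_le (α : σ →₀ ℕ) (c : ℝ) :
    (monomial α c : MvPolynomial σ ℝ).totalDegree ≤ ∑ i, α i := by
  have := totalDegree_monomial_le α c
  rwa [Finsupp.sum_fintype _ _ fun _ => rfl] at this

variable [DecidableEq σ]

theorem MomIdx.sum_exp_le {t : ℕ} (a : MomIdx σ t) : ∑ i, a.exp i ≤ t := a.2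

theorem MomIdx.exp_injective {t : ℕ} : Function.Injective (MomIdx.exp : MomIdx σ t → σ →₀ ℕ) := by
  intro a b h
  refine Subtype.ext (funext fun i => Fin.ext ?_)
  exact DFunLike.congr_fun h i

theorem MomIdx.exists_exp_eq {t : ℕ} {α : σ →₀ ℕ} (h : ∑ i, α i ≤ t) :
    ∃ a : MomIdx σ t, a.exp = α := by
  have hi : ∀ i, α i < t + 1 := fun i =>
    Nat.lt_succ_of_le ((Finset.single_le_sum (fun _ _ => Nat.zero_le _) (Finset.mem_univ i)).trans h)
  exact ⟨⟨fun i => ⟨α i, hi i⟩, h⟩, by ext; rfl⟩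

theorem eq_sum_momIdx {t : ℕ} {s : MvPolynomial σ ℝ} (h : s.totalDegree ≤ t) :
    s = ∑ a : MomIdx σ t, monomial a.exp (coeff a.exp s) := by
  conv_lhs => rw [s.as_sum]
  rw [← Finset.sum_image (s := Finset.univ) (g := MomIdx.exp)
    (f := fun α => monomial α (coeff α s)) fun a _ b _ hab => MomIdx.exp_injective hab]
  refine Finset.sum_subset (fun α hα => ?_) fun α _ hα => ?_
  · have h1 := (le_totalDegree hα).trans h
    rw [Finsupp.sum_fintype _ _ fun _ => rfl] at h1
    obtain ⟨a, ha⟩ := MomIdx.exists_exp_eq h1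
    exact Finset.mem_image.2 ⟨a, Finset.mem_univ _, ha⟩
  · rw [notMem_support_iff.1 hα, map_zero]

theorem rieszLin_mul_mul {d : ℕ} {s t : MvPolynomial σ ℝ} (hs : s.totalDegree ≤ d)
    (ht : t.totalDegree ≤ d) (q : MvPolynomial σ ℝ) :
    rieszLin w (q * (s * t)) = ∑ a : MomIdx σ d, coeff a.exp s *
      ∑ b : MomIdx σ d, rieszLin w (q * monomial (a.exp + b.exp) 1) * coeff b.exp t := by
  conv_lhs => rw [eq_sum_momIdx hs, eq_sum_momIdx ht, Finset.sum_mul_sum]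
  simp only [Finset.mul_sum, map_sum, monomial_mul]
  refine Finset.sum_congr rfl fun a _ => Finset.sum_congr rfl fun b _ => ?_
  have h : q * monomial (a.exp + b.exp) (coeff a.exp s * coeff b.exp t) =
      (coeff a.exp s * coeff b.exp t) • (q * monomial (a.exp + b.exp) 1) := by
    rw [← mul_smul_comm, smul_monomial, smul_eq_mul, mul_one]
  rw [h, map_smul, smul_eq_mul]
  ring

variable {w}

theorem rieszLin_mul_sq_nonneg {k : ℕ} {q s : MvPolynomial σ ℝ} (h : (locMat k q w).PosSemidef)
    (hs : s.totalDegree ≤ k - (q.totalDegree + 1) / 2) : 0 ≤ rieszLin w (q * (s * s)) := by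
  rw [rieszLin_mul_mul w hs hs]
  have := h.dotProduct_mulVec_nonneg fun a => coeff a.exp s
  simpa [dotProduct, Matrix.mulVec, locMat, rieszLin_apply] using this

theorem rieszLin_sq_nonneg {k : ℕ} {s : MvPolynomial σ ℝ} (h : (momMat k w).PosSemidef)
    (hs : s.totalDegree ≤ k) : 0 ≤ rieszLin w (s * s) := by
  rw [← one_mul (s * s), rieszLin_mul_mul w hs hs]
  have := h.dotProduct_mulVec_nonneg fun a => coeff a.exp s
  simpa [dotProduct, Matrix.mulVec, momMat, rieszLin_monomial] using this

theorem rieszLin_mul_eq_zero {k : ℕ} {q s : MvPolynomial σ ℝ} (h : locMat k q w = 0)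
    (hs : s.totalDegree ≤ k - (q.totalDegree + 1) / 2) : rieszLin w (q * s) = 0 := by
  rw [← mul_one s, rieszLin_mul_mul w hs (by simp)]
  have : ∀ a b, rieszLin w (q * monomial (MomIdx.exp a + MomIdx.exp b) 1) = 0 := fun a b => by
    rw [rieszLin_apply]
    exact congrFun (congrFun h a) b
  simp [this]

/-- The Cauchy-Schwarz inequality, degenerate case. -/
theorem rieszLin_mul_eq_zero_of_sq {k : ℕ} {a b : MvPolynomial σ ℝ} (h : (momMat k w).PosSemidef)
    (ha : a.totalDegree ≤ k) (hb : b.totalDegree ≤ k) (h0 : rieszLin w (a * a) = 0) :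
    rieszLin w (a * b) = 0 := by
  have key : ∀ r : ℝ, 0 ≤ 2 * r * rieszLin w (a * b) + rieszLin w (b * b) := by
    intro r
    have h1 := rieszLin_sq_nonneg (s := r • a + b) h
      ((totalDegree_add _ _).trans (max_le ((totalDegree_smul_le _ _).trans ha) hb))
    have h2 : (r • a + b) * (r • a + b) = (r * r) • (a * a) + (2 * r) • (a * b) + b * b := by
      simp only [smul_eq_C_mul, C_mul, map_ofNat]
      ring
    rw [h2, map_add, map_add, map_smul, map_smul, h0] at h1
    simpa using h1
  by_contra hne
  have h1 := key (-(rieszLin w (b * b) + 1) / (2 * rieszLin w (a * b)))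
  field_simp at h1
  linarith

variable {ι κ : Type*} {φ : ι → MvPolynomial σ ℝ}
  {ψ : κ → MvPolynomial σ ℝ}

/-- A property holds for the feasible points of all relaxations of large enough order. -/
def EventuallyFeasible (φ : ι → MvPolynomial σ ℝ) (ψ : κ → MvPolynomial σ ℝ)
    (P : ((σ →₀ ℕ) → ℝ) → Prop) : Prop :=
  ∀ᶠ k in Filter.atTop, ∀ w, RelaxFeasible k φ ψ w → P w

theorem EventuallyFeasible.mono {P P' : ((σ →₀ ℕ) → ℝ) → Prop} (h : EventuallyFeasible φ ψ P)
    (hP : ∀ w, P w → P' w) : EventuallyFeasible φ ψ P' :=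
  Filter.Eventually.mono h fun _ h w hw => hP w (h w hw)

theorem EventuallyFeasible.and {P P' : ((σ →₀ ℕ) → ℝ) → Prop} (h : EventuallyFeasible φ ψ P)
    (h' : EventuallyFeasible φ ψ P') : EventuallyFeasible φ ψ fun w => P w ∧ P' w :=
  Filter.Eventually.mp h (Filter.Eventually.mono h' fun _ h' h w hw => ⟨h w hw, h' w hw⟩)

theorem EventuallyFeasible.eq_zero_of_mem_span [Fintype ι] {a : MvPolynomial σ ℝ}
    (ha : a ∈ Ideal.span (Set.range φ)) :
    EventuallyFeasible φ ψ fun w => rieszLin w a = 0 := by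
  obtain ⟨p, rfl⟩ := mem_span_range_iff_exists_sum.1 ha
  have h : ∀ i, ∀ᶠ k in Filter.atTop, (p i).totalDegree ≤ k - ((φ i).totalDegree + 1) / 2 :=
    fun i => by
      filter_upwards [Filter.eventually_ge_atTop
        ((p i).totalDegree + ((φ i).totalDegree + 1) / 2)] with k hk
      omega
  filter_upwards [Filter.eventually_all.2 h] with k hk w hw
  rw [map_sum]
  exact Finset.sum_eq_zero fun i _ => rieszLin_mul_eq_zero (hw.2.2.1 i) (hk i)

theorem EventuallyFeasible.sq_nonneg (a : MvPolynomial σ ℝ) :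
    EventuallyFeasible φ ψ fun w => 0 ≤ rieszLin w (a * a) := by
  filter_upwards [Filter.eventually_ge_atTop a.totalDegree] with k hk w hw
  exact rieszLin_sq_nonneg hw.2.1 hk

theorem EventuallyFeasible.nonneg_of_isSumSq {s : MvPolynomial σ ℝ} (hs : IsSumSq s) :
    EventuallyFeasible φ ψ fun w => 0 ≤ rieszLin w s := by
  induction hs with
  | zero => exact Filter.Eventually.of_forall fun k w _ => by simp
  | sq_add a _ ih =>
    refine ((EventuallyFeasible.sq_nonneg a).and ih).mono fun w hw => ?_
    rw [map_add]
    exact add_nonneg hw.1 hw.2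

theorem EventuallyFeasible.ineq_mul_nonneg (j : κ) {s : MvPolynomial σ ℝ} (hs : IsSumSq s) :
    EventuallyFeasible φ ψ fun w => 0 ≤ rieszLin w (ψ j * s) := by
  induction hs with
  | zero => exact Filter.Eventually.of_forall fun k w _ => by simp
  | sq_add a _ ih =>
    have h : EventuallyFeasible φ ψ fun w => 0 ≤ rieszLin w (ψ j * (a * a)) := by
      filter_upwards [Filter.eventually_ge_atTop
        (a.totalDegree + ((ψ j).totalDegree + 1) / 2)] with k hk w hw
      exact rieszLin_mul_sq_nonneg (hw.2.2.2 j) (by omega)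
    refine (h.and ih).mono fun w hw => ?_
    rw [mul_add, map_add]
    exact add_nonneg hw.1 hw.2

theorem EventuallyFeasible.nonneg_of_inIQ [Fintype ι] [Fintype κ] {a : MvPolynomial σ ℝ}
    (ha : InIQ φ ψ a) :
    EventuallyFeasible φ ψ fun w => 0 ≤ rieszLin w a := by
  obtain ⟨i, hi, s, t, hs, ht, rfl⟩ := inIQ_iff.1 ha
  have h : EventuallyFeasible φ ψ fun w => ∀ j, 0 ≤ rieszLin w (ψ j * t j) :=
    (Filter.eventually_all.2 fun j => EventuallyFeasible.ineq_mul_nonneg j (ht j)).mono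
      fun k hk w hw j => hk j w hw
  refine (((eq_zero_of_mem_span hi).and (nonneg_of_isSumSq hs)).and h).mono fun w hw => ?_
  rw [map_add, map_add, hw.1.1, zero_add, map_sum]
  exact add_nonneg hw.1.2 (Finset.sum_nonneg fun j _ => hw.2 j)

theorem EventuallyFeasible.mul_eq_zero_of_sq {P : ((σ →₀ ℕ) → ℝ) → Prop} {a : MvPolynomial σ ℝ}
    (h : EventuallyFeasible φ ψ fun w => P w → rieszLin w (a * a) = 0) (b : MvPolynomial σ ℝ) :
    EventuallyFeasible φ ψ fun w => P w → rieszLin w (a * b) = 0 := by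
  filter_upwards [h, Filter.eventually_ge_atTop (max a.totalDegree b.totalDegree)]
    with k h hk w hw hP
  exact rieszLin_mul_eq_zero_of_sq hw.2.1 ((le_max_left _ _).trans hk)
    ((le_max_right _ _).trans hk) (h w hw hP)

theorem EventuallyFeasible.sq_eq_zero_of_pow {P : ((σ →₀ ℕ) → ℝ) → Prop} {a : MvPolynomial σ ℝ}
    {j : ℕ} (h : EventuallyFeasible φ ψ fun w => P w → rieszLin w (a ^ 2 ^ (j + 1)) = 0) :
    EventuallyFeasible φ ψ fun w => P w → rieszLin w (a * a) = 0 := by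
  induction j with
  | zero => simpa [sq] using h
  | succ j ih =>
    refine ih ?_
    have h1 : EventuallyFeasible φ ψ fun w =>
        P w → rieszLin w (a ^ 2 ^ (j + 1) * a ^ 2 ^ (j + 1)) = 0 := by
      simpa [← sq, ← pow_mul, ← pow_succ] using h
    simpa using h1.mul_eq_zero_of_sq 1

/-- If a module of polynomials has nonnegative moments and contains the negative of an even power
of `a`, then the second moment of `a` vanishes. -/
theorem EventuallyFeasible.sq_eq_zero_of_neg_pow_mem {P : ((σ →₀ ℕ) → ℝ) → Prop}
    {M : Set (MvPolynomial σ ℝ)} (hM : IsQuadModule M)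
    (hP : ∀ g ∈ M, EventuallyFeasible φ ψ fun w => P w → 0 ≤ rieszLin w g)
    {a : MvPolynomial σ ℝ} {N : ℕ} (h : -(a ^ (2 * N)) ∈ M) :
    EventuallyFeasible φ ψ fun w => P w → rieszLin w (a * a) = 0 := by
  have h1 : -(a ^ 2 ^ (N + 1)) ∈ M := by
    have h2 : N ≤ 2 ^ N := Nat.lt_two_pow_self.le
    convert hM.mul_sq (a ^ (2 ^ N - N)) h using 1
    rw [← pow_add, neg_mul, ← pow_add]
    congr 2
    rw [pow_succ]
    omega
  refine EventuallyFeasible.sq_eq_zero_of_pow (j := N) ?_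
  have h3 : a ^ 2 ^ (N + 1) = a ^ 2 ^ N * a ^ 2 ^ N := by rw [← pow_add, pow_succ, mul_two]
  have h4 : EventuallyFeasible φ ψ fun w => 0 ≤ rieszLin w (a ^ 2 ^ (N + 1)) :=
    h3 ▸ EventuallyFeasible.sq_nonneg _
  refine (h4.and (hP _ h1)).mono fun w hw hPw => le_antisymm ?_ hw.1
  have := hw.2 hPw
  rw [map_neg] at this
  linarith

end Riesz

section Gap

theorem IsQuadModule.add_ideal {σ : Type} {M : Set (MvPolynomial σ ℝ)} (hM : IsQuadModule M)
    (I : Ideal (MvPolynomial σ ℝ)) : IsQuadModule {a | ∃ g ∈ M, ∃ i ∈ I, a = g + i} where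
  one := ⟨1, hM.one, 0, I.zero_mem, by simp⟩
  add := by
    rintro _ _ ⟨g, hg, i, hi, rfl⟩ ⟨g', hg', i', hi', rfl⟩
    exact ⟨g + g', hM.add hg hg', i + i', I.add_mem hi hi', by ring⟩
  mul_sq := by
    rintro _ b ⟨g, hg, i, hi, rfl⟩
    exact ⟨g * (b * b), hM.mul_sq b hg, i * (b * b), I.mul_mem_right _ hi, by ring⟩

theorem IsQuadModule.preimage_mul_sq {σ : Type} {M : Set (MvPolynomial σ ℝ)}
    (hM : IsQuadModule M) (v : MvPolynomial σ ℝ) : IsQuadModule {a | a * (v * v) ∈ M} where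
  one := by simpa using hM.sq v
  add := fun {a b} ha hb => by
    have := hM.add ha hb
    rwa [← add_mul] at this
  mul_sq := fun {a} b ha => by
    have := hM.mul_sq b ha
    rwa [mul_right_comm] at this

theorem exists_pos_lt_of_isRoot {p : Polynomial ℝ} (hp : p ≠ 0) :
    ∃ δ : ℝ, 0 < δ ∧ ∀ r, 0 < r → p.IsRoot r → δ < r := by
  classical
  have h : ∀ᶠ δ in nhdsWithin (0 : ℝ) (Set.Ioi 0), ∀ r ∈ p.roots.toFinset, 0 < r → δ < r := by
    rw [Filter.eventually_all_finset]
    intro r _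
    by_cases hr : 0 < r
    · filter_upwards [nhdsWithin_le_nhds (Iio_mem_nhds hr)] with δ hδ _ using hδ
    · exact Filter.Eventually.of_forall fun _ h => absurd h hr
  obtain ⟨δ, hδ, h0⟩ := (h.and self_mem_nhdsWithin).exists
  exact ⟨δ, h0, fun r hr hroot => hδ r (by simp [hp, hroot.eq_zero]) hr⟩

theorem IsQuadModule.exists_gap {σ : Type} {M : Set (MvPolynomial σ ℝ)} (hM : IsQuadModule M)
    (hb : BoundsAll M) {I : Ideal (MvPolynomial σ ℝ)} (hI : ∀ a ∈ I, a ∈ M)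
    {c : MvPolynomial σ ℝ} (hc : ∀ x : σ → ℝ, (∀ g ∈ M, 0 ≤ eval x g) → 0 ≤ eval x c)
    {p : Polynomial ℝ} (hp : p ≠ 0) (hpI : Polynomial.aeval c p ∈ I) :
    ∃ δ : ℝ, 0 < δ ∧ ∃ u v : MvPolynomial σ ℝ, u + v = 1 ∧ (∃ N : ℕ, (c * u) ^ N ∈ I) ∧
      (c - C δ) * (v * v) ∈ M := by
  obtain ⟨q, hpq, hq⟩ := Polynomial.exists_eq_pow_rootMultiplicity_mul_and_not_dvd p hp 0
  set e := Polynomial.rootMultiplicity 0 p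
  rw [Polynomial.C_0, sub_zero] at hpq hq
  have hq0 : q ≠ 0 := by
    rintro rfl
    exact hq (dvd_zero _)
  obtain ⟨a, b, hab⟩ := ((Polynomial.irreducible_X.coprime_iff_not_dvd).2 hq).pow_left (m := e)
  obtain ⟨δ, hδ, hroot⟩ := exists_pos_lt_of_isRoot hq0
  let ev : Polynomial ℝ →ₐ[ℝ] MvPolynomial σ ℝ := Polynomial.aeval c
  have hX : ev Polynomial.X = c := Polynomial.aeval_X c
  have hpI' : ev (Polynomial.X ^ e * q) ∈ I := hpq ▸ hpI
  refine ⟨δ, hδ, ev (b * q), ev (a * Polynomial.X ^ e), ?_, ⟨e + 1, ?_⟩, ?_⟩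
  · rw [← map_add, add_comm, hab, map_one]
  · have h : (c * ev (b * q)) ^ (e + 1) = ev (Polynomial.X ^ e * q) *
        ev (Polynomial.X * b * (b * q) ^ e) := by
      simp only [map_mul, map_pow, hX]
      ring
    rw [h]
    exact I.mul_mem_right _ hpI'
  · set v := ev (a * Polynomial.X ^ e) with hv
    have hM' := hM.preimage_mul_sq v
    have hsub : M ⊆ {a | a * (v * v) ∈ M} := fun g hg => hM.mul_sq v hg
    refine hM'.mem_of_forall_pos (hb.mono hsub) fun x hx => ?_
    have hqI : ev q * (v * v) ∈ I := by
      have h : ev q * (v * v) =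
          ev (Polynomial.X ^ e * q) * ev (a * (a * Polynomial.X ^ e)) := by
        simp only [hv, map_mul, map_pow, hX]
        ring
      rw [h]
      exact I.mul_mem_right _ hpI'
    have h1 : 0 ≤ eval x (ev q) := hx _ (hI _ hqI)
    have h2 : 0 ≤ eval x (-ev q) := hx _ (hI _ (by rw [neg_mul]; exact neg_mem hqI))
    have h3 : q.eval (eval x c) = 0 := by
      have h4 : eval x (ev q) = q.eval (eval x c) := by
        rw [← Polynomial.coe_aeval_eq_eval, ← MvPolynomial.coe_aeval_eq_eval]
        exact (Polynomial.aeval_algHom_apply (MvPolynomial.aeval x) c q).symm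
      rw [← h4]
      rw [map_neg] at h2
      linarith
    have h5 : 0 ≤ eval x c := hc x fun g hg => hx g (hsub hg)
    have h6 : eval x c ≠ 0 := by
      intro h0
      rw [h0] at h3
      exact hq (Polynomial.X_dvd_iff.2 (by rwa [Polynomial.coeff_zero_eq_eval_zero]))
    have := hroot _ (lt_of_le_of_ne h5 h6.symm) h3
    rw [map_sub, eval_C]
    linarith

variable {σ : Type} [Fintype σ] [DecidableEq σ] {ι κ : Type*} [Fintype ι] [Fintype κ]
  {φ : ι → MvPolynomial σ ℝ} {ψ : κ → MvPolynomial σ ℝ}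

theorem EventuallyFeasible.of_gap {c u v : MvPolynomial σ ℝ} {δ : ℝ} (hδ : 0 < δ)
    (huv : u + v = 1) {N : ℕ} (hu : (c * u) ^ N ∈ Ideal.span (Set.range φ))
    (hv : InIQ φ ψ ((c - C δ) * (v * v))) :
    EventuallyFeasible φ ψ (fun w => 0 ≤ rieszLin w c) ∧
      ∀ g, EventuallyFeasible φ ψ fun w => rieszLin w c = 0 → rieszLin w (c * g) = 0 := by
  have hcu : ∀ g, EventuallyFeasible φ ψ fun w => rieszLin w (c * u * g) = 0 := by
    intro g
    have h1 := EventuallyFeasible.sq_eq_zero_of_neg_pow_mem (P := fun _ => True)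
      (isQuadModule_inIQ φ ψ) (fun g hg => (nonneg_of_inIQ hg).mono fun w h _ => h)
      (a := c * u) (N := N) (.of_mem_span (neg_mem (by
        rw [two_mul, pow_add]
        exact Ideal.mul_mem_left _ _ hu)))
    exact (h1.mul_eq_zero_of_sq g).mono fun w h => h trivial
  have hsplit : EventuallyFeasible φ ψ fun w => 0 ≤ rieszLin w (v * v) ∧
      δ * rieszLin w (v * v) ≤ rieszLin w c := by
    refine (((hcu (u + 2 * v)).and (nonneg_of_inIQ hv)).and
      (EventuallyFeasible.sq_nonneg v)).mono fun w ⟨⟨h1, h2⟩, h3⟩ => ⟨h3, ?_⟩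
    have h4 : c = c * u * (u + 2 * v) + ((c - C δ) * (v * v) + δ • (v * v)) := by
      rw [smul_eq_C_mul]
      linear_combination (-c * (u + v) - c) * huv
    have h5 := congrArg (rieszLin w) h4
    rw [map_add, map_add, map_smul, h1, smul_eq_mul] at h5
    linarith
  refine ⟨hsplit.mono fun w hw => (mul_nonneg hδ.le hw.1).trans hw.2, fun g => ?_⟩
  have hv0 : EventuallyFeasible φ ψ fun w => rieszLin w c = 0 → rieszLin w (v * v) = 0 :=
    hsplit.mono fun w hw h0 => le_antisymm (by nlinarith [hw.2]) hw.1
  refine ((hcu g).and (hv0.mul_eq_zero_of_sq (c * g))).mono fun w hw h0 => ?_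
  have h4 : c * g = c * u * g + v * (c * g) := by linear_combination (-c * g) * huv
  rw [h4, map_add, hw.1, hw.2 h0, add_zero]

end Gap

section Localization

theorem exists_pos_mem_of_sqDistProd_le {σ : Type} [Fintype σ] {S : Finset (σ → ℝ)}
    {Z : Set (σ → ℝ)} (h : ∀ u ∈ S, ∃ U : Set (σ → ℝ), IsOpen U ∧ u ∈ U ∧ U ∩ Z = {u}) :
    ∃ ρ : ℝ, 0 < ρ ∧ ∀ x ∈ Z, eval x (sqDistProd S) ≤ ρ → x ∈ S := by
  have h1 : ∀ u ∈ S, ∃ ε : ℝ, 0 < ε ∧ ∀ x ∈ Z, ∑ i, (x i - u i) ^ 2 < ε → x = u := by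
    intro u hu
    obtain ⟨U, hU, huU, hUZ⟩ := h u hu
    obtain ⟨r, hr, hrU⟩ := Metric.isOpen_iff.1 hU u huU
    refine ⟨r ^ 2, by positivity, fun x hx hlt => ?_⟩
    have h2 : x ∈ U ∩ Z := ⟨hrU ((dist_pi_lt_iff hr).2 fun i => ?_), hx⟩
    · rwa [hUZ] at h2
    · rw [Real.dist_eq]
      refine abs_lt_of_sq_lt_sq (lt_of_le_of_lt ?_ hlt) hr.le
      exact Finset.single_le_sum (f := fun i => (x i - u i) ^ 2) (fun _ _ => sq_nonneg _)
        (Finset.mem_univ i)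
  choose! ε hε hεx using h1
  have hpos : 0 < ∏ u ∈ S, ε u := Finset.prod_pos hε
  refine ⟨(∏ u ∈ S, ε u) / 2, by positivity, fun x hx hle => ?_⟩
  by_contra hxS
  have h3 : ∏ u ∈ S, ε u ≤ eval x (sqDistProd S) := by
    rw [eval_sqDistProd]
    refine Finset.prod_le_prod (fun u hu => (hε u hu).le) fun u hu => ?_
    by_contra hlt
    exact hxS (hεx u hu x hx (not_le.1 hlt) ▸ hu)
  linarith

/-- The monic univariate polynomial vanishing at the `i`-th coordinates of a finite set. -/
def coordPoly {σ : Type} (S : Finset (σ → ℝ)) (i : σ) : Polynomial ℝ :=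
  ∏ u ∈ S, (Polynomial.X - Polynomial.C (u i))

theorem eval_aeval_coordPoly {σ : Type} {S : Finset (σ → ℝ)} {x : σ → ℝ} (hx : x ∈ S) (i : σ) :
    eval x (Polynomial.aeval (X i : MvPolynomial σ ℝ) (coordPoly S i)) = 0 := by
  simp only [coordPoly, map_prod, map_sub, Polynomial.aeval_X, eval_X]
  refine Finset.prod_eq_zero hx ?_
  rw [Polynomial.aeval_C, algebraMap_eq, eval_C, sub_self]

variable {m : ℕ} {ι κ : Type*} [Fintype ι] [Fintype κ] {φ : ι → MvPolynomial (Fin m) ℝ}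
  {ψ : κ → MvPolynomial (Fin m) ℝ}

theorem EventuallyFeasible.coordPoly_sq_eq_zero (hb : BoundsAll {a | InIQ φ ψ a})
    {c : MvPolynomial (Fin m) ℝ}
    (hc : ∀ g, EventuallyFeasible φ ψ fun w => rieszLin w c = 0 → rieszLin w (c * g) = 0)
    {S : Finset (Fin m → ℝ)}
    (hS : ∀ x, (∀ i, eval x (φ i) = 0) → (∀ j, 0 ≤ eval x (ψ j)) → eval x c = 0 → x ∈ S)
    (hiso : ∀ u ∈ S, ∃ U : Set (Fin m → ℝ), IsOpen U ∧ u ∈ U ∧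
      U ∩ {x | ∀ i, eval x (φ i) = 0} = {u}) (i : Fin m) :
    EventuallyFeasible φ ψ fun w => rieszLin w c = 0 →
      rieszLin w (Polynomial.aeval (X i) (coordPoly S i) *
        Polynomial.aeval (X i) (coordPoly S i)) = 0 := by
  obtain ⟨ρ, hρ, hρS⟩ := exists_pos_mem_of_sqDistProd_le hiso
  have hQ := isQuadModule_inIQ φ ψ
  have hM := hQ.add_ideal (Ideal.span {c})
  set M := {a | ∃ g ∈ {a | InIQ φ ψ a}, ∃ i ∈ Ideal.span {c}, a = g + i} with hMdef
  have hQM : ∀ {a}, InIQ φ ψ a → a ∈ M := fun {a} ha => ⟨a, ha, 0, Ideal.zero_mem _, by simp⟩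
  have hcM : ∀ {a}, a ∈ Ideal.span {c} → a ∈ M := fun {a} ha => ⟨0, hQ.zero, a, ha, by simp⟩
  have hρM : C ρ - sqDistProd S ∈ M := by
    refine hM.mem_of_forall_pos (hb.mono fun a ha => hQM ha) fun x hx => ?_
    obtain ⟨h1, h2⟩ := forall_inIQ_eval_nonneg_iff.1 fun a ha => hx a (hQM ha)
    have h3 := hx c (hcM (Ideal.mem_span_singleton_self c))
    have h4 := hx (-c) (hcM (neg_mem (Ideal.mem_span_singleton_self c)))
    rw [map_neg] at h4
    have h5 := (eval_sqDistProd_eq_zero_iff S x).2 (hS x h1 h2 (by linarith))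
    rwa [map_sub, eval_C, h5, sub_zero]
  obtain ⟨N, a, ha, s, t, hs, ht, hN⟩ := exists_neg_even_pow_eq (φ := φ)
    (a := C ρ - sqDistProd S) (q := Polynomial.aeval (X i) (coordPoly S i)) fun x hx h0 => by
      rw [map_sub, eval_C, sub_nonneg] at h0
      exact eval_aeval_coordPoly (hρS x hx h0) i
  refine sq_eq_zero_of_neg_pow_mem hM ?_ (N := N) ?_
  · rintro _ ⟨g, hg, a, ha, rfl⟩
    obtain ⟨b, rfl⟩ := Ideal.mem_span_singleton.1 ha
    refine ((nonneg_of_inIQ hg).and (hc b)).mono fun w hw h0 => ?_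
    rw [map_add, hw.2 h0, add_zero]
    exact hw.1
  · rw [hN]
    exact hM.add (hM.add (hQM (.of_mem_span ha)) (hM.isSumSq_mem hs)) (hM.mul_isSumSq hρM ht)

end Localization

section Rank

theorem totalDegree_aeval_X_le {σ : Type} (i : σ) (p : Polynomial ℝ) :
    (Polynomial.aeval (X i : MvPolynomial σ ℝ) p).totalDegree ≤ p.natDegree := by
  rw [Polynomial.aeval_eq_sum_range]
  refine (totalDegree_finsetSum _ _).trans (Finset.sup_le fun n hn => ?_)
  refine (totalDegree_smul_le _ _).trans ((totalDegree_pow _ _).trans ?_)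
  rw [totalDegree_X, mul_one]
  exact Nat.lt_succ_iff.1 (Finset.mem_range.1 hn)

variable {σ : Type} [Fintype σ] [DecidableEq σ] {w : (σ →₀ ℕ) → ℝ}

theorem rank_momMat_mono {t T : ℕ} (h : t ≤ T) : (momMat t w).rank ≤ (momMat T w).rank := by
  choose f hf using fun a : MomIdx σ t => MomIdx.exists_exp_eq (a.sum_exp_le.trans h)
  have : momMat t w = (momMat T w).submatrix f f := by
    ext a b
    simp only [momMat, Matrix.of_apply, Matrix.submatrix_apply, hf]
  rw [this]
  exact Matrix.rank_submatrix_le _ _ _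

theorem rank_momMat_le {T r : ℕ} (hr : 0 < r) {P : σ → Polynomial ℝ} (hP : ∀ i, (P i).Monic)
    (hdeg : ∀ i, (P i).natDegree = r)
    (h : ∀ i (g : MvPolynomial σ ℝ), g.totalDegree ≤ 2 * T →
      rieszLin w (Polynomial.aeval (X i) (P i) * g) = 0) :
    (momMat T w).rank ≤ r ^ Fintype.card σ := by
  let L : MvPolynomial σ ℝ →ₗ[ℝ] MomIdx σ T → ℝ :=
    LinearMap.pi fun b => (rieszLin w).comp (LinearMap.mulRight ℝ (monomial b.exp 1))
  have hL : ∀ g b, L g b = rieszLin w (g * monomial b.exp 1) := fun _ _ => rfl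
  let B : (σ → Fin r) → MomIdx σ T → ℝ := fun α =>
    L (monomial (Finsupp.equivFunOnFinite.symm fun i => (α i : ℕ)) 1)
  have key : ∀ n ≤ T, ∀ g : MvPolynomial σ ℝ, g.totalDegree ≤ n →
      L g ∈ Submodule.span ℝ (Set.range B) := by
    intro n
    induction n using Nat.strong_induction_on with
    | _ n ih =>
    intro hn g hg
    rw [g.as_sum, map_sum]
    refine Submodule.sum_mem _ fun α hα => ?_
    have hαn := (le_totalDegree hα).trans hg
    rw [Finsupp.sum_fintype _ _ fun _ => rfl] at hαn
    have h1 : monomial α (coeff α g) = coeff α g • monomial α (1 : ℝ) := by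
      simp [smul_monomial]
    rw [h1, map_smul]
    refine Submodule.smul_mem _ _ ?_
    by_cases hα' : ∀ i, α i < r
    · have h2 : (Finsupp.equivFunOnFinite.symm fun i => α i) = α := by
        ext
        rfl
      refine Submodule.subset_span ⟨fun i => ⟨α i, hα' i⟩, ?_⟩
      simp only [B, h2]
    · push Not at hα'
      obtain ⟨i, hi⟩ := hα'
      obtain ⟨β, hβ⟩ : ∃ β, α = Finsupp.single i r + β :=
        exists_add_of_le (Finsupp.single_le_iff.2 hi)
      have hβn : r + ∑ j, β j ≤ n := by
        have : ∑ j, α j = r + ∑ j, β j := by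
          simp [hβ, Finset.sum_add_distrib, Finsupp.single_apply]
        omega
      set q := Polynomial.X ^ r - P i with hq
      have hqdeg : q.natDegree < r := by
        have h2 : q.degree < (P i).degree := by
          refine Polynomial.degree_sub_lt_right ?_ (hP i).ne_zero ?_
          · rw [Polynomial.degree_X_pow, Polynomial.degree_eq_natDegree (hP i).ne_zero, hdeg]
          · rw [(Polynomial.monic_X_pow r).leadingCoeff, (hP i).leadingCoeff]
        rw [Polynomial.degree_eq_natDegree (hP i).ne_zero, hdeg] at h2
        rcases eq_or_ne q 0 with h0 | h0
        · rwa [h0, Polynomial.natDegree_zero]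
        · exact (Polynomial.natDegree_lt_iff_degree_lt h0).2 h2
      have h2 : monomial α (1 : ℝ) = Polynomial.aeval (X i) (P i) * monomial β 1 +
          Polynomial.aeval (X i) q * monomial β 1 := by
        rw [hq, map_sub, map_pow, Polynomial.aeval_X, hβ, X_pow_eq_monomial, ← add_mul,
          add_sub_cancel, monomial_mul, one_mul]
      have hβdeg := monomial_totalDegree_le β 1
      rw [h2, map_add]
      refine Submodule.add_mem _ ?_ (ih (n - 1) (by omega) (by omega) _ ?_)
      · convert Submodule.zero_mem _
        ext b
        rw [hL, mul_assoc, Pi.zero_apply]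
        refine h i _ ((totalDegree_mul _ _).trans ?_)
        have := monomial_totalDegree_le b.exp 1
        have := b.sum_exp_le
        omega
      · refine (totalDegree_mul _ _).trans ?_
        have := totalDegree_aeval_X_le i q
        omega
  have hsub : Submodule.span ℝ (Set.range (momMat T w).col) ≤
      Submodule.span ℝ (Set.range B) := by
    rw [Submodule.span_le]
    rintro _ ⟨a, rfl⟩
    have hcol : (momMat T w).col a = L (monomial a.exp 1) := by
      ext b
      rw [hL, monomial_mul, rieszLin_monomial, one_mul, one_mul, add_comm]
      rfl
    rw [hcol]
    exact key T le_rfl _ ((monomial_totalDegree_le _ _).trans a.sum_exp_le)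
  rw [Matrix.rank_eq_finrank_span_cols]
  refine (Submodule.finrank_mono hsub).trans ((finrank_range_le_card B).trans_eq ?_)
  simp

/-- A bounded monotone sequence of ranks stabilizes over some window of a given length. -/
theorem exists_rank_momMat_eq {T D d : ℕ} (hT : T = (D + 1) * d) (h : (momMat T w).rank ≤ D) :
    ∃ t, d ≤ t ∧ t ≤ T ∧ (momMat t w).rank = (momMat (t - d) w).rank := by
  by_contra! hne
  have key : ∀ j ≤ D + 1, j ≤ (momMat (j * d) w).rank := by
    intro j
    induction j with
    | zero => simp
    | succ j ih =>
      intro hj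
      have h1 := hne ((j + 1) * d) (by nlinarith) (hT ▸ Nat.mul_le_mul_right d hj)
      have h2 : (j + 1) * d - d = j * d := by rw [add_mul, one_mul, Nat.add_sub_cancel]
      rw [h2] at h1
      have h3 := ih (by omega)
      have h4 := rank_momMat_mono (w := w) (t := j * d) (T := (j + 1) * d) (by nlinarith)
      omega
  have := key (D + 1) le_rfl
  rw [← hT] at this
  omega

end Rank

section Relaxation

/-- The moment sequence of a Dirac measure. -/
def diracSeq {σ : Type} (y : σ → ℝ) (α : σ →₀ ℕ) : ℝ := eval y (monomial α 1)

theorem rieszLin_diracSeq {σ : Type} (y : σ → ℝ) (f : MvPolynomial σ ℝ) :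
    rieszLin (diracSeq y) f = eval y f := by
  induction f using MvPolynomial.induction_on' with
  | monomial α c => rw [rieszLin_monomial, diracSeq, eval_monomial, eval_monomial, one_mul]
  | add p q hp hq => rw [map_add, map_add, hp, hq]

theorem relaxFeasible_diracSeq {σ : Type} [Fintype σ] [DecidableEq σ] {ι κ : Type*}
    {φ : ι → MvPolynomial σ ℝ} {ψ : κ → MvPolynomial σ ℝ} {y : σ → ℝ}
    (hφ : ∀ i, eval y (φ i) = 0) (hψ : ∀ j, 0 ≤ eval y (ψ j)) (k : ℕ) :
    RelaxFeasible k φ ψ (diracSeq y) := by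
  have hloc : ∀ q, locMat k q (diracSeq y) = eval y q •
      Matrix.vecMulVec (fun a => diracSeq y (MomIdx.exp a))
        (star fun a => diracSeq y (MomIdx.exp a)) := by
    intro q
    ext a b
    rw [locMat, Matrix.of_apply, ← rieszLin_apply, rieszLin_diracSeq, map_mul,
      ← one_mul (1 : ℝ), ← monomial_mul, map_mul]
    simp [Matrix.vecMulVec_apply, diracSeq]
  have hmom : momMat k (diracSeq y) = Matrix.vecMulVec (fun a => diracSeq y (MomIdx.exp a))
      (star fun a => diracSeq y (MomIdx.exp a)) := by
    ext a b
    rw [momMat, Matrix.of_apply, diracSeq, ← one_mul (1 : ℝ), ← monomial_mul, map_mul]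
    simp [Matrix.vecMulVec_apply, diracSeq]
  refine ⟨by simp [diracSeq], ?_, fun i => ?_, fun j => ?_⟩
  · rw [hmom]
    exact Matrix.posSemidef_vecMulVec_self_star _
  · rw [hloc, hφ, zero_smul]
  · rw [hloc]
    exact (Matrix.posSemidef_vecMulVec_self_star _).smul (hψ j)

theorem Set.Finite.of_isCompact_of_isolated {X : Type*} [TopologicalSpace X] {S : Set X}
    (hS : IsCompact S) (h : ∀ x ∈ S, ∃ U : Set X, IsOpen U ∧ x ∈ U ∧ U ∩ S ⊆ {x}) :
    S.Finite := by
  choose! U hU hxU hUS using h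
  obtain ⟨t, htS, ht, hcov⟩ := hS.elim_finite_subcover_image (b := S) (c := U) hU
    fun x hx => Set.mem_biUnion hx (hxU x hx)
  refine ht.subset fun x hx => ?_
  obtain ⟨y, hy, hxy⟩ := Set.mem_iUnion₂.1 (hcov hx)
  have : x = y := hUS y (htS hy) ⟨hxy, hx⟩
  exact this ▸ hy

variable {m : ℕ} {ι κ : Type*} [Fintype ι] [Fintype κ] {φ : ι → MvPolynomial (Fin m) ℝ}
  {ψ : κ → MvPolynomial (Fin m) ℝ}

theorem isCompact_of_boundsAll (hb : BoundsAll {a | InIQ φ ψ a}) (c : MvPolynomial (Fin m) ℝ) :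
    IsCompact {x | (∀ i, eval x (φ i) = 0) ∧ (∀ j, 0 ≤ eval x (ψ j)) ∧ eval x c = 0} := by
  obtain ⟨r, hr⟩ := hb (∑ i, X i ^ 2)
  refine Metric.isCompact_of_isClosed_isBounded ?_ ?_
  · simp only [Set.ofPred_and, Set.ofPred_forall]
    refine (isClosed_iInter fun i => isClosed_eq (continuous_eval _) continuous_const).inter
      ((isClosed_iInter fun j => isClosed_le continuous_const (continuous_eval _)).inter
        (isClosed_eq (continuous_eval _) continuous_const))
  · refine (Metric.isBounded_iff_subset_closedBall 0).2 ⟨√r, fun x hx => ?_⟩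
    have h := forall_inIQ_eval_nonneg_iff.2 ⟨hx.1, hx.2.1⟩ _ hr
    simp only [map_sub, eval_C, map_sum, map_pow, eval_X, sub_nonneg] at h
    rw [mem_closedBall_zero_iff, pi_norm_le_iff_of_nonneg (Real.sqrt_nonneg _)]
    intro i
    rw [Real.norm_eq_abs]
    refine Real.abs_le_sqrt (le_trans ?_ h)
    exact Finset.single_le_sum (f := fun i => x i ^ 2) (fun _ _ => sq_nonneg _)
      (Finset.mem_univ i)

/-- Finite convergence of the moment hierarchy together with the rank condition, for algebraic
objectives whose maximizers are isolated zeros of the equality constraints. -/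
theorem exists_relaxation_rank_eq (hb : BoundsAll {a | InIQ φ ψ a}) {f : MvPolynomial (Fin m) ℝ}
    {p : Polynomial ℝ} (hp : p ≠ 0) (hpf : Polynomial.aeval f p ∈ Ideal.span (Set.range φ))
    {y₀ : Fin m → ℝ} (hφ : ∀ i, eval y₀ (φ i) = 0) (hψ : ∀ j, 0 ≤ eval y₀ (ψ j))
    (hmax : ∀ y, (∀ i, eval y (φ i) = 0) → (∀ j, 0 ≤ eval y (ψ j)) → eval y f ≤ eval y₀ f)
    (hiso : ∀ y, (∀ i, eval y (φ i) = 0) → (∀ j, 0 ≤ eval y (ψ j)) → eval y f = eval y₀ f →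
      ∃ U : Set (Fin m → ℝ), IsOpen U ∧ y ∈ U ∧ U ∩ {x | ∀ i, eval x (φ i) = 0} = {y})
    (d : ℕ) :
    ∃ k₀ : ℕ, ∀ k ≥ k₀,
      (∃ w, RelaxFeasible k φ ψ w ∧ ∀ w', RelaxFeasible k φ ψ w' → riesz w' f ≤ riesz w f) ∧
      ∀ w, RelaxFeasible k φ ψ w →
        (∀ w', RelaxFeasible k φ ψ w' → riesz w' f ≤ riesz w f) →
        ∃ t, d ≤ t ∧ t ≤ k ∧ (momMat t w).rank = (momMat (t - d) w).rank := by
  set v := eval y₀ f with hv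
  set c := C v - f with hc
  have hcK : ∀ x : Fin m → ℝ, (∀ g ∈ {a | InIQ φ ψ a}, 0 ≤ eval x g) → 0 ≤ eval x c := by
    intro x hx
    obtain ⟨h1, h2⟩ := forall_inIQ_eval_nonneg_iff.1 hx
    rw [hc, map_sub, eval_C, sub_nonneg]
    exact hmax x h1 h2
  have hpc : Polynomial.aeval c (p.comp (Polynomial.C v - Polynomial.X)) ∈
      Ideal.span (Set.range φ) := by
    rw [Polynomial.aeval_comp]
    convert hpf using 2
    rw [map_sub, Polynomial.aeval_C, Polynomial.aeval_X, algebraMap_eq, hc, sub_sub_cancel]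
  have hp' : p.comp (Polynomial.C v - Polynomial.X) ≠ 0 := by
    intro h
    refine hp ?_
    have h1 := congrArg (fun q => q.comp (Polynomial.C v - Polynomial.X)) h
    simpa [Polynomial.comp_assoc] using h1
  obtain ⟨δ, hδ, a, b, hab, ⟨N, hN⟩, hbM⟩ := (isQuadModule_inIQ φ ψ).exists_gap hb
    (fun _ h => .of_mem_span h) hcK hp' hpc
  obtain ⟨hbound, hzero⟩ := EventuallyFeasible.of_gap hδ hab hN hbM
  have hfin := Set.Finite.of_isCompact_of_isolated (isCompact_of_boundsAll hb c) (by
    intro x hx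
    have h0 : eval x f = v := by
      have := hx.2.2
      rw [hc, map_sub, eval_C] at this
      linarith
    obtain ⟨U, hU, hxU, hUx⟩ := hiso x hx.1 hx.2.1 h0
    exact ⟨U, hU, hxU, fun y hy => hUx ▸ ⟨hy.1, hy.2.1⟩⟩)
  set S := hfin.toFinset with hSdef
  have hS : ∀ x, x ∈ S ↔
      (∀ i, eval x (φ i) = 0) ∧ (∀ j, 0 ≤ eval x (ψ j)) ∧ eval x c = 0 := by
    intro x
    rw [hSdef, Set.Finite.mem_toFinset]
    rfl
  have hcoord := fun i => EventuallyFeasible.coordPoly_sq_eq_zero hb hzero (S := S)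
    (fun x h1 h2 h3 => (hS x).2 ⟨h1, h2, h3⟩) (fun u hu => by
      obtain ⟨h1, h2, h3⟩ := (hS u).1 hu
      rw [hc, map_sub, eval_C] at h3
      exact hiso u h1 h2 (by linarith)) i
  have hS0 : 0 < S.card := Finset.card_pos.2 ⟨y₀, (hS y₀).2 ⟨hφ, hψ, by simp [hc, hv]⟩⟩
  have hdeg : ∀ i, (coordPoly S i).natDegree = S.card := fun i => by
    rw [coordPoly, Polynomial.natDegree_finsetProd_X_sub_C_eq_card]
  have hmonic : ∀ i, (coordPoly S i).Monic := fun i =>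
    Polynomial.monic_prod_of_monic _ _ fun u _ => Polynomial.monic_X_sub_C _
  have hRc : ∀ {w : (Fin m →₀ ℕ) → ℝ}, w 0 = 1 → rieszLin w c = v - riesz w f := by
    intro w hw
    have h1 : (C v : MvPolynomial (Fin m) ℝ) = v • 1 := by rw [smul_eq_C_mul, mul_one]
    rw [hc, map_sub, h1, map_smul, rieszLin_one w hw, rieszLin_apply, smul_eq_mul, mul_one]
  have hdirac : riesz (diracSeq y₀) f = v := by rw [← rieszLin_apply, rieszLin_diracSeq]
  set D := S.card ^ Fintype.card (Fin m) with hD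
  set T := (D + 1) * d with hT
  refine Filter.eventually_atTop.1 ?_
  filter_upwards [hbound, Filter.eventually_all.2 hcoord,
    Filter.eventually_ge_atTop (max (2 * T) S.card)] with k h1 h2 hk
  have hkT := (le_max_left _ _).trans hk
  have hkS := (le_max_right _ _).trans hk
  have hle : ∀ w, RelaxFeasible k φ ψ w → riesz w f ≤ v := fun w hw => by
    have := h1 w hw
    rw [hRc hw.1] at this
    linarith
  have hfeas := relaxFeasible_diracSeq hφ hψ k
  refine ⟨⟨diracSeq y₀, hfeas, fun w hw => hdirac ▸ hle w hw⟩, fun w hw hwmax => ?_⟩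
  have hwv : rieszLin w c = 0 := by
    have h3 := hwmax _ hfeas
    have h4 := hle w hw
    rw [hRc hw.1]
    linarith
  have hrank : (momMat T w).rank ≤ D := rank_momMat_le hS0 hmonic hdeg fun i g hg =>
    rieszLin_mul_eq_zero_of_sq hw.2.1
      ((totalDegree_aeval_X_le _ _).trans ((hdeg i).trans_le hkS)) (hg.trans hkT)
      (h2 i w hw hwv)
  obtain ⟨t, h5, h6, h7⟩ := exists_rank_momMat_eq hT hrank
  exact ⟨t, h5, by omega, h7⟩

theorem eval_Fsub {n : ℕ} (F : MvPolynomial (Fin n ⊕ Fin m) ℝ) (x : Fin n → ℝ) (y : Fin m → ℝ) :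
    eval y (Fsub F x) = eval (Sum.elim x y) F := by
  induction F using MvPolynomial.induction_on with
  | C a => simp [Fsub, algebraMap_eq]
  | add p q hp hq => simp only [Fsub, map_add] at *; rw [hp, hq]
  | mul_X p i hp =>
    simp only [Fsub, map_mul, aeval_X, eval_X] at *
    rw [hp]
    cases i <;> simp

end Relaxation

/-- Theorem 4.8: finite convergence, with flat truncation, of the Lasserre hierarchy for
the lower level maximization problem `max_{y ∈ Y} F(x*, y)`. -/
theorem stmt12 {n m l2 : ℕ}
    (E1Y E2Y : Finset (Fin l2)) (hYu : E1Y ∪ E2Y = Finset.univ) (hYd : Disjoint E1Y E2Y)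
    (h : Fin l2 → MvPolynomial (Fin m) ℝ)
    (H1 : Matrix (Fin l2) (Fin m ⊕ Fin l2) (MvPolynomial (Fin m) ℝ))
    (hH1 : ∀ y : Fin m → ℝ, (Matrix.of fun i j => eval y (H1 i j)) * Hmat h y = 1)
    (F : MvPolynomial (Fin n ⊕ Fin m) ℝ) (xstar : Fin n → ℝ)
    -- the problem `max_{y ∈ Y} F(x*, y)` has a maximizer
    (hmax : ∃ y0 ∈ SemiSet E1Y E2Y h, ∀ y ∈ SemiSet E1Y E2Y h,
      eval (Sum.elim xstar y) F ≤ eval (Sum.elim xstar y0) F)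
    -- Condition 4.7: (1) `IQ(h_eq, h_in)` archimedean, or (2) `φ_{x*} = 0` has finitely
    -- many real solutions, or (3) `IQ(φ_{x*}, ψ_{x*})` archimedean
    (hcond :
      IsArchimedean (fun j : ↥E1Y => h j.1) (fun j : ↥E2Y => h j.1) ∨
      {y : Fin m → ℝ | ∀ idx, eval y (phiUp E1Y E2Y h H1 (Fsub F xstar) idx) = 0}.Finite ∨
      IsArchimedean (phiUp E1Y E2Y h H1 (Fsub F xstar)) (psiUp E2Y h H1 (Fsub F xstar)))
    -- each maximizer is an isolated real solution of `φ_{x*}(y) = 0`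
    (hiso : ∀ y0 ∈ SemiSet E1Y E2Y h,
      (∀ y ∈ SemiSet E1Y E2Y h, eval (Sum.elim xstar y) F ≤ eval (Sum.elim xstar y0) F) →
      (∀ idx, eval y0 (phiUp E1Y E2Y h H1 (Fsub F xstar) idx) = 0) ∧
      ∃ U : Set (Fin m → ℝ), IsOpen U ∧ y0 ∈ U ∧
        U ∩ {y | ∀ idx, eval y (phiUp E1Y E2Y h H1 (Fsub F xstar) idx) = 0} = {y0}) :
    ∃ k0 : ℕ, ∀ k ≥ k0,
      (∃ w : (Fin m →₀ ℕ) → ℝ,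
        RelaxFeasible k (phiUp E1Y E2Y h H1 (Fsub F xstar)) (psiUp E2Y h H1 (Fsub F xstar)) w ∧
        ∀ w' : (Fin m →₀ ℕ) → ℝ,
          RelaxFeasible k (phiUp E1Y E2Y h H1 (Fsub F xstar)) (psiUp E2Y h H1 (Fsub F xstar)) w' →
          riesz w' (Fsub F xstar) ≤ riesz w (Fsub F xstar)) ∧
      ∀ w : (Fin m →₀ ℕ) → ℝ,
        RelaxFeasible k (phiUp E1Y E2Y h H1 (Fsub F xstar)) (psiUp E2Y h H1 (Fsub F xstar)) w →
        (∀ w' : (Fin m →₀ ℕ) → ℝ,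
          RelaxFeasible k (phiUp E1Y E2Y h H1 (Fsub F xstar)) (psiUp E2Y h H1 (Fsub F xstar)) w' →
          riesz w' (Fsub F xstar) ≤ riesz w (Fsub F xstar)) →
        ∃ t : ℕ, dUp E1Y E2Y h H1 (Fsub F xstar) ≤ t ∧ t ≤ k ∧
          (momMat t w).rank = (momMat (t - dUp E1Y E2Y h H1 (Fsub F xstar)) w).rank := by
  set f := Fsub F xstar with hf
  have hev : ∀ y, eval (Sum.elim xstar y) F = eval y f := fun y => (eval_Fsub F xstar y).symm
  simp only [hev] at hmax hiso
  set φ := phiUp E1Y E2Y h H1 f with hφdef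
  set ψ := psiUp E2Y h H1 f with hψdef
  have hmem : ∀ i, φ i ∈ Ideal.span (Set.range φ) := fun i => Ideal.subset_span ⟨i, rfl⟩
  have hsub : ∀ y, (∀ i, eval y (φ i) = 0) → (∀ j, 0 ≤ eval y (ψ j)) → y ∈ SemiSet E1Y E2Y h :=
    fun y h1 h2 => ⟨fun j hj => h1 (Sum.inr (Sum.inl ⟨j, hj⟩)), fun j hj => h2 (Sum.inl ⟨j, hj⟩)⟩
  have hb : BoundsAll {a | InIQ φ ψ a} := by
    rcases hcond with hc | hc | hc
    · exact hc.boundsAll.mono fun a ha => InIQ.mono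
        (fun j => hmem (Sum.inr (Sum.inl j))) (fun j => InIQ.ineq (ψ := ψ) (Sum.inl j)) ha
    · exact boundsAll_inIQ_of_finite hc
    · exact hc.boundsAll
  obtain ⟨p, hp, hpf⟩ := exists_aeval_mem (I := Ideal.span (Set.range φ)) (f := f) (h := h)
    (μ := muSub H1 f) (fun i => hmem (Sum.inl i)) fun j => by
      have hj : j ∈ E1Y ∪ E2Y := hYu ▸ Finset.mem_univ j
      exact (Finset.mem_union.1 hj).imp (fun hj => hmem (Sum.inr (Sum.inl ⟨j, hj⟩)))
        fun hj => hmem (Sum.inr (Sum.inr ⟨j, hj⟩))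
  obtain ⟨y₀, hy₀, hy₀max⟩ := hmax
  refine exists_relaxation_rank_eq hb hp hpf (hiso y₀ hy₀ hy₀max).1 (fun j => ?_)
    (fun y h1 h2 => hy₀max y (hsub y h1 h2))
    (fun y h1 h2 he => (hiso y (hsub y h1 h2) fun z hz => he ▸ hy₀max z hz).2) _
  rcases j with j | j
  · exact hy₀.2 j.1 j.2
  · have hle := multiplier_nonpos hYd (hH1 y₀) hy₀ hy₀max j.2
    simpa [hψdef, psiUp, muSub] using hle
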